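/- There exists an absolute constant A > 0 such that for every ε ∈ (0,1), every real P ≥ ε^{−10}, and every α ∈ ℝ, at least one of the following holds: (i) the discrepancy of the finite sequence of fractional parts ({pα})_{p prime, p ≤ P} is at most ε; (ii) there exists an integer ℓ with 1 ≤ ℓ ≤ A·ε^{−10} such that ‖ℓα‖ ≤ A·ε^{−10}/P. -/

import Mathlib

namespace DPM
open Finset

noncomputable def ee (x : ℝ) : ℂ := Complex.exp (Complex.I * ((2 * Real.pi * x : ℝ) : ℂ))

lemma ee_add (x y : ℝ) : ee (x + y) = ee x * ee y := by
  unfold ee; rw [← Complex.exp_add]; congr 1; push_cast; ring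

lemma ee_int (m : ℤ) : ee m = 1 := by
  unfold ee
  rw [Complex.exp_eq_one_iff]
  exact ⟨m, by push_cast; ring⟩

lemma ee_zero : ee 0 = 1 := by simpa using ee_int 0

lemma norm_ee (x : ℝ) : ‖ee x‖ = 1 := by
  unfold ee; rw [mul_comm]; exact Complex.norm_exp_ofReal_mul_I _

lemma ee_add_int (x : ℝ) (m : ℤ) : ee (x + m) = ee x := by rw [ee_add, ee_int, mul_one]

lemma ee_conj (x : ℝ) : (starRingEnd ℂ) (ee x) = ee (-x) := by
  unfold ee
  rw [← Complex.exp_conj]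
  congr 1
  rw [map_mul, Complex.conj_I, Complex.conj_ofReal]
  push_cast; ring

lemma ee_sub_le (x y : ℝ) : ‖ee x - ee y‖ ≤ 2 * Real.pi * |x - y| := by
  have h : ee x = ee y * ee (x - y) := by rw [← ee_add]; ring_nf
  have h2 : ee x - ee y = ee y * (ee (x - y) - 1) := by rw [h]; ring
  rw [h2, norm_mul, norm_ee, one_mul]
  refine (Real.norm_exp_I_mul_ofReal_sub_one_le).trans ?_
  rw [Real.norm_eq_abs, abs_mul, abs_of_pos (by positivity)]

lemma norm_ee_sub_one_ge (γ c : ℝ) (h : ∀ m : ℤ, c ≤ |γ - m|) : 4 * c ≤ ‖ee γ - 1‖ := by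
  have h1 : ee γ = ee (γ - round γ) := by
    have := ee_add_int (γ - round γ) (round γ)
    rw [← this]; congr 1; ring
  rw [h1]
  unfold ee
  rw [Complex.norm_exp_I_mul_ofReal_sub_one]
  set t := γ - round γ with ht
  have ht1 : |t| ≤ 1 / 2 := abs_sub_round γ
  have h2 : c ≤ |t| := h (round γ)
  have h3 : ‖2 * Real.sin (2 * Real.pi * t / 2)‖ = 2 * |Real.sin (Real.pi * t)| := by
    rw [Real.norm_eq_abs, abs_mul]; congr 1
    · norm_num
    · congr 2; ring
  rw [h3]
  have h4 : |Real.sin (Real.pi * t)| ≥ Real.sin (Real.pi * |t|) := by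
    rcases abs_cases t with ⟨h, _⟩ | ⟨h, _⟩
    · rw [h]; exact le_abs_self _
    · rw [h, mul_neg, Real.sin_neg]; exact neg_le_abs _
  have h5 := Real.mul_le_sin (x := Real.pi * |t|) (by positivity) (by nlinarith [Real.pi_pos])
  have h6 : 2 / Real.pi * (Real.pi * |t|) = 2 * |t| := by
    have := Real.pi_pos.ne'
    field_simp
  linarith

lemma geom_bound (γ c : ℝ) (hc : 0 < c) (h : ∀ m : ℤ, c ≤ |γ - m|) (X Y : ℕ) :
    ‖∑ n ∈ Ico X Y, ee (n * γ)‖ ≤ 1 / (2 * c) := by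
  rcases le_total X Y with hXY | hXY
  · have key : (ee γ - 1) * ∑ n ∈ Ico X Y, ee (n * γ) = ee (Y * γ) - ee (X * γ) := by
      induction Y, hXY using Nat.le_induction with
      | base => simp
      | succ k hk ih =>
        rw [Finset.sum_Ico_succ_top hk, mul_add, ih]
        have : ee ((k + 1 : ℕ) * γ) = ee γ * ee (k * γ) := by
          rw [← ee_add]; congr 1; push_cast; ring
        rw [this]; ring
    have h1 := norm_ee_sub_one_ge γ c h
    have h2 : ‖ee γ - 1‖ * ‖∑ n ∈ Ico X Y, ee (n * γ)‖ ≤ 2 := by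
      rw [← norm_mul, key]
      refine (norm_sub_le _ _).trans ?_
      rw [norm_ee, norm_ee]; norm_num
    rw [le_div_iff₀ (by positivity)]
    nlinarith [norm_nonneg (∑ n ∈ Ico X Y, ee (n * γ))]
  · rw [Finset.Ico_eq_empty_of_le hXY]; simp; positivity

lemma sum_ee_le (γ : ℝ) (X Y : ℕ) : ‖∑ n ∈ Ico X Y, ee (n * γ)‖ ≤ ((Y - X : ℕ) : ℝ) := by
  refine (norm_sum_le _ _).trans ?_
  simp [norm_ee]

lemma abel_bound (a g : ℕ → ℂ) (B : ℝ) (X Y : ℕ) (hXY : X ≤ Y)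
    (h : ∀ Z, X ≤ Z → Z ≤ Y → ‖∑ n ∈ Ico X Z, a n‖ ≤ B) :
    ‖∑ n ∈ Ico X Y, a n * g n‖ ≤ B * (‖g Y‖ + ∑ n ∈ Ico X Y, ‖g (n + 1) - g n‖) := by
  have key : ∑ n ∈ Ico X Y, a n * g n = (∑ n ∈ Ico X Y, a n) * g Y
      - ∑ n ∈ Ico X Y, (∑ k ∈ Ico X (n + 1), a k) * (g (n + 1) - g n) := by
    clear h
    induction Y, hXY using Nat.le_induction with
    | base => simp
    | succ k hk ih =>
      rw [Finset.sum_Ico_succ_top hk, ih, Finset.sum_Ico_succ_top hk, Finset.sum_Ico_succ_top hk,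
        Finset.sum_Ico_succ_top hk]
      ring
  rw [key, mul_add]
  refine (norm_sub_le _ _).trans (add_le_add ?_ ?_)
  · rw [norm_mul]; gcongr; exact h Y hXY le_rfl
  · rw [Finset.mul_sum]
    refine (norm_sum_le _ _).trans (Finset.sum_le_sum fun n hn => ?_)
    rw [Finset.mem_Ico] at hn
    rw [norm_mul]; gcongr; exact h (n + 1) (by omega) (by omega)

lemma card_modEq (A B v d : ℤ) (hAB : A ≤ B) (hd : 0 < d) :
    |((#{x ∈ Ico A B | x ≡ v [ZMOD d]} : ℕ) : ℝ) - ((B : ℝ) - A) / d| ≤ 1 := by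
  have h := Int.Ico_filter_modEq_card A B hd v
  have hd' : (0 : ℝ) < d := by exact_mod_cast hd
  have h1 : ⌈((A : ℚ) - v) / d⌉ ≤ ⌈((B : ℚ) - v) / d⌉ := by
    apply Int.ceil_le_ceil
    have : (0 : ℚ) < d := by exact_mod_cast hd
    have : (A : ℚ) ≤ B := by exact_mod_cast hAB
    gcongr
  rw [max_eq_left (by linarith)] at h
  have h2 : ((#{x ∈ Ico A B | x ≡ v [ZMOD d]} : ℕ) : ℝ)
      = ((⌈((B : ℚ) - v) / d⌉ - ⌈((A : ℚ) - v) / d⌉ : ℤ) : ℝ) := by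
    exact_mod_cast h
  rw [h2]
  have a1 := Int.le_ceil (((B : ℚ) - v) / d)
  have a2 := Int.ceil_lt_add_one (((B : ℚ) - v) / d)
  have a3 := Int.le_ceil (((A : ℚ) - v) / d)
  have a4 := Int.ceil_lt_add_one (((A : ℚ) - v) / d)
  have b1 : ((B : ℝ) - v) / d ≤ (⌈((B : ℚ) - v) / d⌉ : ℝ) := by exact_mod_cast a1
  have b2 : (⌈((B : ℚ) - v) / d⌉ : ℝ) < ((B : ℝ) - v) / d + 1 := by exact_mod_cast a2
  have b3 : ((A : ℝ) - v) / d ≤ (⌈((A : ℚ) - v) / d⌉ : ℝ) := by exact_mod_cast a3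
  have b4 : (⌈((A : ℚ) - v) / d⌉ : ℝ) < ((A : ℝ) - v) / d + 1 := by exact_mod_cast a4
  have e : ((B : ℝ) - A) / d = ((B : ℝ) - v) / d - ((A : ℝ) - v) / d := by ring
  rw [e, abs_le]
  push_cast
  constructor <;> linarith

lemma card_dvd (X Y d : ℕ) (hXY : X ≤ Y) (hd : 0 < d) :
    |((#{x ∈ Ico X Y | d ∣ x} : ℕ) : ℝ) - ((Y : ℝ) - X) / d| ≤ 1 := by
  have h := card_modEq X Y 0 d (by exact_mod_cast hXY) (by exact_mod_cast hd)
  have e : #{x ∈ Ico X Y | d ∣ x} = #{x ∈ Ico (X : ℤ) (Y : ℤ) | x ≡ 0 [ZMOD (d : ℤ)]} := by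
    apply Finset.card_bij (fun (x : ℕ) _ => (x : ℤ))
    · intro x hx
      simp only [Finset.mem_filter, Finset.mem_Ico] at hx ⊢
      refine ⟨by omega, ?_⟩
      rw [Int.modEq_zero_iff_dvd]; exact_mod_cast hx.2
    · intro x _ y _ hxy; exact_mod_cast hxy
    · intro y hy
      simp only [Finset.mem_filter, Finset.mem_Ico, Int.modEq_zero_iff_dvd] at hy
      obtain ⟨k, rfl⟩ := Int.eq_ofNat_of_zero_le (show 0 ≤ y by omega)
      refine ⟨k, ?_, rfl⟩
      simp only [Finset.mem_filter, Finset.mem_Ico]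
      exact ⟨by omega, by exact_mod_cast hy.2⟩
  rw [e]; simpa only [Int.cast_natCast] using h

lemma dvd_sum (d : ℕ) (hd : 0 < d) (γ : ℝ) (X Y : ℕ) (hXY : X ≤ Y) :
    ‖∑ n ∈ Ico X Y with d ∣ n, ee (n * γ) - (1 / d : ℝ) * ∑ n ∈ Ico X Y, ee (n * γ)‖
      ≤ 1 + 2 * Real.pi * |γ| * ((Y : ℝ) - X) := by
  have h := abel_bound (fun n => (if d ∣ n then (1 : ℂ) else 0) - (1 / d : ℝ))
    (fun n => ee (n * γ)) 1 X Y hXY ?_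
  · have e : ∑ n ∈ Ico X Y with d ∣ n, ee (n * γ) - (1 / d : ℝ) * ∑ n ∈ Ico X Y, ee (n * γ)
        = ∑ n ∈ Ico X Y, ((if d ∣ n then (1 : ℂ) else 0) - (1 / d : ℝ)) * ee (n * γ) := by
      rw [Finset.sum_filter, Finset.mul_sum, ← Finset.sum_sub_distrib]
      refine Finset.sum_congr rfl fun n _ => ?_
      split_ifs <;> ring
    rw [e]
    refine h.trans ?_
    rw [norm_ee, one_mul]
    have : ∑ n ∈ Ico X Y, ‖ee ((n + 1 : ℕ) * γ) - ee (n * γ)‖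
        ≤ ∑ n ∈ Ico X Y, 2 * Real.pi * |γ| := by
      refine Finset.sum_le_sum fun n _ => (ee_sub_le _ _).trans (le_of_eq ?_)
      congr 2; push_cast; ring
    have e2 : ∑ n ∈ Ico X Y, 2 * Real.pi * |γ| = 2 * Real.pi * |γ| * ((Y : ℝ) - X) := by
      rw [Finset.sum_const, Nat.card_Ico, nsmul_eq_mul, Nat.cast_sub hXY]; ring
    linarith
  · intro Z hXZ _
    have h := card_dvd X Z d hXZ hd
    have e : ∑ n ∈ Ico X Z, ((if d ∣ n then (1 : ℂ) else 0) - (1 / d : ℝ))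
        = ((((#{x ∈ Ico X Z | d ∣ x} : ℕ) : ℝ) - ((Z : ℝ) - X) / d : ℝ) : ℂ) := by
      rw [Finset.sum_sub_distrib, Finset.sum_boole, Finset.sum_const, Nat.card_Ico, nsmul_eq_mul,
        Nat.cast_sub hXZ]
      push_cast; ring
    rw [e, Complex.norm_real]
    exact h

end DPM

namespace DPM
open Finset

noncomputable def Phi (y : ℝ) : ℝ := Int.fract y ^ 2 - Int.fract y + 1 / 6

lemma Phi_hasSum (y : ℝ) :
    HasSum (fun n : ℕ => 1 / (n : ℝ) ^ 2 * Real.cos (2 * Real.pi * n * y)) (Real.pi ^ 2 * Phi y) := by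
  have h := hasSum_one_div_nat_pow_mul_cos (k := 1) one_ne_zero (x := Int.fract y)
    ⟨Int.fract_nonneg _, (Int.fract_lt_one _).le⟩
  convert h using 1
  · funext n
    congr 1
    have : 2 * Real.pi * n * y = 2 * Real.pi * n * Int.fract y + ((n * ⌊y⌋ : ℤ) : ℝ) * (2 * Real.pi) := by
      conv_lhs => rw [← Int.floor_add_fract y]
      push_cast; ring
    rw [this, Real.cos_add_int_mul_two_pi]
  · simp [Phi, Polynomial.bernoulli_def, Finset.sum_range_succ, Nat.choose, bernoulli_one]
    ring

lemma Phi_up (y δ : ℝ) (h0 : 0 < δ) (h1 : δ ≤ 1) :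
    Phi (y + δ) - Phi y ≤ 2 * δ * Int.fract y + δ ^ 2 - δ := by
  unfold Phi
  have e : Int.fract (y + δ) = Int.fract (Int.fract y + δ) := by
    conv_lhs => rw [← Int.fract_add_floor y]
    rw [show Int.fract y + ⌊y⌋ + δ = Int.fract y + δ + ⌊y⌋ by ring, Int.fract_add_intCast]
  have f0 := Int.fract_nonneg y
  have f1 := Int.fract_lt_one y
  rw [e]
  set f := Int.fract y
  by_cases h : f + δ < 1
  · rw [Int.fract_eq_self.2 ⟨by linarith, h⟩]; nlinarith
  · have : Int.fract (f + δ) = f + δ - 1 := by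
      rw [Int.fract_eq_iff]; exact ⟨by linarith, by linarith, 1, by push_cast; ring⟩
    rw [this]; nlinarith

lemma Phi_down (w δ : ℝ) (h0 : 0 < δ) (h1 : δ ≤ 1) :
    2 * δ * Int.fract w - δ ^ 2 - δ + 2 * max 0 (δ - Int.fract w) ≤ Phi w - Phi (w - δ) := by
  unfold Phi
  have e : Int.fract (w - δ) = Int.fract (Int.fract w - δ) := by
    conv_lhs => rw [← Int.fract_add_floor w]
    rw [show Int.fract w + ⌊w⌋ - δ = Int.fract w - δ + ⌊w⌋ by ring, Int.fract_add_intCast]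
  have f0 := Int.fract_nonneg w
  have f1 := Int.fract_lt_one w
  rw [e]
  set f := Int.fract w
  by_cases h : δ ≤ f
  · rw [Int.fract_eq_self.2 ⟨by linarith, by linarith⟩, max_eq_left (by linarith)]; nlinarith
  · have : Int.fract (f - δ) = f - δ + 1 := by
      rw [Int.fract_eq_iff]; exact ⟨by linarith, by linarith, -1, by push_cast; ring⟩
    rw [this, max_eq_right (by linarith)]; nlinarith

lemma trap_ge (x a b δ : ℝ) (h0 : 0 < δ) (h1 : δ ≤ 1) :
    (⌊x - a⌋ : ℝ) - ⌊x - b⌋ + max 0 (1 - Int.fract (x - b) / δ) ≤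
    b - a + δ + 1 / (2 * δ) * (-Phi (x - a + δ) + Phi (x - a) + Phi (x - b) - Phi (x - b - δ)) := by
  have u := Phi_up (x - a) δ h0 h1
  have d := Phi_down (x - b) δ h0 h1
  have e1 := Int.floor_add_fract (x - a)
  have e2 := Int.floor_add_fract (x - b)
  have e3 : max 0 (1 - Int.fract (x - b) / δ) = max 0 (δ - Int.fract (x - b)) / δ := by
    rw [← max_div_div_right h0.le, zero_div, sub_div, div_self h0.ne']
  rw [e3]
  set m := max 0 (δ - Int.fract (x - b))
  have : 2 * δ * (Int.fract (x - b) - Int.fract (x - a) - δ) + 2 * m ≤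
    (-Phi (x - a + δ) + Phi (x - a) + Phi (x - b) - Phi (x - b - δ)) := by nlinarith
  have h3 : 1 / (2 * δ) * (2 * δ * (Int.fract (x - b) - Int.fract (x - a) - δ) + 2 * m) ≤
    1 / (2 * δ) * (-Phi (x - a + δ) + Phi (x - a) + Phi (x - b) - Phi (x - b - δ)) := by gcongr
  have h4 : 1 / (2 * δ) * (2 * δ * (Int.fract (x - b) - Int.fract (x - a) - δ) + 2 * m)
    = (Int.fract (x - b) - Int.fract (x - a) - δ) + m / δ := by field_simp
  linarith

lemma trap_sum (s : Finset ℕ) (x : ℕ → ℝ) (a b δ σ : ℝ) (h0 : 0 < δ) (hσ : 0 ≤ σ) (N0 : ℕ) (hN : 1 ≤ N0)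
    (hS : ∀ n : ℕ, 1 ≤ n → n ≤ N0 → ‖∑ k ∈ s, ee (n * x k)‖ ≤ σ * #s) :
    Real.pi ^ 2 * ∑ k ∈ s, (-Phi (x k - a + δ) + Phi (x k - a) + Phi (x k - b) - Phi (x k - b - δ))
      ≤ 4 * Real.pi * δ * σ * #s * (1 + Real.log N0) + 4 * #s / N0 := by
  set f : ℕ → ℝ := fun n => ∑ k ∈ s,
    (-(1 / (n : ℝ) ^ 2 * Real.cos (2 * Real.pi * n * (x k - a + δ)))
      + 1 / (n : ℝ) ^ 2 * Real.cos (2 * Real.pi * n * (x k - a))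
      + 1 / (n : ℝ) ^ 2 * Real.cos (2 * Real.pi * n * (x k - b))
      - 1 / (n : ℝ) ^ 2 * Real.cos (2 * Real.pi * n * (x k - b - δ))) with hf
  have hsum : HasSum f (Real.pi ^ 2 * ∑ k ∈ s,
      (-Phi (x k - a + δ) + Phi (x k - a) + Phi (x k - b) - Phi (x k - b - δ))) := by
    rw [Finset.mul_sum]
    apply hasSum_sum
    intro k _
    have e : Real.pi ^ 2 * (-Phi (x k - a + δ) + Phi (x k - a) + Phi (x k - b) - Phi (x k - b - δ))
      = -(Real.pi ^ 2 * Phi (x k - a + δ)) + Real.pi ^ 2 * Phi (x k - a) + Real.pi ^ 2 * Phi (x k - b)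
        - Real.pi ^ 2 * Phi (x k - b - δ) := by ring
    rw [e]
    exact (((Phi_hasSum (x k - a + δ)).neg.add (Phi_hasSum (x k - a))).add
      (Phi_hasSum (x k - b))).sub (Phi_hasSum (x k - b - δ))
  have hfn : ∀ n : ℕ, f n ≤ 1 / (n : ℝ) ^ 2 * (‖∑ k ∈ s, ee (n * x k)‖ *
      ‖ee (-(n * a)) - ee (-(n * (a - δ))) + (ee (-(n * b)) - ee (-(n * (b + δ))))‖) := by
    intro n
    have e : f n = 1 / (n : ℝ) ^ 2 * ((∑ k ∈ s, ee (n * x k)) *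
      (ee (-(n * a)) - ee (-(n * (a - δ))) + (ee (-(n * b)) - ee (-(n * (b + δ)))))).re := by
      have hc : ∀ y : ℝ, Real.cos (2 * Real.pi * y) = (ee y).re := by
        intro y
        unfold ee
        rw [mul_comm Complex.I, Complex.exp_ofReal_mul_I_re]
      rw [Finset.sum_mul, Complex.re_sum, Finset.mul_sum, hf]
      refine Finset.sum_congr rfl fun k _ => ?_
      have ex : ee (n * x k) * (ee (-(n * a)) - ee (-(n * (a - δ))) + (ee (-(n * b)) - ee (-(n * (b + δ)))))
        = ee (n * x k + -(n * a)) - ee (n * x k + -(n * (a - δ))) +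
          (ee (n * x k + -(n * b)) - ee (n * x k + -(n * (b + δ)))) := by
        simp only [ee_add]; ring
      rw [ex]
      simp only [Complex.add_re, Complex.sub_re, ← hc]
      rw [show 2 * Real.pi * (n * x k + -(n * a)) = 2 * Real.pi * n * (x k - a) by ring,
        show 2 * Real.pi * (n * x k + -(n * (a - δ))) = 2 * Real.pi * n * (x k - a + δ) by ring,
        show 2 * Real.pi * (n * x k + -(n * b)) = 2 * Real.pi * n * (x k - b) by ring,
        show 2 * Real.pi * (n * x k + -(n * (b + δ))) = 2 * Real.pi * n * (x k - b - δ) by ring]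
      ring
    rw [e, ← norm_mul]
    gcongr
    exact Complex.re_le_norm _
  have b1 : ∀ n : ℕ, 1 ≤ n → n ≤ N0 → f n ≤ 4 * Real.pi * δ * σ * #s * (n : ℝ)⁻¹ := by
    intro n h1 h2
    have hn : (0 : ℝ) < n := by exact_mod_cast h1
    refine (hfn n).trans ?_
    have t1 : ‖ee (-(n * a)) - ee (-(n * (a - δ))) + (ee (-(n * b)) - ee (-(n * (b + δ))))‖
        ≤ 4 * Real.pi * n * δ := by
      refine (norm_add_le _ _).trans ?_
      have h1' := ee_sub_le (-(n * a)) (-(n * (a - δ)))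
      have h2' := ee_sub_le (-(n * b)) (-(n * (b + δ)))
      have e1 : |-(n * a) - -(n * (a - δ))| = n * δ := by
        rw [show -(n * a) - -(n * (a - δ)) = -(n * δ) by ring, abs_neg, abs_of_pos (by positivity)]
      have e2 : |-(n * b) - -(n * (b + δ))| = n * δ := by
        rw [show -(n * b) - -(n * (b + δ)) = n * δ by ring, abs_of_pos (by positivity)]
      rw [e1] at h1'; rw [e2] at h2'
      linarith
    calc _ ≤ 1 / (n : ℝ) ^ 2 * ((σ * #s) * (4 * Real.pi * n * δ)) := by
          gcongr; exact hS n h1 h2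
      _ = _ := by field_simp
  have b2 : ∀ n : ℕ, f n ≤ 4 * #s * ((n : ℝ) ^ 2)⁻¹ := by
    intro n
    refine (hfn n).trans ?_
    have t1 : ‖ee (-(n * a)) - ee (-(n * (a - δ))) + (ee (-(n * b)) - ee (-(n * (b + δ))))‖
        ≤ 4 := by
      refine (norm_add_le _ _).trans ?_
      have h1 := norm_sub_le (ee (-(n * a))) (ee (-(n * (a - δ))))
      have h2 := norm_sub_le (ee (-(n * b))) (ee (-(n * (b + δ))))
      simp only [norm_ee] at h1 h2
      linarith
    have t2 : ‖∑ k ∈ s, ee (n * x k)‖ ≤ #s := by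
      refine (norm_sum_le _ _).trans ?_
      simp [norm_ee]
    calc _ ≤ 1 / (n : ℝ) ^ 2 * (#s * 4) := by gcongr
      _ = _ := by ring
  refine le_of_tendsto hsum.tendsto_sum_nat ?_
  filter_upwards [Filter.eventually_ge_atTop (N0 + 1)] with M hM
  have f0 : f 0 = 0 := by simp [hf]
  have split : ∑ i ∈ range M, f i = f 0 + ∑ i ∈ Icc 1 N0, f i + ∑ i ∈ Ioc N0 (M - 1), f i := by
    have r : range M = insert 0 (Icc 1 N0 ∪ Ioc N0 (M - 1)) := by
      ext i; simp only [Finset.mem_range, Finset.mem_insert, Finset.mem_union, Finset.mem_Icc,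
        Finset.mem_Ioc]; omega
    rw [r, Finset.sum_insert (by simp), Finset.sum_union, add_assoc]
    rw [Finset.disjoint_left]; intro i; simp only [Finset.mem_Icc, Finset.mem_Ioc]; omega
  rw [split, f0, zero_add]
  apply add_le_add
  · calc _ ≤ ∑ i ∈ Icc 1 N0, 4 * Real.pi * δ * σ * #s * (i : ℝ)⁻¹ := by
          refine Finset.sum_le_sum fun i hi => ?_
          rw [Finset.mem_Icc] at hi; exact b1 i hi.1 hi.2
      _ ≤ _ := by
          rw [← Finset.mul_sum]
          gcongr
          have := harmonic_le_one_add_log N0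
          rw [harmonic_eq_sum_Icc] at this
          push_cast at this
          exact this
  · calc _ ≤ ∑ i ∈ Ioc N0 (M - 1), 4 * #s * ((i : ℝ) ^ 2)⁻¹ :=
          Finset.sum_le_sum fun i _ => b2 i
      _ ≤ _ := by
          rw [← Finset.mul_sum, div_eq_mul_inv]
          gcongr
          have := sum_Ioc_inv_sq_le_sub (α := ℝ) (k := N0) (n := M - 1) (by omega) (by omega)
          have h3 : (0 : ℝ) ≤ ((M - 1 : ℕ) : ℝ)⁻¹ := by positivity
          linarith

lemma arc_exp (ε : ℝ) (he : 0 < ε) (he1 : ε < 1) (s G : Finset ℕ) (hGs : G ⊆ s) (x : ℕ → ℝ) (a b : ℝ)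
    (hab : a ≤ b)
    (hG : ∀ k ∈ G, (1 : ℤ) ≤ ⌊x k - a⌋ - ⌊x k - b⌋ ∨ Int.fract (x k - b) = 0)
    (hbig : (b - a + ε) * #s < #G) :
    ∃ n : ℕ, 1 ≤ n ∧ (n : ℝ) ≤ 17 / ε ^ 2 ∧
      ε * √ε / 64 * #s < ‖∑ k ∈ s, ee (n * x k)‖ := by
  by_contra hcon
  push Not at hcon
  set N0 := ⌊17 / ε ^ 2⌋₊ with hN0
  have he2 : ε ^ 2 ≤ 1 := by nlinarith
  have hA : (1 : ℝ) ≤ 1 / ε ^ 2 := by rw [le_div_iff₀ (by positivity)]; linarith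
  have hB : 17 / ε ^ 2 = 17 * (1 / ε ^ 2) := by ring
  have hN0r : (16 / ε ^ 2 : ℝ) ≤ N0 := by
    have := (Nat.lt_floor_add_one (17 / ε ^ 2)).le
    rw [← hN0] at this
    have hC : 16 / ε ^ 2 = 16 * (1 / ε ^ 2) := by ring
    rw [hB] at this; rw [hC]; linarith
  have hN0u : (N0 : ℝ) ≤ 17 / ε ^ 2 := Nat.floor_le (by positivity)
  have hN1 : 1 ≤ N0 := by
    have : (1 : ℝ) ≤ N0 := by
      have hC : 16 / ε ^ 2 = 16 * (1 / ε ^ 2) := by ring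
      linarith
    exact_mod_cast this
  have hN0pos : (0 : ℝ) < N0 := by exact_mod_cast hN1
  have hts := trap_sum s x a b (ε / 2) (ε * √ε / 64) (by positivity) (by positivity) N0 hN1
    (fun n h1 h2 => hcon n h1 (le_trans (by exact_mod_cast h2) hN0u))
  set K : ℝ := (#s : ℝ) with hK
  set W := ∑ k ∈ s, (-Phi (x k - a + ε / 2) + Phi (x k - a) + Phi (x k - b) - Phi (x k - b - ε / 2))
    with hW
  have hK0 : 0 ≤ K := by positivity
  -- lower bound
  have hlow : (#G : ℝ) ≤ (b - a + ε / 2) * K + 1 / ε * W := by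
    have e : (b - a + ε / 2) * K + 1 / ε * W = ∑ k ∈ s, (b - a + ε / 2 + 1 / (2 * (ε / 2)) *
        (-Phi (x k - a + ε / 2) + Phi (x k - a) + Phi (x k - b) - Phi (x k - b - ε / 2))) := by
      rw [Finset.sum_add_distrib, Finset.sum_const, nsmul_eq_mul, ← Finset.mul_sum]
      rw [show 2 * (ε / 2) = ε by ring]; ring
    rw [e]
    have h1 : (#G : ℝ) = ∑ k ∈ s, if k ∈ G then (1 : ℝ) else 0 := by
      rw [Finset.sum_ite_mem, Finset.inter_eq_right.2 hGs]; simp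
    rw [h1]
    refine Finset.sum_le_sum fun k _ => ?_
    refine le_trans ?_ (trap_ge (x k) a b (ε / 2) (by positivity) (by linarith))
    have hm : ⌊x k - b⌋ ≤ ⌊x k - a⌋ := Int.floor_le_floor (by linarith)
    have hm' : (⌊x k - b⌋ : ℝ) ≤ ⌊x k - a⌋ := by exact_mod_cast hm
    have hm0 := le_max_left 0 (1 - Int.fract (x k - b) / (ε / 2))
    split_ifs with hkG
    · rcases hG k hkG with h | h
      · have : (1 : ℝ) ≤ ⌊x k - a⌋ - ⌊x k - b⌋ := by exact_mod_cast h
        linarith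
      · have : (1 : ℝ) ≤ max 0 (1 - Int.fract (x k - b) / (ε / 2)) := by rw [h]; simp
        linarith
    · linarith
  have hW2 : W ≤ K * ε ^ 2 * (1 / 4) := by
    have hpi := Real.pi_gt_three
    have hpi4 := Real.pi_le_four
    have l1 : Real.log N0 ≤ 3 + 4 / √ε := by
      have : Real.log N0 ≤ Real.log (17 / ε ^ 2) := Real.log_le_log hN0pos hN0u
      have h17 : Real.log 17 ≤ 3 := by
        rw [Real.log_le_iff_le_exp (by norm_num)]
        have := Real.exp_one_gt_d9
        have h3 : Real.exp 3 = Real.exp 1 ^ 3 := by rw [← Real.exp_nat_mul]; norm_num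
        rw [h3]
        calc (17 : ℝ) ≤ 2.7 ^ 3 := by norm_num
          _ ≤ _ := by gcongr; linarith
      have e : Real.log (17 / ε ^ 2) = Real.log 17 + 4 * Real.log (1 / √ε) := by
        rw [Real.log_div (by norm_num) (by positivity), Real.log_div (by norm_num) (by positivity),
          Real.log_sqrt he.le, Real.log_pow, Real.log_one]
        push_cast; ring
      have h2 : Real.log (1 / √ε) ≤ 1 / √ε := by
        have := Real.log_le_sub_one_of_pos (show 0 < 1 / √ε by positivity)
        linarith
      have h4 : 4 / √ε = 4 * (1 / √ε) := by ring
      rw [h4]; linarith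
    have hs1 : √ε ≤ 1 := by rw [show (1 : ℝ) = √1 by simp]; exact Real.sqrt_le_sqrt he1.le
    have hsp : 0 < √ε := by positivity
    have l2 : √ε * (1 + Real.log N0) ≤ 8 := by
      have : √ε * (1 + Real.log N0) ≤ √ε * (1 + (3 + 4 / √ε)) := by gcongr
      have e : √ε * (1 + (3 + 4 / √ε)) = 4 * √ε + 4 := by field_simp; ring
      linarith
    have l3 : 4 * K / N0 ≤ K * ε ^ 2 / 4 := by
      calc 4 * K / N0 ≤ 4 * K / (16 / ε ^ 2) := by gcongr
        _ = _ := by field_simp; ring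
    have l4 : 4 * Real.pi * (ε / 2) * (ε * √ε / 64) * K * (1 + Real.log N0) ≤
        K * ε ^ 2 * (Real.pi / 4) := by
      calc _ = K * ε ^ 2 * (Real.pi / 32) * (√ε * (1 + Real.log N0)) := by ring
        _ ≤ K * ε ^ 2 * (Real.pi / 32) * 8 := by gcongr
        _ = _ := by ring
    have hX : 0 ≤ K * ε ^ 2 := by positivity
    have l5 : Real.pi ^ 2 * W ≤ Real.pi ^ 2 * (K * ε ^ 2 * (1 / 4)) := by
      have : Real.pi / 4 + 1 / 4 ≤ Real.pi ^ 2 * (1 / 4) := by nlinarith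
      nlinarith [mul_le_mul_of_nonneg_left this hX]
    exact le_of_mul_le_mul_left l5 (by positivity)
  have h5 : 1 / ε * W ≤ K * ε * (1 / 4) := by
    calc 1 / ε * W ≤ 1 / ε * (K * ε ^ 2 * (1 / 4)) := by gcongr
      _ = _ := by field_simp
  nlinarith

lemma disc_exp (ε : ℝ) (he : 0 < ε) (he1 : ε < 1) (s : Finset ℕ) (hs : s.Nonempty) (x : ℕ → ℝ)
    (hx0 : ∀ k, 0 ≤ x k) (hx1 : ∀ k, x k < 1) (I : Set ℝ) (hI : I ⊆ Set.Icc 0 1) (hc : I.OrdConnected)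
    (G : Finset ℕ) (hG : ∀ k, k ∈ G ↔ k ∈ s ∧ x k ∈ I)
    (hbig : ε < |(#G : ℝ) / #s - (MeasureTheory.volume I).toReal|) :
    ∃ n : ℕ, 1 ≤ n ∧ (n : ℝ) ≤ 17 / ε ^ 2 ∧
      ε * √ε / 64 * #s < ‖∑ k ∈ s, ee (n * x k)‖ := by
  classical
  have hK : (0 : ℝ) < #s := by exact_mod_cast hs.card_pos
  have hGs : G ⊆ s := fun k hk => ((hG k).1 hk).1
  rcases I.eq_empty_or_nonempty with rfl | hne
  · have : G = ∅ := by ext k; rw [hG]; simp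
    rw [this] at hbig; simp at hbig; linarith
  have bb : BddBelow I := ⟨0, fun y hy => (hI hy).1⟩
  have ba : BddAbove I := ⟨1, fun y hy => (hI hy).2⟩
  set a := sInf I with ha
  set b := sSup I with hb
  have hab : a ≤ b := csInf_le_csSup hne bb ba
  have hb1 : b ≤ 1 := csSup_le hne fun y hy => (hI hy).2
  have ha0 : 0 ≤ a := le_csInf hne fun y hy => (hI hy).1
  have sub1 : Set.Ioo a b ⊆ I := IsConnected.Ioo_csInf_csSup_subset ⟨hne, hc.isPreconnected⟩ bb ba
  have sub2 : I ⊆ Set.Icc a b := fun y hy => ⟨csInf_le bb hy, le_csSup ba hy⟩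
  have hvol : (MeasureTheory.volume I).toReal = b - a := by
    have h1 := MeasureTheory.measure_mono (μ := MeasureTheory.volume) sub1
    have h2 := MeasureTheory.measure_mono (μ := MeasureTheory.volume) sub2
    rw [Real.volume_Ioo] at h1
    rw [Real.volume_Icc] at h2
    rw [le_antisymm h2 h1, ENNReal.toReal_ofReal (by linarith)]
  rw [hvol] at hbig
  rcases lt_abs.1 hbig with h | h
  · apply arc_exp ε he he1 s G hGs x a b hab
    · intro k hk
      have hxI := sub2 ((hG k).1 hk).2
      rcases hxI.2.lt_or_eq with hlt | heq
      · left
        have h1 : 0 ≤ ⌊x k - a⌋ := Int.floor_nonneg.2 (by linarith [hxI.1])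
        have h2 : ⌊x k - b⌋ < 0 := by rw [Int.floor_lt]; push_cast; linarith
        omega
      · right; rw [heq, sub_self, Int.fract_zero]
    · have : b - a + ε < #G / (#s : ℝ) := by linarith
      rwa [lt_div_iff₀ hK] at this
  · apply arc_exp ε he he1 s (s \ G) Finset.sdiff_subset x b (a + 1) (by linarith)
    · intro k hk
      rw [Finset.mem_sdiff, hG] at hk
      have hnI : ¬ (x k ∈ I) := fun hh => hk.2 ⟨hk.1, hh⟩
      have hor : x k ≤ a ∨ b ≤ x k := by
        by_contra hcon; push Not at hcon; exact hnI (sub1 hcon)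
      have e : x k - (a + 1) = x k - a - (1 : ℤ) := by push_cast; ring
      rw [e, Int.floor_sub_intCast, Int.fract_sub_intCast]
      rcases hor with hle | hle
      · rcases hle.lt_or_eq with hlt | heq
        · left
          have h1 : -1 ≤ ⌊x k - b⌋ := by rw [Int.le_floor]; push_cast; linarith [hx0 k]
          have h2 : ⌊x k - a⌋ < 0 := by rw [Int.floor_lt]; push_cast; linarith
          omega
        · right; rw [heq, sub_self, Int.fract_zero]
      · left
        have h1 : 0 ≤ ⌊x k - b⌋ := Int.floor_nonneg.2 (by linarith)
        have h2 : ⌊x k - a⌋ < 1 := by rw [Int.floor_lt]; push_cast; linarith [hx1 k]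
        omega
    · rw [Finset.card_sdiff_of_subset hGs, Nat.cast_sub (Finset.card_le_card hGs)]
      have : #G / (#s : ℝ) < b - a - ε := by linarith
      rw [div_lt_iff₀ hK] at this
      nlinarith

end DPM

namespace DPM
open Finset

noncomputable def nd (t : ℝ) : ℝ := |t - round t|

lemma nd_nonneg (t : ℝ) : 0 ≤ nd t := abs_nonneg _

lemma nd_le (t : ℝ) (m : ℤ) : nd t ≤ |t - m| := round_le t m

noncomputable def mn (X γ : ℝ) : ℝ := if X * nd γ ≤ 1 then X else 1 / nd γ

lemma mn_nonneg (X γ : ℝ) (hX : 0 ≤ X) : 0 ≤ mn X γ := by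
  unfold mn; split_ifs
  · exact hX
  · exact div_nonneg zero_le_one (nd_nonneg _)

lemma mn_le (X γ : ℝ) : mn X γ ≤ X := by
  unfold mn; split_ifs with h
  · exact le_rfl
  · push Not at h
    have h0 : 0 < nd γ := by
      rcases (nd_nonneg γ).eq_or_lt with h1 | h1
      · rw [← h1] at h; linarith
      · exact h1
    rw [div_le_iff₀ h0]; exact h.le

lemma mn_nd (X γ : ℝ) : mn X γ * nd γ ≤ 1 := by
  unfold mn; split_ifs with h
  · exact h
  · rcases (nd_nonneg γ).eq_or_lt with h1 | h1
    · rw [← h1]; simp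
    · rw [div_mul_cancel₀ _ h1.ne']

lemma le_mn (X γ S : ℝ) (h1 : S ≤ X) (h2 : S * nd γ ≤ 1) : S ≤ mn X γ := by
  unfold mn; split_ifs with h
  · exact h1
  · rcases (nd_nonneg γ).eq_or_lt with h3 | h3
    · rw [← h3] at h; simp at h
    · rw [le_div_iff₀ h3]; exact h2

lemma geom_mn (X γ : ℝ) (A B : ℕ) (h : (B : ℝ) - A ≤ X) (hX : 0 ≤ X) :
    ‖∑ n ∈ Ico A B, ee (n * γ)‖ ≤ mn X γ := by
  apply le_mn
  · refine (sum_ee_le γ A B).trans ?_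
    rcases le_total A B with h1 | h1
    · rw [Nat.cast_sub h1]; exact h
    · rw [Nat.sub_eq_zero_of_le h1]; simpa using hX
  · rcases (nd_nonneg γ).eq_or_lt with h3 | h3
    · rw [← h3]; simp
    · have := geom_bound γ (nd γ) h3 (nd_le γ) A B
      calc _ ≤ 1 / (2 * nd γ) * nd γ := by gcongr
        _ = 1 / 2 := by field_simp
        _ ≤ 1 := by norm_num

lemma mn_neg (X γ : ℝ) : mn X (-γ) = mn X γ := by
  have : nd (-γ) = nd γ := by
    apply le_antisymm
    · have := nd_le (-γ) (-round γ)
      refine this.trans (le_of_eq ?_)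
      unfold nd; rw [← abs_neg]; congr 1; push_cast; ring
    · have := nd_le γ (-round (-γ))
      refine this.trans (le_of_eq ?_)
      unfold nd; rw [← abs_neg]; congr 1; push_cast; ring
  unfold mn; rw [this]

/-- approximation data -/
def Approx (β : ℝ) (a : ℤ) (q : ℕ) : Prop :=
  0 < q ∧ IsCoprime a (q : ℤ) ∧ |β - a / q| ≤ 1 / (q : ℝ) ^ 2

lemma spacing {β : ℝ} {a : ℤ} {q : ℕ} (h : Approx β a q) (j : ℤ) (hj : j ≠ 0)
    (hj2 : 2 * |j| ≤ q) (m : ℤ) : 1 / (2 * q : ℝ) ≤ |j * β - m| := by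
  obtain ⟨hq, hc, hb⟩ := h
  have hq' : (0 : ℝ) < q := by exact_mod_cast hq
  have hne : j * a - m * q ≠ 0 := by
    intro h0
    have hd : (q : ℤ) ∣ j * a := ⟨m, by linarith⟩
    have hd2 : (q : ℤ) ∣ j := hc.symm.dvd_of_dvd_mul_right hd
    have := Int.le_of_dvd (abs_pos.2 hj) ((dvd_abs _ _).2 hd2)
    have := abs_pos.2 hj
    omega
  have h1 : (1 : ℝ) ≤ |(j : ℝ) * a - m * q| := by
    have := Int.one_le_abs hne
    exact_mod_cast this
  have h2 : (j : ℝ) * β - m = (j * a - m * q) / q + j * (β - a / q) := by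
    field_simp; ring
  have h3 : |(j : ℝ) * (β - a / q)| ≤ 1 / (2 * q) := by
    rw [abs_mul]
    have hj3 : 2 * |(j : ℝ)| ≤ q := by exact_mod_cast hj2
    calc |(j : ℝ)| * |β - a / q| ≤ (q / 2) * (1 / (q : ℝ) ^ 2) := by
          gcongr; linarith
      _ = _ := by field_simp
  have h4 : 1 / (q : ℝ) ≤ |((j : ℝ) * a - m * q) / q| := by
    rw [abs_div, abs_of_pos hq']; gcongr
  have h5 := abs_sub_abs_le_abs_sub (((j : ℝ) * a - m * q) / q) (-(j * (β - a / q)))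
  rw [h2]
  rw [abs_neg, sub_neg_eq_add] at h5
  have : 1 / (q : ℝ) = 1 / (2 * q) + 1 / (2 * q) := by field_simp; norm_num
  linarith

lemma block {β : ℝ} {a : ℤ} {q : ℕ} (h : Approx β a q) (c : ℝ) (A : ℤ) (H : ℕ) (hH : H ≤ q / 2 + 1)
    (X : ℝ) (hX : 0 ≤ X) (F : ℤ → ℝ) (hF : ∀ k ∈ Ico A (A + H), F k ≤ X)
    (hF2 : ∀ k ∈ Ico A (A + H), F k * nd (k * β + c) ≤ 1) :
    ∑ k ∈ Ico A (A + H), F k ≤ 2 * X + 4 * q * (1 + Real.log (2 * q)) := by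
  have hq := h.1
  have hq' : (0 : ℝ) < q := by exact_mod_cast hq
  set J : ℤ → ℕ := fun k => ⌊2 * q * Int.fract (k * β + c)⌋₊ with hJ
  set G : ℕ → ℝ := fun j => (if j = 0 then X else 0) + (if j = 2 * q - 1 then X else 0)
    + 2 * q * (j : ℝ)⁻¹ + 2 * q * ((2 * q - 1 - j : ℕ) : ℝ)⁻¹ with hG
  have hG0 : ∀ j, 0 ≤ G j := by intro j; simp only [hG]; split_ifs <;> positivity
  have hJle : ∀ k : ℤ, (J k : ℝ) ≤ 2 * q * Int.fract (k * β + c) := fun k =>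
    Nat.floor_le (mul_nonneg (by positivity) (Int.fract_nonneg _))
  have hJlt : ∀ k : ℤ, 2 * q * Int.fract (k * β + c) < J k + 1 := fun k => Nat.lt_floor_add_one _
  have hJ2 : ∀ k : ℤ, J k < 2 * q := by
    intro k
    have h1 := hJle k
    have h2 := Int.fract_lt_one (k * β + c)
    have : (J k : ℝ) < (2 * q : ℕ) := by push_cast; nlinarith
    exact_mod_cast this
  have hFG : ∀ k ∈ Ico A (A + H), F k ≤ G (J k) := by
    intro k hk
    have p1 : (0 : ℝ) ≤ 2 * q * (J k : ℝ)⁻¹ := by positivity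
    have p2 : (0 : ℝ) ≤ 2 * q * ((2 * q - 1 - J k : ℕ) : ℝ)⁻¹ := by positivity
    simp only [hG]
    by_cases e1 : J k = 0
    · rw [if_pos e1]; split_ifs <;> linarith [hF k hk]
    by_cases e2 : J k = 2 * q - 1
    · rw [if_pos e2]; split_ifs <;> linarith [hF k hk]
    rw [if_neg e1, if_neg e2]
    have j1 : (0 : ℝ) < J k := by exact_mod_cast Nat.pos_of_ne_zero e1
    have j2n : 0 < 2 * q - 1 - J k := by have := hJ2 k; omega
    have j2 : (0 : ℝ) < ((2 * q - 1 - J k : ℕ) : ℝ) := by exact_mod_cast j2n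
    have j2e : ((2 * q - 1 - J k : ℕ) : ℝ) = 2 * q - 1 - J k := by
      rw [Nat.cast_sub (by have := hJ2 k; omega), Nat.cast_sub (by omega)]; push_cast; ring
    rcases le_or_gt (F k) 0 with hneg | hpos
    · linarith
    have hnd := hF2 k hk
    set y := (k : ℝ) * β + c with hy
    have hf1 := hJle k
    have hf2 := hJlt k
    have hnd2 : nd y = min (Int.fract y) (1 - Int.fract y) := abs_sub_round_eq_min y
    rcases le_total (Int.fract y) (1 - Int.fract y) with hm | hm
    · rw [hnd2, min_eq_left hm] at hnd
      have : F k ≤ 2 * q * (J k : ℝ)⁻¹ := by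
        rw [← div_eq_mul_inv, le_div_iff₀ j1]
        nlinarith
      linarith
    · rw [hnd2, min_eq_right hm] at hnd
      have : F k ≤ 2 * q * ((2 * q - 1 - J k : ℕ) : ℝ)⁻¹ := by
        rw [← div_eq_mul_inv, le_div_iff₀ j2, j2e]
        nlinarith
      linarith
  have hinj : Set.InjOn J (Ico A (A + H) : Finset ℤ) := by
    intro k hk l hl hkl
    simp only [Finset.coe_Ico, Set.mem_Ico] at hk hl
    by_contra hne
    have hsp := spacing h (k - l) (sub_ne_zero.2 hne) (by
      have : |k - l| ≤ (q / 2 : ℕ) := by rw [abs_le]; omega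
      omega) (⌊(k * β + c)⌋ - ⌊(l * β + c)⌋)
    have e : ((k - l : ℤ) : ℝ) * β - ((⌊(k * β + c)⌋ - ⌊(l * β + c)⌋ : ℤ) : ℝ)
        = Int.fract (k * β + c) - Int.fract (l * β + c) := by
      unfold Int.fract; push_cast; ring
    rw [e] at hsp
    have a1 := hJle k
    have a2 := hJlt k
    have a3 := hJle l
    have a4 := hJlt l
    rw [hkl] at a1 a2
    have : |Int.fract (k * β + c) - Int.fract (l * β + c)| < 1 / (2 * q) := by
      rw [abs_lt, lt_div_iff₀ (by positivity), ← neg_div, div_lt_iff₀ (by positivity)]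
      constructor <;> nlinarith
    linarith
  calc ∑ k ∈ Ico A (A + H), F k ≤ ∑ k ∈ Ico A (A + H), G (J k) := Finset.sum_le_sum hFG
    _ = ∑ j ∈ (Ico A (A + H)).image J, G j := by rw [Finset.sum_image hinj]
    _ ≤ ∑ j ∈ range (2 * q), G j := by
        apply Finset.sum_le_sum_of_subset_of_nonneg
        · intro j hj
          obtain ⟨k, _, rfl⟩ := Finset.mem_image.1 hj
          exact Finset.mem_range.2 (hJ2 k)
        · intro j _ _; exact hG0 j
    _ ≤ _ := by
        simp only [hG, Finset.sum_add_distrib]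
        rw [Finset.sum_ite_eq', Finset.sum_ite_eq', if_pos (by simp; omega), if_pos (by simp; omega)]
        have hr : ∑ j ∈ range (2 * q), 2 * (q : ℝ) * ((2 * q - 1 - j : ℕ) : ℝ)⁻¹
            = ∑ j ∈ range (2 * q), 2 * (q : ℝ) * (j : ℝ)⁻¹ :=
          Finset.sum_range_reflect (fun j => 2 * (q : ℝ) * (j : ℝ)⁻¹) (2 * q)
        rw [hr, ← Finset.mul_sum]
        have hs : ∑ j ∈ range (2 * q), (j : ℝ)⁻¹ ≤ 1 + Real.log (2 * q) := by
          have h1 := harmonic_le_one_add_log (2 * q)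
          rw [harmonic_eq_sum_Icc] at h1
          push_cast at h1
          refine le_trans ?_ h1
          rw [Finset.range_eq_Ico, Finset.sum_eq_sum_Ico_succ_bot (by omega)]
          simp only [Nat.cast_zero, inv_zero, zero_add]
          apply Finset.sum_le_sum_of_subset_of_nonneg
          · intro j; simp only [Finset.mem_Ico, Finset.mem_Icc]; omega
          · intro j _ _; positivity
        nlinarith

lemma int_consec (F : ℤ → ℝ) {A B C : ℤ} (h1 : A ≤ B) (h2 : B ≤ C) :
    ∑ k ∈ Ico A B, F k + ∑ k ∈ Ico B C, F k = ∑ k ∈ Ico A C, F k := by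
  rw [← Finset.sum_union (Finset.Ico_disjoint_Ico_consecutive A B C), Finset.Ico_union_Ico_eq_Ico h1 h2]

lemma blocks {β : ℝ} {a : ℤ} {q : ℕ} (h : Approx β a q) (c : ℝ) (X : ℝ) (hX : 0 ≤ X) (F : ℤ → ℝ)
    (H : ℕ) : ∀ A : ℤ, (∀ k ∈ Ico A (A + H), F k ≤ X) →
    (∀ k ∈ Ico A (A + H), F k * nd (k * β + c) ≤ 1) →
    ∑ k ∈ Ico A (A + H), F k ≤ (2 * H / q + 1) * (2 * X + 4 * q * (1 + Real.log (2 * q))) := by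
  have hq := h.1
  have hq' : (0 : ℝ) < q := by exact_mod_cast hq
  have hq1 : (1 : ℝ) ≤ q := by exact_mod_cast hq
  have hlog : 0 ≤ Real.log (2 * q) := Real.log_nonneg (by linarith)
  have hB : 0 ≤ 2 * X + 4 * q * (1 + Real.log (2 * q)) := by positivity
  induction H using Nat.strong_induction_on with
  | _ H ih =>
    intro A h1 h2
    by_cases hH : H ≤ q / 2 + 1
    · refine (block h c A H hH X hX F h1 h2).trans ?_
      have : (0 : ℝ) ≤ 2 * H / q := by positivity
      nlinarith
    · push Not at hH
      set L := q / 2 + 1 with hL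
      have hLq : (q : ℝ) ≤ 2 * L := by
        have : q ≤ 2 * L := by omega
        exact_mod_cast this
      have hHL : ((H - L : ℕ) : ℤ) = H - L := by rw [Nat.cast_sub hH.le]
      have e : A + (L : ℤ) + ((H - L : ℕ) : ℤ) = A + H := by rw [hHL]; ring
      have i1 := block h c A L le_rfl X hX F
        (fun k hk => h1 k (by rw [Finset.mem_Ico] at hk ⊢; omega))
        (fun k hk => h2 k (by rw [Finset.mem_Ico] at hk ⊢; omega))
      have i2 := ih (H - L) (by omega) (A + L)
        (fun k hk => h1 k (by rw [Finset.mem_Ico] at hk ⊢; omega))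
        (fun k hk => h2 k (by rw [Finset.mem_Ico] at hk ⊢; omega))
      rw [e] at i2
      rw [← int_consec F (show A ≤ A + L by omega) (show A + (L : ℤ) ≤ A + H by omega)]
      have hc : ((H - L : ℕ) : ℝ) = H - L := by rw [Nat.cast_sub hH.le]
      rw [hc] at i2
      have : 2 * ((H : ℝ) - L) / q + 1 + 1 ≤ 2 * H / q + 1 := by
        have : (1 : ℝ) ≤ 2 * L / q := by rw [le_div_iff₀ hq']; linarith
        have e2 : 2 * ((H : ℝ) - L) / q = 2 * H / q - 2 * L / q := by ring
        linarith
      nlinarith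

lemma typeI_sum {β : ℝ} {a : ℤ} {q : ℕ} (h : Approx β a q) (N K ll : ℝ) (hN : 0 ≤ N) (Kn : ℕ) (hK : (Kn : ℝ) ≤ K)
    (l1 : 1 + Real.log (2 * q) ≤ ll) (l2 : 1 + Real.log (2 * K + 1) ≤ ll) :
    ∑ k ∈ Ico 1 (Kn + 1), mn (N / k) (k * β) ≤ 8 * ll * (q + K + N / q) := by
  have hq := h.1
  have hq' : (0 : ℝ) < q := by exact_mod_cast hq
  have hq1 : (1 : ℝ) ≤ q := by exact_mod_cast hq
  have hlog : 0 ≤ Real.log (2 * q) := Real.log_nonneg (by linarith)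
  have hK0 : 0 ≤ K := le_trans (by positivity) hK
  set L := q / 2 + 1 with hL
  have hLq : (q : ℝ) ≤ 2 * L := by
    have : q ≤ 2 * L := by omega
    exact_mod_cast this
  set F : ℤ → ℝ := fun k => mn (N / k) (k * β) with hF
  have key : ∀ J : ℕ, 1 ≤ J → ∑ k ∈ Ico (1 : ℤ) (J * L), F k ≤
      4 * q + J * (4 * q * (1 + Real.log (2 * q))) + 4 * N / q * ∑ i ∈ Ico 1 J, (i : ℝ)⁻¹ := by
    intro J hJ
    induction J, hJ using Nat.le_induction with
    | base =>
      have := block h 0 1 (L - 1) (by omega) (2 * q) (by positivity) F ?_ ?_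
      · have e : (1 : ℤ) + ((L - 1 : ℕ) : ℤ) = (1 : ℕ) * L := by push_cast; omega
        rw [e] at this
        simp only [Finset.Ico_self, Finset.sum_empty, Nat.cast_one] at this ⊢
        linarith
      · intro k hk
        rw [Finset.mem_Ico] at hk
        have hs := spacing h k (by omega) (by rw [abs_of_pos (by omega)]; omega)
        have hs2 := hs (round (k * β))
        have h1 := mn_nd (N / k) (k * β)
        have h3 : 0 ≤ mn (N / k) (k * β) := mn_nonneg _ _ (div_nonneg hN (by
          have : (0 : ℤ) ≤ k := by omega
          exact_mod_cast this))
        have h4 : mn (N / k) (k * β) * (1 / (2 * q)) ≤ 1 := by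
          refine le_trans ?_ h1
          unfold nd; gcongr
        rw [mul_one_div, div_le_iff₀ (by positivity)] at h4
        linarith
      · intro k hk; rw [add_zero]; exact mn_nd _ _
    | succ J hJ ih =>
      have hJ' : (1 : ℝ) ≤ J := by exact_mod_cast hJ
      have hb := block h 0 (J * L) L le_rfl (2 * N / (q * J)) (by positivity) F ?_ ?_
      · have e : ((J : ℤ) * L + L) = ((J + 1 : ℕ) : ℤ) * L := by push_cast; ring
        rw [e] at hb
        rw [← int_consec F (show (1 : ℤ) ≤ J * L by
          have : 1 ≤ J * L := Nat.mul_pos hJ (by omega)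
          exact_mod_cast this) (show (J : ℤ) * L ≤ (J + 1 : ℕ) * L by rw [← e]; omega)]
        rw [Finset.sum_Ico_succ_top hJ]
        have e3 : 2 * (2 * N / (q * J)) = 4 * N / q * (J : ℝ)⁻¹ := by field_simp; ring
        rw [e3] at hb
        rw [show ((J + 1 : ℕ) : ℝ) = J + 1 by push_cast; ring, mul_add (4 * N / q), add_mul (J : ℝ)]
        linarith
      · intro k hk
        rw [Finset.mem_Ico] at hk
        have hk1 : (J : ℝ) * L ≤ k := by exact_mod_cast hk.1
        have hk0 : (0 : ℝ) < k := by nlinarith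
        refine (mn_le _ _).trans ?_
        rw [div_le_div_iff₀ hk0 (by positivity)]
        have : (q : ℝ) * J ≤ 2 * k := by nlinarith
        nlinarith
      · intro k hk; rw [add_zero]; exact mn_nd _ _
  set J := Kn / L + 1 with hJ
  have hJL : Kn < J * L := by
    rw [hJ, mul_comm]; exact Nat.lt_mul_div_succ Kn (by omega)
  have hJr : (J : ℝ) ≤ 2 * K / q + 1 := by
    rw [hJ]; push_cast
    have h1 : ((Kn / L : ℕ) : ℝ) ≤ Kn / L := Nat.cast_div_le
    have hL0 : (0 : ℝ) < L := by positivity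
    have : (Kn : ℝ) / L ≤ 2 * K / q := by
      rw [div_le_div_iff₀ hL0 hq']; nlinarith
    linarith
  have hJ2 : (J : ℝ) ≤ 2 * K + 1 := by
    have : 2 * K / q ≤ 2 * K := div_le_self (by positivity) hq1
    linarith
  have k1 := key J (by rw [hJ]; exact Nat.le_add_left 1 _)
  have hsub : ∑ k ∈ Ico 1 (Kn + 1), mn (N / k) (k * β) ≤ ∑ k ∈ Ico (1 : ℤ) (J * L), F k := by
    have e : ∑ k ∈ Ico 1 (Kn + 1), mn (N / k) (k * β) = ∑ k ∈ (Ico 1 (Kn + 1)).image (fun k : ℕ => (k : ℤ)), F k := by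
      rw [Finset.sum_image (by intro x _ y _ hxy; exact Int.ofNat_inj.1 hxy)]
      refine Finset.sum_congr rfl fun k _ => ?_
      simp only [hF, Int.cast_natCast]
    rw [e]
    apply Finset.sum_le_sum_of_subset_of_nonneg
    · intro k hk
      obtain ⟨l, hl, rfl⟩ := Finset.mem_image.1 hk
      rw [Finset.mem_Ico] at hl ⊢
      have : l < J * L := by omega
      exact ⟨by omega, by exact_mod_cast this⟩
    · intro k hk _
      rw [Finset.mem_Ico] at hk
      exact mn_nonneg _ _ (div_nonneg hN (by
          have : (0 : ℤ) ≤ k := by omega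
          exact_mod_cast this))
  have hh : ∑ i ∈ Ico 1 J, (i : ℝ)⁻¹ ≤ ll := by
    have h1 := harmonic_le_one_add_log J
    rw [harmonic_eq_sum_Icc] at h1
    push_cast at h1
    have hJp : (0 : ℝ) < J := by positivity
    have h2 : Real.log J ≤ Real.log (2 * K + 1) := Real.log_le_log hJp hJ2
    refine le_trans ?_ (le_trans h1 (by linarith))
    apply Finset.sum_le_sum_of_subset_of_nonneg
    · intro j; simp only [Finset.mem_Ico, Finset.mem_Icc]; omega
    · intro j _ _; positivity
  have hll : 1 ≤ ll := by linarith
  calc _ ≤ _ := hsub.trans k1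
    _ ≤ 4 * q * ll + (2 * K / q + 1) * (4 * q * ll) + 4 * N / q * ll := by
        have : (q : ℝ) ≤ q * ll := le_mul_of_one_le_right hq'.le hll
        have h2 : J * (4 * q * (1 + Real.log (2 * q))) ≤ (2 * K / q + 1) * (4 * q * ll) := by gcongr
        have h3 : 4 * N / q * ∑ i ∈ Ico 1 J, (i : ℝ)⁻¹ ≤ 4 * N / q * ll := by gcongr
        linarith
    _ = 8 * ll * q + 8 * ll * K + 4 * ll * (N / q) := by field_simp; ring
    _ ≤ _ := by
        have : 0 ≤ ll * (N / q) := by positivity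
        nlinarith

lemma bilin (β : ℝ) (X X' : ℕ) (hXX : X ≤ X') (Ks : Finset ℕ) (u : ℕ → ℕ) (b a : ℕ → ℂ) (c t : ℕ → ℝ)
    (hc : ∀ m ∈ Ico X X', 0 ≤ c m) (ht : ∀ m ∈ Ico X X', 0 ≤ t m)
    (hb : ∀ m ∈ Ico X X', ‖b m‖ ^ 2 ≤ c m * t m)
    (W : ℕ → ℕ → ℝ)
    (hW : ∀ k ∈ Ks, ∀ l ∈ Ks, ∀ Y, X ≤ Y → Y ≤ X' →
      ‖∑ m ∈ Ico X Y, (t m : ℂ) * ee (m * (((k : ℝ) - l) * β))‖ ≤ W k l)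
    (hW0 : ∀ k ∈ Ks, ∀ l ∈ Ks, W k l = W l k) :
    ‖∑ m ∈ Ico X X', b m * ∑ k ∈ Ks with m ≤ u k, a k * ee (m * k * β)‖ ^ 2
      ≤ (∑ m ∈ Ico X X', c m) * ∑ k ∈ Ks, ‖a k‖ ^ 2 * ∑ l ∈ Ks, W k l := by
  set F : ℕ → ℂ := fun m => ∑ k ∈ Ks with m ≤ u k, a k * ee (m * k * β) with hF
  have h1 : ‖∑ m ∈ Ico X X', b m * F m‖ ≤ ∑ m ∈ Ico X X', ‖b m‖ * ‖F m‖ := by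
    refine (norm_sum_le _ _).trans (le_of_eq ?_)
    refine Finset.sum_congr rfl fun m _ => norm_mul _ _
  have h2 : (∑ m ∈ Ico X X', ‖b m‖ * ‖F m‖) ^ 2 ≤
      (∑ m ∈ Ico X X', c m) * ∑ m ∈ Ico X X', t m * ‖F m‖ ^ 2 := by
    apply Finset.sum_sq_le_sum_mul_sum_of_sq_le_mul
    · exact hc
    · intro m hm; exact mul_nonneg (ht m hm) (by positivity)
    · intro m hm
      rw [mul_pow, ← mul_assoc]
      gcongr
      exact hb m hm
  have hWn : ∀ k ∈ Ks, ∀ l ∈ Ks, 0 ≤ W k l := fun k hk l hl =>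
    (norm_nonneg _).trans (hW k hk l hl X le_rfl hXX)
  have h3 : ((∑ m ∈ Ico X X', t m * ‖F m‖ ^ 2 : ℝ) : ℂ) = ∑ k ∈ Ks, ∑ l ∈ Ks,
      (a k * (starRingEnd ℂ) (a l)) * ∑ m ∈ Ico X X' with m ≤ u k ∧ m ≤ u l,
        (t m : ℂ) * ee (m * (((k : ℝ) - l) * β)) := by
    have e : ∀ m, ((t m * ‖F m‖ ^ 2 : ℝ) : ℂ) = ∑ k ∈ Ks, ∑ l ∈ Ks, (a k * (starRingEnd ℂ) (a l)) *
        (if m ≤ u k ∧ m ≤ u l then (t m : ℂ) * ee (m * (((k : ℝ) - l) * β)) else 0) := by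
      intro m
      have : (‖F m‖ ^ 2 : ℂ) = F m * (starRingEnd ℂ) (F m) := (Complex.mul_conj' (F m)).symm
      push_cast
      rw [this, hF]
      beta_reduce
      rw [map_sum, Finset.sum_filter, Finset.sum_filter, Finset.sum_mul_sum, Finset.mul_sum]
      refine Finset.sum_congr rfl fun k _ => ?_
      rw [Finset.mul_sum]
      refine Finset.sum_congr rfl fun l _ => ?_
      by_cases c1 : m ≤ u k
      · by_cases c2 : m ≤ u l
        · rw [if_pos c1, if_pos c2, if_pos ⟨c1, c2⟩, map_mul, ee_conj]
          have : ee (m * (((k : ℝ) - l) * β)) = ee (m * k * β) * ee (-(m * l * β)) := by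
            rw [← ee_add]; congr 1; ring
          rw [this]; ring
        · simp [c2]
      · simp [c1]
    rw [Complex.ofReal_sum, Finset.sum_congr rfl fun m _ => e m, Finset.sum_comm]
    refine Finset.sum_congr rfl fun k _ => ?_
    rw [Finset.sum_comm]
    refine Finset.sum_congr rfl fun l _ => ?_
    rw [Finset.sum_filter, Finset.mul_sum]
  have h4 : ∑ m ∈ Ico X X', t m * ‖F m‖ ^ 2 ≤ ∑ k ∈ Ks, ∑ l ∈ Ks, (‖a k‖ * ‖a l‖) * W k l := by
    have h5 : ∑ m ∈ Ico X X', t m * ‖F m‖ ^ 2 ≤ ‖((∑ m ∈ Ico X X', t m * ‖F m‖ ^ 2 : ℝ) : ℂ)‖ := by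
      rw [Complex.norm_real]; exact le_abs_self _
    refine h5.trans ?_
    rw [h3]
    refine (norm_sum_le _ _).trans (Finset.sum_le_sum fun k hk => ?_)
    refine (norm_sum_le _ _).trans (Finset.sum_le_sum fun l hl => ?_)
    rw [norm_mul, norm_mul, Complex.norm_conj]
    gcongr
    have e : (Ico X X').filter (fun m => m ≤ u k ∧ m ≤ u l)
        = Ico X (max X (min X' (min (u k) (u l) + 1))) := by
      ext m; simp only [Finset.mem_filter, Finset.mem_Ico]; omega
    rw [e]
    exact hW k hk l hl _ (by omega) (by omega)
  have h6 : ∑ k ∈ Ks, ∑ l ∈ Ks, (‖a k‖ * ‖a l‖) * W k l ≤ ∑ k ∈ Ks, ‖a k‖ ^ 2 * ∑ l ∈ Ks, W k l := by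
    have i1 : ∑ k ∈ Ks, ∑ l ∈ Ks, (‖a k‖ * ‖a l‖) * W k l ≤
        ∑ k ∈ Ks, ∑ l ∈ Ks, (‖a k‖ ^ 2 / 2 * W k l + ‖a l‖ ^ 2 / 2 * W k l) := by
      refine Finset.sum_le_sum fun k hk => Finset.sum_le_sum fun l hl => ?_
      have := hWn k hk l hl
      have h7 := two_mul_le_add_sq ‖a k‖ ‖a l‖
      nlinarith
    refine i1.trans (le_of_eq ?_)
    simp only [Finset.sum_add_distrib]
    rw [Finset.sum_comm (f := fun k l => ‖a l‖ ^ 2 / 2 * W k l)]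
    rw [← Finset.sum_add_distrib]
    refine Finset.sum_congr rfl fun k hk => ?_
    rw [← Finset.sum_add_distrib, Finset.mul_sum]
    refine Finset.sum_congr rfl fun l hl => ?_
    rw [hW0 l hl k hk]; ring
  have hc0 : 0 ≤ ∑ m ∈ Ico X X', c m := Finset.sum_nonneg hc
  calc _ ≤ (∑ m ∈ Ico X X', ‖b m‖ * ‖F m‖) ^ 2 := by gcongr
    _ ≤ _ := h2
    _ ≤ _ := by gcongr; exact h4.trans h6

end DPM

namespace DPM
open Finset

lemma hyper {E : Type*} [AddCommMonoid E] (F : ℕ → ℕ → E) (M : ℕ) :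
    ∑ n ∈ Ico 1 (M + 1), ∑ x ∈ n.divisorsAntidiagonal, F x.1 x.2
      = ∑ k ∈ Ico 1 (M + 1), ∑ m ∈ Ico 1 (M / k + 1), F k m := by
  rw [Finset.sum_sigma', Finset.sum_sigma']
  refine Finset.sum_bij' (fun x _ => ⟨x.2.1, x.2.2⟩) (fun y _ => ⟨y.1 * y.2, (y.1, y.2)⟩) ?_ ?_ ?_ ?_ ?_
  · rintro ⟨n, k, m⟩ h
    simp only [Finset.mem_sigma, Finset.mem_Ico, Nat.mem_divisorsAntidiagonal] at h ⊢
    obtain ⟨⟨h1, h2⟩, h3, h4⟩ := h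
    have hk : 0 < k := Nat.pos_of_ne_zero (by rintro rfl; simp at h3; omega)
    have hm : 0 < m := Nat.pos_of_ne_zero (by rintro rfl; simp at h3; omega)
    have : k ≤ n := by rw [← h3]; exact Nat.le_mul_of_pos_right k hm
    have h5 : m ≤ M / k := by rw [Nat.le_div_iff_mul_le hk, mul_comm, h3]; omega
    omega
  · rintro ⟨k, m⟩ h
    simp only [Finset.mem_sigma, Finset.mem_Ico, Nat.mem_divisorsAntidiagonal] at h ⊢
    obtain ⟨⟨h1, h2⟩, h3, h4⟩ := h
    have h5 : m ≤ M / k := by omega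
    rw [Nat.le_div_iff_mul_le (by omega), mul_comm] at h5
    have : 0 < k * m := Nat.mul_pos h1 h3
    refine ⟨⟨by omega, by omega⟩, trivial, by omega⟩
  · rintro ⟨n, k, m⟩ h
    simp only [Finset.mem_sigma, Finset.mem_Ico, Nat.mem_divisorsAntidiagonal] at h
    obtain ⟨_, rfl, _⟩ := h
    rfl
  · rintro ⟨k, m⟩ h; rfl
  · rintro ⟨n, k, m⟩ h; rfl

lemma harm_le (K K' : ℕ) (h : K' ≤ K) (hK : 1 ≤ K) : ∑ k ∈ Ico 1 (K' + 1), (k : ℝ)⁻¹ ≤ 1 + Real.log K := by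
  have h1 := harmonic_le_one_add_log K
  rw [harmonic_eq_sum_Icc] at h1
  push_cast at h1
  refine le_trans ?_ h1
  apply Finset.sum_le_sum_of_subset_of_nonneg
  · intro j; simp only [Finset.mem_Ico, Finset.mem_Icc]; omega
  · intro j _ _; positivity

lemma card_div_eq (n : ℕ) : (#n.divisors : ℝ) = ∑ x ∈ n.divisorsAntidiagonal, (1 : ℝ) := by
  rw [← Nat.map_div_right_divisors]; simp

lemma tau_sum (K K' : ℕ) (hK : 1 ≤ K) (h : K' ≤ K) :
    ∑ k ∈ Ico 1 (K' + 1), (#k.divisors : ℝ) ≤ K' * (1 + Real.log K) := by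
  rw [Finset.sum_congr rfl fun k _ => card_div_eq k, hyper (fun _ _ => (1 : ℝ))]
  calc _ ≤ ∑ k ∈ Ico 1 (K' + 1), (K' : ℝ) * (k : ℝ)⁻¹ := by
        refine Finset.sum_le_sum fun k _ => ?_
        simp only [Finset.sum_const, Nat.card_Ico, nsmul_eq_mul, mul_one, Nat.add_sub_cancel]
        rw [← div_eq_mul_inv]; exact Nat.cast_div_le
    _ ≤ _ := by
        rw [← Finset.mul_sum]; gcongr; exact harm_le K K' h hK

lemma tau_sum2 (K : ℕ) (hK : 1 ≤ K) :
    ∑ k ∈ Ico 1 (K + 1), (#k.divisors : ℝ) * (k : ℝ)⁻¹ ≤ (1 + Real.log K) ^ 2 := by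
  have e : ∀ k ∈ Ico 1 (K + 1), (#k.divisors : ℝ) * (k : ℝ)⁻¹ =
      ∑ x ∈ k.divisorsAntidiagonal, (x.1 : ℝ)⁻¹ * (x.2 : ℝ)⁻¹ := by
    intro k _
    rw [card_div_eq, Finset.sum_mul]
    refine Finset.sum_congr rfl fun x hx => ?_
    rw [Nat.mem_divisorsAntidiagonal] at hx
    rw [one_mul, ← hx.1, Nat.cast_mul, mul_inv]
  rw [Finset.sum_congr rfl e, hyper (fun a b => (a : ℝ)⁻¹ * (b : ℝ)⁻¹)]
  have hL : 0 ≤ 1 + Real.log K := by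
    have := Real.log_nonneg (show (1 : ℝ) ≤ K by exact_mod_cast hK); linarith
  calc _ ≤ ∑ k ∈ Ico 1 (K + 1), (k : ℝ)⁻¹ * (1 + Real.log K) := by
        refine Finset.sum_le_sum fun k _ => ?_
        rw [← Finset.mul_sum]
        gcongr
        exact harm_le K _ (Nat.div_le_self _ _) hK
    _ ≤ _ := by
        rw [← Finset.sum_mul, sq]; gcongr; exact harm_le K K le_rfl hK

lemma tau_sq (K : ℕ) (hK : 1 ≤ K) :
    ∑ k ∈ Ico 1 (K + 1), (#k.divisors : ℝ) ^ 2 ≤ K * (1 + Real.log K) ^ 3 := by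
  have hL : 0 ≤ 1 + Real.log K := by
    have := Real.log_nonneg (show (1 : ℝ) ≤ K by exact_mod_cast hK); linarith
  have e : ∀ k ∈ Ico 1 (K + 1), (#k.divisors : ℝ) ^ 2 ≤
      ∑ x ∈ k.divisorsAntidiagonal, (#(x.1).divisors : ℝ) * (#(x.2).divisors : ℝ) := by
    intro k _
    rw [sq]
    nth_rewrite 1 [card_div_eq]
    rw [Finset.sum_mul]
    refine Finset.sum_le_sum fun x hx => ?_
    rw [Nat.mem_divisorsAntidiagonal] at hx
    rw [one_mul, ← hx.1, Nat.divisors_mul]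
    exact_mod_cast Finset.card_mul_le
  refine (Finset.sum_le_sum e).trans ?_
  rw [hyper (fun a b => (#(a).divisors : ℝ) * (#(b).divisors : ℝ))]
  calc _ ≤ ∑ k ∈ Ico 1 (K + 1), (#k.divisors : ℝ) * (((K : ℝ) * (k : ℝ)⁻¹) * (1 + Real.log K)) := by
        refine Finset.sum_le_sum fun k _ => ?_
        rw [← Finset.mul_sum]
        gcongr
        refine (tau_sum K _ hK (Nat.div_le_self _ _)).trans ?_
        gcongr
        rw [← div_eq_mul_inv]; exact Nat.cast_div_le
    _ = K * (1 + Real.log K) * ∑ k ∈ Ico 1 (K + 1), (#k.divisors : ℝ) * (k : ℝ)⁻¹ := by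
        rw [Finset.mul_sum]; refine Finset.sum_congr rfl fun k _ => by ring
    _ ≤ K * (1 + Real.log K) * (1 + Real.log K) ^ 2 := by gcongr; exact tau_sum2 K hK
    _ = _ := by ring

open ArithmeticFunction in
noncomputable def lo (f : ArithmeticFunction ℝ) (U : ℕ) : ArithmeticFunction ℝ :=
  ⟨fun n => if n ≤ U then f n else 0, by simp⟩

open ArithmeticFunction in
noncomputable def hi (f : ArithmeticFunction ℝ) (U : ℕ) : ArithmeticFunction ℝ :=
  ⟨fun n => if n ≤ U then 0 else f n, by simp⟩

lemma lo_apply (f : ArithmeticFunction ℝ) (U n : ℕ) : lo f U n = if n ≤ U then f n else 0 := rfl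
lemma hi_apply (f : ArithmeticFunction ℝ) (U n : ℕ) : hi f U n = if n ≤ U then 0 else f n := rfl

lemma lo_add_hi (f : ArithmeticFunction ℝ) (U : ℕ) : lo f U + hi f U = f := by
  ext n; rw [ArithmeticFunction.add_apply, lo_apply, hi_apply]; split_ifs <;> simp

open ArithmeticFunction in
lemma vaughan (U : ℕ) :
    (vonMangoldt : ArithmeticFunction ℝ) = lo vonMangoldt U + lo (moebius : ArithmeticFunction ℝ) U * log
      - (lo (moebius : ArithmeticFunction ℝ) U * lo vonMangoldt U) * (zeta : ArithmeticFunction ℝ)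
      + hi vonMangoldt U * (hi (moebius : ArithmeticFunction ℝ) U * (zeta : ArithmeticFunction ℝ)) := by
  have h1 := lo_add_hi vonMangoldt U
  have h2 := lo_add_hi (moebius : ArithmeticFunction ℝ) U
  have h3 : (moebius : ArithmeticFunction ℝ) * (zeta : ArithmeticFunction ℝ) = 1 := coe_moebius_mul_coe_zeta
  rw [← vonMangoldt_mul_zeta]
  set l := lo vonMangoldt U
  set h := hi vonMangoldt U
  set m := lo (moebius : ArithmeticFunction ℝ) U
  set n := hi (moebius : ArithmeticFunction ℝ) U
  rw [← h2] at h3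
  rw [← h1]
  linear_combination (-h) * h3

lemma conv_sum (f g : ArithmeticFunction ℝ) (β : ℝ) (M : ℕ) :
    ∑ n ∈ Ico 1 (M + 1), (((f * g) n : ℝ) : ℂ) * ee (n * β)
      = ∑ k ∈ Ico 1 (M + 1), (f k : ℂ) * ∑ m ∈ Ico 1 (M / k + 1), (g m : ℂ) * ee (k * m * β) := by
  have e : ∀ n ∈ Ico 1 (M + 1), (((f * g) n : ℝ) : ℂ) * ee (n * β) = ∑ x ∈ n.divisorsAntidiagonal,
      (f x.1 : ℂ) * ((g x.2 : ℂ) * ee (x.1 * x.2 * β)) := by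
    intro n _
    rw [ArithmeticFunction.mul_apply, Complex.ofReal_sum, Finset.sum_mul]
    refine Finset.sum_congr rfl fun x hx => ?_
    rw [Nat.mem_divisorsAntidiagonal] at hx
    rw [← hx.1]; push_cast; ring
  rw [Finset.sum_congr rfl e, hyper (fun a b => (f a : ℂ) * ((g b : ℂ) * ee (a * b * β)))]
  refine Finset.sum_congr rfl fun k _ => ?_
  rw [Finset.mul_sum]

end DPM

namespace DPM
open Finset

lemma log_sum_bound (γ T : ℝ) (Y : ℕ) (hY : (Y : ℝ) ≤ T) (ll : ℝ) (hll : Real.log (Y + 1) ≤ ll) :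
    ‖∑ m ∈ Ico 1 (Y + 1), ((Real.log m : ℝ) : ℂ) * ee (m * γ)‖ ≤ 2 * ll * mn T γ := by
  have hT : 0 ≤ T := le_trans (by positivity) hY
  have h := abel_bound (fun m => ee (m * γ)) (fun m => ((Real.log m : ℝ) : ℂ)) (mn T γ) 1 (Y + 1) (by omega)
    (fun Z h1 h2 => geom_mn T γ 1 Z (by
      have : (Z : ℝ) ≤ Y + 1 := by exact_mod_cast h2
      push_cast; linarith) hT)
  have e : ∑ m ∈ Ico 1 (Y + 1), ((Real.log m : ℝ) : ℂ) * ee (m * γ) =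
      ∑ m ∈ Ico 1 (Y + 1), ee (m * γ) * ((Real.log m : ℝ) : ℂ) :=
    Finset.sum_congr rfl fun m _ => mul_comm _ _
  rw [e]
  refine h.trans ?_
  have h0 : 0 ≤ Real.log (Y + 1) := Real.log_nonneg (by linarith [show (0 : ℝ) ≤ Y by positivity])
  have e2 : ∑ n ∈ Ico 1 (Y + 1), ‖((Real.log (n + 1 : ℕ) : ℝ) : ℂ) - ((Real.log n : ℝ) : ℂ)‖ = Real.log (Y + 1) := by
    have e3 : ∀ n ∈ Ico 1 (Y + 1), ‖((Real.log (n + 1 : ℕ) : ℝ) : ℂ) - ((Real.log n : ℝ) : ℂ)‖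
        = Real.log (n + 1 : ℕ) - Real.log n := by
      intro n hn
      rw [Finset.mem_Ico] at hn
      rw [← Complex.ofReal_sub, Complex.norm_real, Real.norm_eq_abs, abs_of_nonneg]
      have : Real.log n ≤ Real.log (n + 1 : ℕ) := Real.log_le_log (by exact_mod_cast hn.1) (by push_cast; linarith)
      linarith
    rw [Finset.sum_congr rfl e3, Finset.sum_Ico_sub (fun n : ℕ => Real.log n) (by omega)]
    simp
  rw [e2, Complex.norm_real, Real.norm_eq_abs]
  push_cast
  rw [abs_of_nonneg h0]
  have := mn_nonneg T γ hT
  nlinarith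

structure VHyp (β : ℝ) (a : ℤ) (q N U : ℕ) (ll : ℝ) : Prop where
  ap : Approx β a q
  hU : 1 ≤ U
  hUN : U ^ 3 ≤ N
  hqN : q ≤ N
  hll : 1 + Real.log (4 * N) ≤ ll

lemma VHyp.N1 {β : ℝ} {a : ℤ} {q N U : ℕ} {ll : ℝ} (h : VHyp β a q N U ll) : 1 ≤ N :=
  le_trans (Nat.succ_le_of_lt h.ap.1) h.hqN

lemma VHyp.logle {β : ℝ} {a : ℤ} {q N U : ℕ} {ll : ℝ} (h : VHyp β a q N U ll) (x : ℝ) (hx : 0 < x)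
    (hx2 : x ≤ 4 * N) : 1 + Real.log x ≤ ll := by
  have := Real.log_le_log hx hx2
  linarith [h.hll]

lemma VHyp.ll1 {β : ℝ} {a : ℤ} {q N U : ℕ} {ll : ℝ} (h : VHyp β a q N U ll) : 1 ≤ ll := by
  have h1 : (1 : ℝ) ≤ N := by exact_mod_cast h.N1
  have := h.logle 1 one_pos (by linarith)
  simpa using this

lemma VHyp.tI {β : ℝ} {a : ℤ} {q N U : ℕ} {ll : ℝ} (h : VHyp β a q N U ll) (K : ℕ) (hK : K ≤ N) :
    ∑ k ∈ Ico 1 (K + 1), mn (N / k) (k * β) ≤ 8 * ll * (q + K + (N : ℝ) / q) := by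
  have h1 : (1 : ℝ) ≤ N := by exact_mod_cast h.N1
  have hK' : (K : ℝ) ≤ N := by exact_mod_cast hK
  have hq : (q : ℝ) ≤ N := by exact_mod_cast h.hqN
  have hq0 : (0 : ℝ) < q := by exact_mod_cast h.ap.1
  exact typeI_sum h.ap N K ll (by positivity) K le_rfl (h.logle _ (by positivity) (by linarith))
    (h.logle _ (by positivity) (by linarith))

lemma vS1 {β : ℝ} {a : ℤ} {q N U : ℕ} {ll : ℝ} (h : VHyp β a q N U ll) (M : ℕ) (hMN : M ≤ N) :
    ‖∑ n ∈ Ico 1 (M + 1), (((lo (ArithmeticFunction.moebius : ArithmeticFunction ℝ) U *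
      ArithmeticFunction.log) n : ℝ) : ℂ) * ee (n * β)‖ ≤ 16 * ll ^ 2 * (q + U + (N : ℝ) / q) := by
  have hl := h.ll1
  rw [conv_sum]
  have hUN : U ≤ N := le_trans (Nat.le_self_pow (by norm_num) U) h.hUN
  have hN1 : (1 : ℝ) ≤ N := by exact_mod_cast h.N1
  have hMN' : (M : ℝ) ≤ N := by exact_mod_cast hMN
  calc _ ≤ ∑ k ∈ Ico 1 (M + 1), if k ≤ U then 2 * ll * mn (N / k) (k * β) else 0 := by
        refine (norm_sum_le _ _).trans (Finset.sum_le_sum fun k hk => ?_)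
        rw [Finset.mem_Ico] at hk
        have hk0 : (0 : ℝ) < k := by exact_mod_cast hk.1
        rw [norm_mul, lo_apply]
        split_ifs with hkU
        · have h1 : ‖(((ArithmeticFunction.moebius : ArithmeticFunction ℝ) k : ℝ) : ℂ)‖ ≤ 1 := by
            rw [Complex.norm_real, ArithmeticFunction.intCoe_apply, Real.norm_eq_abs]
            exact_mod_cast ArithmeticFunction.abs_moebius_le_one (n := k)
          have hd : ((M / k : ℕ) : ℝ) ≤ N / k := Nat.cast_div_le.trans (by gcongr)
          have h2 := log_sum_bound (k * β) (N / k) (M / k) hd ll (by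
            have : ((M / k : ℕ) : ℝ) ≤ M := by exact_mod_cast Nat.div_le_self _ _
            have := h.logle (((M / k : ℕ) : ℝ) + 1) (by positivity) (by linarith)
            linarith)
          have e : ∑ m ∈ Ico 1 (M / k + 1), ((Real.log m : ℝ) : ℂ) * ee (m * (k * β)) =
              ∑ m ∈ Ico 1 (M / k + 1), ((ArithmeticFunction.log m : ℝ) : ℂ) * ee (k * m * β) := by
            refine Finset.sum_congr rfl fun m _ => ?_
            rw [ArithmeticFunction.log_apply]; congr 2; ring
          rw [e] at h2
          calc _ ≤ 1 * (2 * ll * mn (N / k) (k * β)) := by gcongr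
            _ = _ := one_mul _
        · simp
    _ ≤ ∑ k ∈ Ico 1 (U + 1), 2 * ll * mn (N / k) (k * β) := by
        rw [← Finset.sum_filter]
        apply Finset.sum_le_sum_of_subset_of_nonneg
        · intro k; simp only [Finset.mem_filter, Finset.mem_Ico]; omega
        · intro k _ _
          have := mn_nonneg ((N : ℝ) / k) (k * β) (by positivity)
          positivity
    _ ≤ 2 * ll * (8 * ll * (q + U + (N : ℝ) / q)) := by
        rw [← Finset.mul_sum]; gcongr; exact h.tI U hUN
    _ = _ := by ring

lemma vS2 {β : ℝ} {a : ℤ} {q N U : ℕ} {ll : ℝ} (h : VHyp β a q N U ll) (M : ℕ) (hMN : M ≤ N) :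
    ‖∑ n ∈ Ico 1 (M + 1), ((((lo (ArithmeticFunction.moebius : ArithmeticFunction ℝ) U *
      lo ArithmeticFunction.vonMangoldt U) * (ArithmeticFunction.zeta : ArithmeticFunction ℝ)) n : ℝ) : ℂ)
        * ee (n * β)‖ ≤ 8 * ll ^ 2 * (q + (U : ℝ) ^ 2 + (N : ℝ) / q) := by
  have hl := h.ll1
  rw [conv_sum]
  have hUN : U ^ 2 ≤ N := le_trans (Nat.pow_le_pow_right h.hU (by norm_num)) h.hUN
  have hN1 : (1 : ℝ) ≤ N := by exact_mod_cast h.N1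
  have hMN' : (M : ℝ) ≤ N := by exact_mod_cast hMN
  set f := lo (ArithmeticFunction.moebius : ArithmeticFunction ℝ) U * lo ArithmeticFunction.vonMangoldt U with hf
  have f1 : ∀ k, 1 ≤ k → k ≤ M → ‖(f k : ℂ)‖ ≤ if k ≤ U ^ 2 then ll else 0 := by
    intro k hk hkM
    rw [Complex.norm_real, Real.norm_eq_abs, hf, ArithmeticFunction.mul_apply]
    split_ifs with hkU
    · calc _ ≤ ∑ x ∈ k.divisorsAntidiagonal, ArithmeticFunction.vonMangoldt x.2 := by
            refine (Finset.abs_sum_le_sum_abs _ _).trans (Finset.sum_le_sum fun x _ => ?_)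
            have hL := ArithmeticFunction.vonMangoldt_nonneg (n := x.2)
            have hm : |(ArithmeticFunction.moebius : ArithmeticFunction ℝ) x.1| ≤ 1 := by
              rw [ArithmeticFunction.intCoe_apply]
              exact_mod_cast ArithmeticFunction.abs_moebius_le_one (n := x.1)
            rw [lo_apply, lo_apply, abs_mul]
            split_ifs
            · rw [abs_of_nonneg hL]; nlinarith
            · simpa using hL
            · simpa using hL
            · simpa using hL
        _ = Real.log k := by
            rw [← ArithmeticFunction.vonMangoldt_sum]
            rw [Nat.sum_divisorsAntidiagonal' (f := fun _ y => ArithmeticFunction.vonMangoldt y)]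
        _ ≤ ll := by
            have hk' : (k : ℝ) ≤ M := by exact_mod_cast hkM
            have := h.logle k (by exact_mod_cast hk) (by linarith)
            linarith
    · rw [Finset.sum_eq_zero, abs_zero]
      intro x hx
      rw [Nat.mem_divisorsAntidiagonal] at hx
      rw [lo_apply, lo_apply]
      by_cases h1 : x.1 ≤ U
      · by_cases h2 : x.2 ≤ U
        · exfalso; apply hkU; rw [← hx.1, sq]; exact Nat.mul_le_mul h1 h2
        · rw [if_neg h2, mul_zero]
      · rw [if_neg h1, zero_mul]
  calc _ ≤ ∑ k ∈ Ico 1 (M + 1), if k ≤ U ^ 2 then ll * mn (N / k) (k * β) else 0 := by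
        refine (norm_sum_le _ _).trans (Finset.sum_le_sum fun k hk => ?_)
        rw [Finset.mem_Ico] at hk
        have hk0 : (0 : ℝ) < k := by exact_mod_cast hk.1
        have f2 := f1 k hk.1 (by omega)
        rw [norm_mul]
        have hd : ((M / k : ℕ) : ℝ) ≤ N / k := Nat.cast_div_le.trans (by gcongr)
        have h2 := geom_mn (N / k) (k * β) 1 (M / k + 1) (by push_cast; linarith) (by positivity)
        have e : ∑ m ∈ Ico 1 (M / k + 1), ee (m * (k * β)) =
              ∑ m ∈ Ico 1 (M / k + 1), (((ArithmeticFunction.zeta : ArithmeticFunction ℝ) m : ℝ) : ℂ) * ee (k * m * β) := by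
          refine Finset.sum_congr rfl fun m hm => ?_
          rw [Finset.mem_Ico] at hm
          rw [ArithmeticFunction.natCoe_apply, ArithmeticFunction.zeta_apply, if_neg (by omega)]
          simp only [Nat.cast_one, Complex.ofReal_one, one_mul]
          congr 1; ring
        rw [e] at h2
        split_ifs with hkU
        · rw [if_pos hkU] at f2; gcongr
        · rw [if_neg hkU] at f2
          rw [le_antisymm f2 (norm_nonneg _), zero_mul]
    _ ≤ ∑ k ∈ Ico (1 : ℕ) (U ^ 2 + 1), ll * mn (N / k) (k * β) := by
        rw [← Finset.sum_filter]
        apply Finset.sum_le_sum_of_subset_of_nonneg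
        · intro k; simp only [Finset.mem_filter, Finset.mem_Ico]; omega
        · intro k _ _
          have := mn_nonneg ((N : ℝ) / k) (k * β) (by positivity)
          positivity
    _ ≤ ll * (8 * ll * (q + (U ^ 2 : ℕ) + (N : ℝ) / q)) := by
        rw [← Finset.mul_sum]; gcongr; exact h.tI (U ^ 2) hUN
    _ = _ := by push_cast; ring

lemma vS4 {β : ℝ} {a : ℤ} {q N U : ℕ} {ll : ℝ} (h : VHyp β a q N U ll) (M : ℕ) (hMN : M ≤ N) :
    ‖∑ n ∈ Ico 1 (M + 1), ((lo ArithmeticFunction.vonMangoldt U n : ℝ) : ℂ) * ee (n * β)‖ ≤ U * ll := by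
  have hl := h.ll1
  have hMN' : (M : ℝ) ≤ N := by exact_mod_cast hMN
  have hN1 : (1 : ℝ) ≤ N := by exact_mod_cast h.N1
  calc _ ≤ ∑ k ∈ Ico 1 (M + 1), if k ≤ U then ll else 0 := by
        refine (norm_sum_le _ _).trans (Finset.sum_le_sum fun k hk => ?_)
        rw [Finset.mem_Ico] at hk
        rw [norm_mul, norm_ee, mul_one, Complex.norm_real, Real.norm_eq_abs, lo_apply]
        split_ifs
        · rw [abs_of_nonneg ArithmeticFunction.vonMangoldt_nonneg]
          have hk' : (k : ℝ) ≤ M := by exact_mod_cast (show k ≤ M by omega)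
          have := h.logle k (by exact_mod_cast hk.1) (by linarith)
          linarith [ArithmeticFunction.vonMangoldt_le_log (n := k)]
        · simp
    _ ≤ ∑ k ∈ Ico 1 (U + 1), ll := by
        rw [← Finset.sum_filter]
        apply Finset.sum_le_sum_of_subset_of_nonneg
        · intro k; simp only [Finset.mem_filter, Finset.mem_Ico]; omega
        · intro k _ _; linarith
    _ = _ := by simp

end DPM

namespace DPM
open Finset

noncomputable def gS (U : ℕ) : ArithmeticFunction ℝ :=
  hi (ArithmeticFunction.moebius : ArithmeticFunction ℝ) U * (ArithmeticFunction.zeta : ArithmeticFunction ℝ)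

lemma gS_bound (U k : ℕ) : ‖(gS U k : ℂ)‖ ≤ #k.divisors := by
  rw [Complex.norm_real, Real.norm_eq_abs, gS, ArithmeticFunction.coe_mul_zeta_apply]
  refine (Finset.abs_sum_le_sum_abs _ _).trans ?_
  calc _ ≤ ∑ x ∈ k.divisors, (1 : ℝ) := by
        refine Finset.sum_le_sum fun x _ => ?_
        rw [hi_apply]
        split_ifs
        · simp
        · rw [ArithmeticFunction.intCoe_apply]
          exact_mod_cast ArithmeticFunction.abs_moebius_le_one (n := x)
    _ = _ := by simp

lemma gS_zero (U k : ℕ) (h : k ≤ U) : gS U k = 0 := by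
  rw [gS, ArithmeticFunction.coe_mul_zeta_apply]
  refine Finset.sum_eq_zero fun x hx => ?_
  rw [hi_apply, if_pos ((Nat.divisor_le hx).trans h)]

lemma vS3_block {β : ℝ} {a : ℤ} {q N U : ℕ} {ll : ℝ} (h : VHyp β a q N U ll) (M : ℕ) (hMN : M ≤ N)
    (X : ℕ) (hX : 1 ≤ X) :
    ‖∑ m ∈ Ico X (2 * X), ((hi ArithmeticFunction.vonMangoldt U m : ℝ) : ℂ) *
      ∑ k ∈ Ico 1 (M / m + 1), (gS U k : ℂ) * ee (m * k * β)‖ ^ 2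
      ≤ 18 * N * ll ^ 6 * ((N : ℝ) / q + (N : ℝ) / U + q) := by
  have hl := h.ll1
  have hMN' : (M : ℝ) ≤ N := by exact_mod_cast hMN
  have hN1 : (1 : ℝ) ≤ N := by exact_mod_cast h.N1
  have hq0 : (0 : ℝ) < q := by exact_mod_cast h.ap.1
  have hU0 : (0 : ℝ) < U := by exact_mod_cast h.hU
  have hX0 : (0 : ℝ) < X := by exact_mod_cast hX
  by_cases hc1 : 2 * X ≤ U
  · rw [Finset.sum_eq_zero]
    · simp; positivity
    · intro m hm
      rw [Finset.mem_Ico] at hm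
      rw [hi_apply, if_pos (by omega)]; simp
  by_cases hc2 : M < X * U
  · rw [Finset.sum_eq_zero]
    · simp; positivity
    · intro m hm
      rw [Finset.mem_Ico] at hm
      rw [Finset.sum_eq_zero, mul_zero]
      intro k hk
      rw [Finset.mem_Ico] at hk
      have h1 : k ≤ M / m := by omega
      rw [Nat.le_div_iff_mul_le (by omega)] at h1
      have : k ≤ U := by
        by_contra hcon
        push Not at hcon
        have : X * U ≤ k * m := by rw [mul_comm X]; exact Nat.mul_le_mul hcon.le hm.1
        omega
      rw [gS_zero U k this]; simp
  push Not at hc1 hc2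
  have hMX : 1 ≤ M / X := by
    rw [Nat.le_div_iff_mul_le (by omega)]
    have : X * 1 ≤ X * U := Nat.mul_le_mul_left X h.hU
    omega
  by_cases hM0 : 2 * X ≤ M + 1 ∨ M + 1 < 2 * X
  swap
  · omega
  have key := bilin β X (2 * X) (by omega) (Ico 1 (M / X + 1)) (fun k => M / k)
    (fun m => if m ≤ M then ((hi ArithmeticFunction.vonMangoldt U m : ℝ) : ℂ) else 0) (fun k => (gS U k : ℂ)) (fun _ => ll ^ 2) (fun _ => 1)
    (fun _ _ => by positivity) (fun _ _ => zero_le_one) (by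
      intro m hm
      rw [Finset.mem_Ico] at hm
      rw [mul_one]
      gcongr
      split_ifs with hmM
      · rw [Complex.norm_real, Real.norm_eq_abs, hi_apply]
        split_ifs
        · simp; linarith
        · rw [abs_of_nonneg ArithmeticFunction.vonMangoldt_nonneg]
          have hk' : (m : ℝ) ≤ M := by exact_mod_cast hmM
          have := h.logle m (by exact_mod_cast (show 0 < m by omega)) (by linarith)
          linarith [ArithmeticFunction.vonMangoldt_le_log (n := m)]
      · simp; linarith) (fun k l => mn X (((k : ℝ) - l) * β)) (by
      intro k _ l _ Y h1 h2
      simp only [Complex.ofReal_one, one_mul]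
      apply geom_mn
      · have : (Y : ℝ) ≤ 2 * X := by exact_mod_cast h2
        linarith
      · positivity) (by
      intro k _ l _
      rw [← mn_neg]; congr 1; ring)
  have e : ∑ m ∈ Ico X (2 * X), ((hi ArithmeticFunction.vonMangoldt U m : ℝ) : ℂ) *
      ∑ k ∈ Ico 1 (M / m + 1), (gS U k : ℂ) * ee (m * k * β) =
      ∑ m ∈ Ico X (2 * X), (if m ≤ M then ((hi ArithmeticFunction.vonMangoldt U m : ℝ) : ℂ) else 0) *
      ∑ k ∈ Ico 1 (M / X + 1) with m ≤ M / k, (gS U k : ℂ) * ee (m * k * β) := by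
    refine Finset.sum_congr rfl fun m hm => ?_
    rw [Finset.mem_Ico] at hm
    have es : Ico 1 (M / m + 1) = (Ico 1 (M / X + 1)).filter (fun k => m ≤ M / k) := by
      ext k
      simp only [Finset.mem_Ico, Finset.mem_filter, Nat.lt_add_one_iff]
      constructor
      · rintro ⟨h1, h2⟩
        rw [Nat.le_div_iff_mul_le (by omega)] at h2
        refine ⟨⟨h1, ?_⟩, ?_⟩
        · rw [Nat.le_div_iff_mul_le (by omega)]
          exact le_trans (Nat.mul_le_mul_left k hm.1) h2
        · rw [Nat.le_div_iff_mul_le (by omega), mul_comm]; exact h2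
      · rintro ⟨⟨h1, _⟩, h2⟩
        rw [Nat.le_div_iff_mul_le (by omega)] at h2
        refine ⟨h1, ?_⟩
        rw [Nat.le_div_iff_mul_le (by omega), mul_comm]; exact h2
    rw [es]
    split_ifs with hmM
    · rfl
    · rw [← es, Nat.div_eq_of_lt (by omega)]; simp
  rw [e]
  refine key.trans ?_
  have hKX : ((M / X : ℕ) : ℝ) ≤ N / X := Nat.cast_div_le.trans (by gcongr)
  have hW : ∀ k ∈ Ico 1 (M / X + 1), ∑ l ∈ Ico 1 (M / X + 1), mn X (((k : ℝ) - l) * β) ≤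
      (2 * ((N : ℝ) / X) / q + 1) * (2 * X + 4 * q * ll) := by
    intro k _
    have hb := blocks h.ap (-(k * β)) X (by positivity) (fun l => mn X (l * β + -(k * β))) (M / X) 1
      (fun l _ => mn_le _ _) (fun l _ => mn_nd _ _)
    have hlog := h.logle (2 * q) (by positivity) (by
      have : (q : ℝ) ≤ N := by exact_mod_cast h.hqN
      linarith)
    have e2 : ∑ l ∈ Ico 1 (M / X + 1), mn X (((k : ℝ) - l) * β) =
        ∑ l ∈ Ico (1 : ℤ) (1 + (M / X : ℕ)), mn X (l * β + -(k * β)) := by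
      have : Ico (1 : ℤ) (1 + (M / X : ℕ)) = (Ico 1 (M / X + 1)).image (fun l : ℕ => (l : ℤ)) := by
        ext l
        simp only [Finset.mem_Ico, Finset.mem_image]
        constructor
        · rintro ⟨h1, h2⟩
          exact ⟨l.toNat, by omega, by omega⟩
        · rintro ⟨x, h1, rfl⟩; omega
      rw [this, Finset.sum_image (by intro x _ y _ hxy; exact Int.ofNat_inj.1 hxy)]
      refine Finset.sum_congr rfl fun l _ => ?_
      rw [← mn_neg]; congr 1; push_cast; ring
    rw [e2]
    refine hb.trans ?_
    have hlog0 : 0 ≤ Real.log (2 * q) := Real.log_nonneg (by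
      have hq1 : (1:ℝ) ≤ q := by exact_mod_cast h.ap.1
      linarith)
    gcongr
  have hτ := tau_sq (M / X) hMX
  have hlogK : 1 + Real.log (M / X : ℕ) ≤ ll := by
    apply h.logle
    · exact_mod_cast hMX
    · have : ((M / X : ℕ) : ℝ) ≤ M := by exact_mod_cast Nat.div_le_self _ _
      linarith
  have hlogK0 : 0 ≤ 1 + Real.log (M / X : ℕ) := by
    have := Real.log_nonneg (show (1 : ℝ) ≤ (M / X : ℕ) by exact_mod_cast hMX)
    linarith
  have hXu : (X : ℝ) ≤ N / U := by
    rw [le_div_iff₀ hU0]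
    have : (X : ℝ) * U ≤ M := by exact_mod_cast hc2
    linarith
  have hXl : (N : ℝ) / X ≤ 2 * (N / U) := by
    rw [← mul_div_assoc, div_le_div_iff₀ hX0 hU0]
    have : (U : ℝ) < 2 * X := by exact_mod_cast hc1
    nlinarith
  have hW0 : 0 ≤ (2 * ((N : ℝ) / X) / q + 1) * (2 * X + 4 * q * ll) := by positivity
  calc _ ≤ (X * ll ^ 2) * (((N : ℝ) / X * ll ^ 3) * ((2 * ((N : ℝ) / X) / q + 1) * (2 * X + 4 * q * ll))) := by
        have i1 : ∑ m ∈ Ico X (2 * X), ll ^ 2 = X * ll ^ 2 := by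
          rw [Finset.sum_const, Nat.card_Ico, nsmul_eq_mul]; congr 2; omega
        rw [i1]
        gcongr
        calc _ ≤ ∑ k ∈ Ico 1 (M / X + 1), (#k.divisors : ℝ) ^ 2 *
              ((2 * ((N : ℝ) / X) / q + 1) * (2 * X + 4 * q * ll)) := by
              refine Finset.sum_le_sum fun k hk => ?_
              have := gS_bound U k
              refine mul_le_mul (by gcongr) (hW k hk) ?_ (by positivity)
              exact Finset.sum_nonneg fun l _ => mn_nonneg _ _ (by positivity)
          _ ≤ _ := by
              rw [← Finset.sum_mul]
              gcongr
              refine hτ.trans ?_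
              gcongr
    _ = N * ll ^ 5 * (4 * (N / q) + 8 * (N / X) * ll + 2 * X + 4 * q * ll) := by
        field_simp; ring
    _ ≤ N * ll ^ 5 * (4 * (N / q) * ll + 8 * (2 * (N / U)) * ll + 2 * (N / U) * ll + 4 * q * ll) := by
        have j1 : 4 * ((N : ℝ) / q) ≤ 4 * (N / q) * ll := le_mul_of_one_le_right (by positivity) hl
        have j2 : 2 * (X : ℝ) ≤ 2 * (N / U) * ll := by
          have : 2 * ((N : ℝ) / U) ≤ 2 * (N / U) * ll := le_mul_of_one_le_right (by positivity) hl
          linarith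
        gcongr
    _ ≤ _ := by
        have j3 : 0 ≤ N * ll ^ 6 * ((N : ℝ) / q) := by positivity
        have j4 : 0 ≤ N * ll ^ 6 * (q : ℝ) := by positivity
        nlinarith

lemma vS3 {β : ℝ} {a : ℤ} {q N U : ℕ} {ll : ℝ} (h : VHyp β a q N U ll) (M : ℕ) (hMN : M ≤ N) :
    ‖∑ n ∈ Ico 1 (M + 1), (((hi ArithmeticFunction.vonMangoldt U * gS U) n : ℝ) : ℂ) * ee (n * β)‖
      ≤ 10 * ll ^ 4 * √(N * ((N : ℝ) / q + (N : ℝ) / U + q)) := by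
  have hl := h.ll1
  rw [conv_sum]
  set f : ℕ → ℂ := fun m => ((hi ArithmeticFunction.vonMangoldt U m : ℝ) : ℂ) *
      ∑ k ∈ Ico 1 (M / m + 1), (gS U k : ℂ) * ee (m * k * β) with hf
  set Z := N * ((N : ℝ) / q + (N : ℝ) / U + q) with hZ
  have hZ0 : 0 ≤ Z := by positivity
  have hblock : ∀ X : ℕ, 1 ≤ X → ‖∑ m ∈ Ico X (2 * X), f m‖ ≤ 5 * ll ^ 3 * √Z := by
    intro X hX
    have h1 := vS3_block h M hMN X hX
    apply le_of_sq_le_sq _ (by positivity)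
    rw [mul_pow, Real.sq_sqrt hZ0]
    refine h1.trans ?_
    have : 0 ≤ ll ^ 6 * Z := by positivity
    rw [hZ] at this ⊢
    nlinarith
  have hdy : ∀ i : ℕ, ‖∑ m ∈ Ico 1 (2 ^ i), f m‖ ≤ i * (5 * ll ^ 3 * √Z) := by
    intro i
    induction i with
    | zero => simp
    | succ i ih =>
      have : 1 ≤ 2 ^ i := Nat.one_le_two_pow
      rw [← Finset.sum_Ico_consecutive f this (show 2 ^ i ≤ 2 ^ (i + 1) by rw [pow_succ]; omega)]
      refine (norm_add_le _ _).trans ?_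
      have h2 := hblock (2 ^ i) this
      rw [show 2 ^ (i + 1) = 2 * 2 ^ i by ring]
      push_cast
      linarith
  rcases Nat.eq_zero_or_pos M with hM | hM
  · subst hM; simp; positivity
  have hM1 : (1 : ℝ) ≤ M := by exact_mod_cast hM
  set i := Nat.log 2 M + 1 with hi
  have hiM : M + 1 ≤ 2 ^ i := Nat.lt_pow_succ_log_self (by norm_num) M
  have e : ∑ m ∈ Ico 1 (M + 1), f m = ∑ m ∈ Ico 1 (2 ^ i), f m := by
    apply Finset.sum_subset
    · intro m; simp only [Finset.mem_Ico]; omega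
    · intro m h1 h2
      simp only [Finset.mem_Ico] at h1 h2
      simp only [hf]
      rw [Nat.div_eq_of_lt (by omega)]; simp
  rw [e]
  refine (hdy i).trans ?_
  have hi2 : (i : ℝ) ≤ 2 * ll := by
    have h1 : (2 : ℝ) ^ Nat.log 2 M ≤ M := by exact_mod_cast Nat.pow_log_le_self 2 (by omega)
    have h2 := Real.log_le_log (by positivity) h1
    rw [Real.log_pow] at h2
    have h3 := Real.log_two_gt_d9
    have hMN' : (M : ℝ) ≤ N := by exact_mod_cast hMN
    have h4 := h.logle M (by linarith) (by linarith)
    have h5 : (0 : ℝ) ≤ Nat.log 2 M := by positivity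
    rw [hi]; push_cast
    nlinarith
  calc _ ≤ 2 * ll * (5 * ll ^ 3 * √Z) := by gcongr
    _ = _ := by ring

lemma v_main {β : ℝ} {a : ℤ} {q N U : ℕ} {ll : ℝ} (h : VHyp β a q N U ll) (M : ℕ) (hMN : M ≤ N) :
    ‖∑ n ∈ Ico 1 (M + 1), ((ArithmeticFunction.vonMangoldt n : ℝ) : ℂ) * ee (n * β)‖
      ≤ 83 * ll ^ 4 * √(N * ((N : ℝ) / q + (N : ℝ) / U + q)) := by
  have hl := h.ll1
  have e : ∑ n ∈ Ico 1 (M + 1), ((ArithmeticFunction.vonMangoldt n : ℝ) : ℂ) * ee (n * β) =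
    ∑ n ∈ Ico 1 (M + 1), ((lo ArithmeticFunction.vonMangoldt U n : ℝ) : ℂ) * ee (n * β)
    + ∑ n ∈ Ico 1 (M + 1), (((lo (ArithmeticFunction.moebius : ArithmeticFunction ℝ) U *
      ArithmeticFunction.log) n : ℝ) : ℂ) * ee (n * β)
    - ∑ n ∈ Ico 1 (M + 1), ((((lo (ArithmeticFunction.moebius : ArithmeticFunction ℝ) U *
      lo ArithmeticFunction.vonMangoldt U) * (ArithmeticFunction.zeta : ArithmeticFunction ℝ)) n : ℝ) : ℂ)
        * ee (n * β)
    + ∑ n ∈ Ico 1 (M + 1), (((hi ArithmeticFunction.vonMangoldt U * gS U) n : ℝ) : ℂ) * ee (n * β) := by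
    rw [← Finset.sum_add_distrib, ← Finset.sum_sub_distrib, ← Finset.sum_add_distrib]
    refine Finset.sum_congr rfl fun n _ => ?_
    have hv : ArithmeticFunction.vonMangoldt n = _ := congrArg (fun f => f n) (vaughan U)
    beta_reduce at hv
    rw [ArithmeticFunction.add_apply, sub_eq_add_neg, ArithmeticFunction.add_apply, ArithmeticFunction.add_apply,
      ArithmeticFunction.neg_apply] at hv
    rw [hv, gS]; push_cast; ring
  rw [e]
  have s1 := vS1 h M hMN
  have s2 := vS2 h M hMN
  have s3 := vS3 h M hMN
  have s4 := vS4 h M hMN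
  set R := √(N * ((N : ℝ) / q + (N : ℝ) / U + q)) with hR
  have hN1 : (1 : ℝ) ≤ N := by exact_mod_cast h.N1
  have hq0 : (1 : ℝ) ≤ q := by exact_mod_cast h.ap.1
  have hqN : (q : ℝ) ≤ N := by exact_mod_cast h.hqN
  have hU0 : (1 : ℝ) ≤ U := by exact_mod_cast h.hU
  have hUN : (U : ℝ) ^ 3 ≤ N := by exact_mod_cast h.hUN
  have n1 : 0 ≤ (N : ℝ) / q := by positivity
  have n2 : 0 ≤ (N : ℝ) / U := by positivity
  have r1 : (q : ℝ) ≤ R := by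
    apply Real.le_sqrt_of_sq_le; nlinarith
  have r2 : (N : ℝ) / q ≤ R := by
    apply Real.le_sqrt_of_sq_le
    have : (N : ℝ) / q ≤ N := div_le_self (by positivity) hq0
    nlinarith
  have r3 : (U : ℝ) ^ 2 ≤ R := by
    apply Real.le_sqrt_of_sq_le
    have : (U : ℝ) ^ 2 ≤ N / U := by rw [le_div_iff₀ (by linarith)]; nlinarith
    have : (U : ℝ) ^ 2 ≤ N := by nlinarith
    nlinarith
  have r4 : (U : ℝ) ≤ R := by nlinarith
  have hR0 : 0 ≤ R := by positivity
  have l2 : ll ^ 2 ≤ ll ^ 4 := pow_le_pow_right₀ hl (by norm_num)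
  have l1 : ll ≤ ll ^ 4 := by simpa using pow_le_pow_right₀ hl (show 1 ≤ 4 by norm_num)
  have t1 : 16 * ll ^ 2 * (q + U + (N : ℝ) / q) ≤ 48 * (ll ^ 4 * R) := by
    calc _ ≤ 16 * ll ^ 4 * (R + R + R) := by gcongr
      _ = _ := by ring
  have t2 : 8 * ll ^ 2 * (q + (U : ℝ) ^ 2 + (N : ℝ) / q) ≤ 24 * (ll ^ 4 * R) := by
    calc _ ≤ 8 * ll ^ 4 * (R + R + R) := by gcongr
      _ = _ := by ring
  have t4 : U * ll ≤ ll ^ 4 * R := by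
    calc _ ≤ R * ll ^ 4 := by gcongr
      _ = _ := by ring
  refine (norm_add_le _ _).trans ?_
  refine (add_le_add_left ((norm_sub_le _ _).trans (add_le_add_left (norm_add_le _ _) _)) _).trans ?_
  linarith

end DPM
namespace DPM
open Finset

theorem theta_exp {β : ℝ} {a : ℤ} {q N U : ℕ} {ll : ℝ} (h : VHyp β a q N U ll) (M : ℕ) (hMN : M ≤ N) :
    ‖∑ n ∈ Ico 1 (M + 1), (if n.Prime then ((Real.log n : ℝ) : ℂ) * ee (n * β) else 0)‖
      ≤ 85 * ll ^ 4 * √(N * ((N : ℝ) / q + (N : ℝ) / U + q)) := by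
  have hl := h.ll1
  have h0 := v_main h M hMN
  set R := √(N * ((N : ℝ) / q + (N : ℝ) / U + q)) with hR
  rcases Nat.eq_zero_or_pos M with rfl | hM
  · simp; positivity
  have e : ∑ n ∈ Ico 1 (M + 1), ((ArithmeticFunction.vonMangoldt n : ℝ) : ℂ) * ee (n * β) =
     ∑ n ∈ Ico 1 (M + 1), (if n.Prime then ((Real.log n : ℝ) : ℂ) * ee (n * β) else 0)
     + ∑ n ∈ Ico 1 (M + 1) with ¬ n.Prime, ((ArithmeticFunction.vonMangoldt n : ℝ) : ℂ) * ee (n * β) := by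
    rw [Finset.sum_filter, ← Finset.sum_add_distrib]
    refine Finset.sum_congr rfl fun n _ => ?_
    by_cases hp : n.Prime
    · simp [hp, ArithmeticFunction.vonMangoldt_apply_prime hp]
    · simp [hp]
  have hM1 : (1 : ℝ) ≤ M := by exact_mod_cast hM
  have hs : ‖∑ n ∈ Ico 1 (M + 1) with ¬ n.Prime, ((ArithmeticFunction.vonMangoldt n : ℝ) : ℂ) * ee (n * β)‖
      ≤ 2 * √M * Real.log M := by
    refine (norm_sum_le _ _).trans ?_
    have h1 := Chebyshev.psi_sub_theta_eq_sum_not_prime (M : ℝ)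
    have h2 := Chebyshev.psi_sub_theta_le hM1
    rw [h1, Nat.floor_natCast] at h2
    refine le_trans (le_of_eq ?_) h2
    have : Ioc 0 M = Ico 1 (M + 1) := by ext; simp; omega
    rw [this]
    refine Finset.sum_congr rfl fun n _ => ?_
    rw [norm_mul, norm_ee, mul_one, Complex.norm_real, Real.norm_of_nonneg ArithmeticFunction.vonMangoldt_nonneg]
  have hq0 : (1 : ℝ) ≤ q := by exact_mod_cast h.ap.1
  have hMN' : (M : ℝ) ≤ N := by exact_mod_cast hMN
  have hsR : √M ≤ R := by
    apply Real.sqrt_le_sqrt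
    have : 0 ≤ (N : ℝ) / q + (N : ℝ) / U := by positivity
    nlinarith
  have hlM : Real.log M ≤ ll := by
    have := h.logle M (by linarith) (by linarith)
    linarith
  have l1 : ll ≤ ll ^ 4 := by simpa using pow_le_pow_right₀ hl (show 1 ≤ 4 by norm_num)
  have t : 2 * √M * Real.log M ≤ 2 * R * ll ^ 4 := by
    have := Real.log_nonneg hM1
    gcongr; linarith
  have e2 := eq_sub_of_add_eq e.symm
  rw [e2]
  refine (norm_sub_le _ _).trans ?_
  linarith

theorem prime_exp {β : ℝ} {a : ℤ} {q N U : ℕ} {ll : ℝ} (h : VHyp β a q N U ll) :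
    ‖∑ n ∈ Ico 1 (N + 1) with n.Prime, ee (n * β)‖
      ≤ 170 * ll ^ 4 * √(N * ((N : ℝ) / q + (N : ℝ) / U + q)) := by
  have hl := h.ll1
  have hth := theta_exp h
  set R := √(N * ((N : ℝ) / q + (N : ℝ) / U + q)) with hR
  have hN := h.N1
  have hlog : ∀ n : ℕ, 2 ≤ n → 0 < Real.log n := fun n hn => Real.log_pos (by exact_mod_cast hn)
  have key := abel_bound (fun n => if n.Prime then ((Real.log n : ℝ) : ℂ) * ee (n * β) else 0)
    (fun n => ((1 / Real.log n : ℝ) : ℂ)) (85 * ll ^ 4 * R) 2 (N + 1) (by omega) (by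
      intro Z hZ1 hZ2
      have := hth (Z - 1) (by omega)
      rw [show Z - 1 + 1 = Z by omega, Finset.sum_eq_sum_Ico_succ_bot (by omega)] at this
      simpa [Nat.not_prime_one] using this)
  have e : ∑ n ∈ Ico 1 (N + 1) with n.Prime, ee (n * β) = ∑ n ∈ Ico 2 (N + 1),
     (if n.Prime then ((Real.log n : ℝ) : ℂ) * ee (n * β) else 0) * ((1 / Real.log n : ℝ) : ℂ) := by
    rw [Finset.sum_filter, Finset.sum_eq_sum_Ico_succ_bot (by omega)]
    simp only [Nat.not_prime_one, if_false, zero_add]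
    refine Finset.sum_congr rfl fun n hn => ?_
    split_ifs with hp
    · have := (hlog n hp.two_le).ne'
      have h2 : ((Real.log n : ℝ) : ℂ) ≠ 0 := by exact_mod_cast this
      push_cast at h2 ⊢
      field_simp
    · simp
  have hv : ∀ n : ℕ, 2 ≤ n → ‖((1 / Real.log n : ℝ) : ℂ)‖ + ∑ m ∈ Ico 2 n,
      ‖((1 / Real.log ((m + 1 : ℕ)) : ℝ) : ℂ) - ((1 / Real.log m : ℝ) : ℂ)‖ = 1 / Real.log 2 := by
    intro n hn
    induction n, hn using Nat.le_induction with
    | base =>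
      have := hlog 2 le_rfl
      rw [Finset.Ico_self, Finset.sum_empty, add_zero, Complex.norm_real, Real.norm_of_nonneg (by positivity)]
      norm_num
    | succ n hn ih =>
      rw [Finset.sum_Ico_succ_top (by omega), ← ih]
      have h1 := hlog n hn
      have h2 := hlog (n + 1) (by omega)
      have h3 : 1 / Real.log ((n + 1 : ℕ)) ≤ 1 / Real.log n := by
        apply one_div_le_one_div_of_le h1
        apply Real.log_le_log (by positivity)
        push_cast; linarith
      have nn : ∀ x : ℝ, 0 ≤ x → ‖(x : ℂ)‖ = x := fun x hx => by
        rw [Complex.norm_real, Real.norm_of_nonneg hx]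
      rw [norm_sub_rev, ← Complex.ofReal_sub, nn (1 / Real.log n) (by positivity),
        nn (1 / Real.log n - _) (by linarith), nn _ (by positivity)]
      ring
  rw [e]
  refine key.trans ?_
  rw [hv (N + 1) (by omega)]
  have : 1 / Real.log 2 ≤ 2 := by
    rw [div_le_iff₀ (Real.log_pos (by norm_num))]
    have := Real.log_two_gt_d9
    linarith
  calc _ ≤ 85 * ll ^ 4 * R * 2 := by gcongr
    _ = _ := by ring

end DPM
namespace DPM
open Finset

noncomputable def mon (x : ℕ → ℝ) (t : Finset ℕ) : ℝ := ∏ p ∈ t, x p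
noncomputable def vv (x : ℕ → ℝ) (S : Finset ℕ) : ℝ := ∏ p ∈ S, (1 - x p)
noncomputable def sg (x : ℕ → ℝ) (k : ℕ) (S : Finset ℕ) : ℝ :=
  ∑ t ∈ S.powerset, (if t.card < k then (-1) ^ t.card else 0) * mon x t
noncomputable def es (x : ℕ → ℝ) (k : ℕ) (S : Finset ℕ) : ℝ :=
  ∑ t ∈ S.powerset, (if t.card = k then 1 else 0) * mon x t

theorem mon_insert (x : ℕ → ℝ) {p : ℕ} {t : Finset ℕ} (h : p ∉ t) : mon x (insert p t) = x p * mon x t :=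
  Finset.prod_insert h

theorem sg_insert (x : ℕ → ℝ) (k : ℕ) {p : ℕ} {S : Finset ℕ} (h : p ∉ S) :
    sg x (k + 1) (insert p S) = sg x (k + 1) S - x p * sg x k S := by
  unfold sg
  rw [Finset.sum_powerset_insert h, Finset.mul_sum, sub_eq_add_neg, ← Finset.sum_neg_distrib]
  congr 1
  refine Finset.sum_congr rfl fun t ht => ?_
  have hpt : p ∉ t := fun hp => h (Finset.mem_powerset.1 ht hp)
  rw [mon_insert x hpt, Finset.card_insert_of_notMem hpt]
  simp only [Nat.add_lt_add_iff_right]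
  split_ifs <;> ring

theorem es_insert (x : ℕ → ℝ) (k : ℕ) {p : ℕ} {S : Finset ℕ} (h : p ∉ S) :
    es x (k + 1) (insert p S) = es x (k + 1) S + x p * es x k S := by
  unfold es
  rw [Finset.sum_powerset_insert h, Finset.mul_sum]
  congr 1
  refine Finset.sum_congr rfl fun t ht => ?_
  have hpt : p ∉ t := fun hp => h (Finset.mem_powerset.1 ht hp)
  rw [mon_insert x hpt, Finset.card_insert_of_notMem hpt]
  simp only [Nat.add_right_cancel_iff]
  split_ifs <;> ring

theorem es_zero (x : ℕ → ℝ) (S : Finset ℕ) : es x 0 S = 1 := by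
  unfold es
  rw [Finset.sum_eq_single ∅]
  · simp [mon]
  · intro t _ ht
    simp [ht]
  · intro h; simp at h

theorem brun (x : ℕ → ℝ) (h0 : ∀ p, 0 ≤ x p) (h1 : ∀ p, x p ≤ 1) (S : Finset ℕ) :
    ∀ k, 0 ≤ (-1) ^ k * (vv x S - sg x k S) ∧ (-1) ^ k * (vv x S - sg x k S) ≤ es x k S := by
  induction S using Finset.induction_on with
  | empty =>
    intro k
    rcases k with _ | k
    · simp [vv, sg, es, mon]
    · simp [vv, sg, es, mon]
  | insert p S hp ih =>
    intro k
    have hv : vv x (insert p S) = vv x S - x p * vv x S := by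
      unfold vv; rw [Finset.prod_insert hp]; ring
    rcases k with _ | k
    · have hz : ∀ S, sg x 0 S = 0 := fun S => by simp [sg]
      have := ih 0
      rw [hz, es_zero] at this ⊢
      have a := h0 p; have b := h1 p
      rw [hv]
      simp only [pow_zero, one_mul, sub_zero] at this ⊢
      constructor <;> nlinarith
    · obtain ⟨a1, a2⟩ := ih k
      obtain ⟨b1, b2⟩ := ih (k + 1)
      have e : (-1) ^ (k + 1) * (vv x (insert p S) - sg x (k + 1) (insert p S)) =
        (-1) ^ (k + 1) * (vv x S - sg x (k + 1) S) + x p * ((-1) ^ k * (vv x S - sg x k S)) := by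
        rw [hv, sg_insert x k hp]; ring
      rw [e, es_insert x k hp]
      have a := h0 p
      exact ⟨by positivity, by gcongr⟩

theorem es_le (x : ℕ → ℝ) (h0 : ∀ p, 0 ≤ x p) (S : Finset ℕ) :
    ∀ k, es x k S ≤ (∑ p ∈ S, x p) ^ k / k.factorial := by
  induction S using Finset.induction_on with
  | empty =>
    intro k
    rcases k with _ | k
    · simp [es, mon]
    · simp [es]
  | insert p S hp ih =>
    intro k
    rcases k with _ | k
    · simp [es_zero]
    · rw [es_insert x k hp, Finset.sum_insert hp]
      have i1 := ih k
      have i2 := ih (k + 1)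
      set s := ∑ p ∈ S, x p with hs
      have s0 : 0 ≤ s := Finset.sum_nonneg fun p _ => h0 p
      have a := h0 p
      have hB : ∀ k : ℕ, s ^ (k + 1) + (k + 1) * x p * s ^ k ≤ (x p + s) ^ (k + 1) := by
        intro k
        induction k with
        | zero => simp; linarith
        | succ k ihk =>
          rw [pow_succ (x p + s) (k + 1)]
          have : (s ^ (k + 1) + (k + 1) * x p * s ^ k) * (x p + s) ≤ (x p + s) ^ (k + 1) * (x p + s) := by gcongr
          refine le_trans ?_ this
          have : 0 ≤ (k + 1) * x p * s ^ k * x p := by positivity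
          push_cast; ring_nf at this ⊢; linarith
      have := hB k
      rw [le_div_iff₀ (by positivity)] at i1 i2 ⊢
      have hf : ((k + 1).factorial : ℝ) = (k + 1) * k.factorial := by rw [Nat.factorial_succ]; push_cast; ring
      rw [hf] at i2 ⊢
      refine le_trans ?_ this
      have : (k + 1) * x p * (es x k S * k.factorial) ≤ (k + 1) * x p * s ^ k := by gcongr
      linarith

theorem mon_nonneg (x : ℕ → ℝ) (h0 : ∀ p, 0 ≤ x p) (t) : 0 ≤ mon x t := Finset.prod_nonneg fun p _ => h0 p

/-- Sieve data. -/
structure SD (S : Finset ℕ) (D : ℕ) (δ : ℝ) {ι : Type} (I : Finset ι) (d : ι → Finset ℕ) (l k : ι → ℝ) : Prop where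
  sub : ∀ i ∈ I, d i ⊆ S
  le : ∀ i ∈ I, ∏ p ∈ d i, p ≤ D
  sum : ∑ i ∈ I, (|l i| + |k i|) ≤ D
  lower : ∀ x : ℕ → ℝ, (∀ p, 0 ≤ x p) → (∀ p, x p ≤ 1) → vv x S ≤ ∑ i ∈ I, l i * mon x (d i)
  upper : ∀ x : ℕ → ℝ, (∀ p, 0 ≤ x p) → (∀ p, x p ≤ 1) →
    ∑ i ∈ I, l i * mon x (d i) ≤ vv x S + ∑ i ∈ I, k i * mon x (d i)
  tt : ∑ i ∈ I, l i * mon (fun p => (1 / p : ℝ)) (d i) ≤ vv (fun p => (1 / p : ℝ)) S * (1 + δ)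
  kk : ∑ i ∈ I, k i * mon (fun p => (1 / p : ℝ)) (d i) ≤ vv (fun p => (1 / p : ℝ)) S * δ
  d0 : 0 ≤ δ

theorem vv_nonneg (x : ℕ → ℝ) (h1 : ∀ p, x p ≤ 1) (S) : 0 ≤ vv x S :=
  Finset.prod_nonneg fun p _ => by linarith [h1 p]

theorem inv01 : (∀ p : ℕ, (0 : ℝ) ≤ 1 / p) ∧ (∀ p : ℕ, (1 / p : ℝ) ≤ 1) := by
  refine ⟨fun p => by positivity, fun p => ?_⟩
  rcases Nat.eq_zero_or_pos p with rfl | h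
  · simp
  · rw [div_le_one (by positivity)]; exact_mod_cast h

theorem SD.combine {S1 S2 : Finset ℕ} (hd : Disjoint S1 S2) {D1 D2 : ℕ} {δ1 δ2 : ℝ} {ι1 ι2 : Type}
    {I1 : Finset ι1} {I2 : Finset ι2} {d1 d2 l1 l2 k1 k2} (h1 : SD S1 D1 δ1 I1 d1 l1 k1)
    (h2 : SD S2 D2 δ2 I2 d2 l2 k2) :
    SD (S1 ∪ S2) (D1 * D2) (δ1 + δ2 + 2 * δ1 * δ2) (I1 ×ˢ I2) (fun i => d1 i.1 ∪ d2 i.2)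
      (fun i => l1 i.1 * l2 i.2) (fun i => k1 i.1 * l2 i.2 + l1 i.1 * k2 i.2) := by
  have hdd : ∀ i ∈ I1 ×ˢ I2, Disjoint (d1 i.1) (d2 i.2) := by
    intro i hi
    rw [Finset.mem_product] at hi
    exact Finset.disjoint_of_subset_left (h1.sub _ hi.1) (Finset.disjoint_of_subset_right (h2.sub _ hi.2) hd)
  have hm : ∀ x, ∀ i ∈ I1 ×ˢ I2, mon x (d1 i.1 ∪ d2 i.2) = mon x (d1 i.1) * mon x (d2 i.2) :=
    fun x i hi => Finset.prod_union (hdd i hi)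
  have hv : ∀ x, vv x (S1 ∪ S2) = vv x S1 * vv x S2 := fun x => Finset.prod_union hd
  have eT : ∀ x, ∑ i ∈ I1 ×ˢ I2, l1 i.1 * l2 i.2 * mon x (d1 i.1 ∪ d2 i.2) =
      (∑ i ∈ I1, l1 i * mon x (d1 i)) * ∑ i ∈ I2, l2 i * mon x (d2 i) := by
    intro x
    rw [Finset.sum_mul_sum, ← Finset.sum_product']
    refine Finset.sum_congr rfl fun i hi => ?_
    rw [hm x i hi]; ring
  have eK : ∀ x, ∑ i ∈ I1 ×ˢ I2, (k1 i.1 * l2 i.2 + l1 i.1 * k2 i.2) * mon x (d1 i.1 ∪ d2 i.2) =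
      (∑ i ∈ I1, k1 i * mon x (d1 i)) * (∑ i ∈ I2, l2 i * mon x (d2 i)) +
      (∑ i ∈ I1, l1 i * mon x (d1 i)) * ∑ i ∈ I2, k2 i * mon x (d2 i) := by
    intro x
    rw [Finset.sum_mul_sum, ← Finset.sum_product', Finset.sum_mul_sum, ← Finset.sum_product',
      ← Finset.sum_add_distrib]
    refine Finset.sum_congr rfl fun i hi => ?_
    rw [hm x i hi]; ring
  obtain ⟨i0, i1⟩ := inv01
  have v1 := vv_nonneg _ i1 S1
  have v2 := vv_nonneg _ i1 S2
  have T1 := v1.trans (h1.lower _ i0 i1)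
  have T2 := v2.trans (h2.lower _ i0 i1)
  have K1 : 0 ≤ ∑ i ∈ I1, k1 i * mon (fun p => (1 / p : ℝ)) (d1 i) := by
    linarith [h1.lower _ i0 i1, h1.upper _ i0 i1]
  have K2 : 0 ≤ ∑ i ∈ I2, k2 i * mon (fun p => (1 / p : ℝ)) (d2 i) := by
    linarith [h2.lower _ i0 i1, h2.upper _ i0 i1]
  have a1 := h1.d0
  have a2 := h2.d0
  refine ⟨?_, ?_, ?_, ?_, ?_, ?_, ?_, by positivity⟩
  · intro i hi
    rw [Finset.mem_product] at hi
    exact Finset.union_subset_union (h1.sub _ hi.1) (h2.sub _ hi.2)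
  · intro i hi
    rw [Finset.prod_union (hdd i hi)]
    rw [Finset.mem_product] at hi
    exact Nat.mul_le_mul (h1.le _ hi.1) (h2.le _ hi.2)
  · push_cast
    refine le_trans ?_ (mul_le_mul h1.sum h2.sum (Finset.sum_nonneg fun i _ => by positivity) (by positivity))
    rw [Finset.sum_mul_sum, ← Finset.sum_product']
    refine Finset.sum_le_sum fun i hi => ?_
    have := abs_add_le (k1 i.1 * l2 i.2) (l1 i.1 * k2 i.2)
    rw [abs_mul, abs_mul] at this
    rw [abs_mul]
    have : 0 ≤ |k1 i.1| * |k2 i.2| := by positivity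
    linarith
  · intro x x0 x1
    rw [hv, eT]
    exact mul_le_mul (h1.lower x x0 x1) (h2.lower x x0 x1) (vv_nonneg x x1 _)
      ((vv_nonneg x x1 _).trans (h1.lower x x0 x1))
  · intro x x0 x1
    rw [hv, eT, eK]
    have a := h1.lower x x0 x1
    have b := h2.lower x x0 x1
    have c := h1.upper x x0 x1
    have e := h2.upper x x0 x1
    have w1 := vv_nonneg x x1 S1
    have w2 := vv_nonneg x x1 S2
    generalize ∑ i ∈ I1, l1 i * mon x (d1 i) = A at *
    generalize ∑ i ∈ I2, l2 i * mon x (d2 i) = B at *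
    generalize ∑ i ∈ I1, k1 i * mon x (d1 i) = K at *
    generalize ∑ i ∈ I2, k2 i * mon x (d2 i) = L at *
    have p1 : (A - vv x S1) * B ≤ K * B := mul_le_mul_of_nonneg_right (by linarith) (by linarith)
    have p2 : vv x S1 * (B - vv x S2) ≤ A * L := mul_le_mul a (by linarith) (by linarith) (by linarith)
    linarith
  · rw [hv, eT]
    refine (mul_le_mul h1.tt h2.tt T2 (by positivity)).trans ?_
    have : 0 ≤ vv (fun p => (1 / p : ℝ)) S1 * vv (fun p => (1 / p : ℝ)) S2 * (δ1 * δ2) := by positivity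
    linarith
  · rw [hv, eK]
    have p1 := mul_le_mul h1.kk h2.tt T2 (by positivity)
    have p2 := mul_le_mul h1.tt h2.kk K2 (by positivity)
    linarith

theorem SD.block {S : Finset ℕ} (hS : ∀ p ∈ S, p.Prime) {M : ℕ} (hM1 : 1 ≤ M) (hM : ∀ p ∈ S, p ≤ M) (b : ℕ)
    (hs : ∑ p ∈ S, (1 / p : ℝ) ≤ 4) :
    SD S (M ^ (2 * b + 1)) (Real.exp 8 * (4 ^ (2 * b + 1) / (2 * b + 1).factorial))
      (S.powerset.filter fun t => t.card ≤ 2 * b + 1) id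
      (fun t => if t.card < 2 * b + 1 then (-1) ^ t.card else 0)
      (fun t => if t.card = 2 * b + 1 then 1 else 0) := by
  have hle : ∀ t ∈ S.powerset.filter fun t => t.card ≤ 2 * b + 1, ∏ p ∈ t, p ≤ M ^ (2 * b + 1) := by
    intro t ht
    rw [Finset.mem_filter, Finset.mem_powerset] at ht
    refine (Finset.prod_le_pow_card t _ M fun p hp => hM p (ht.1 hp)).trans ?_
    exact Nat.pow_le_pow_right hM1 ht.2
  have eT : ∀ x, ∑ t ∈ S.powerset.filter fun t => t.card ≤ 2 * b + 1,
      (if t.card < 2 * b + 1 then (-1) ^ t.card else 0) * mon x t = sg x (2 * b + 1) S := by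
    intro x
    unfold sg
    rw [Finset.sum_filter]
    refine Finset.sum_congr rfl fun t _ => ?_
    split_ifs <;> first | rfl | omega | simp
  have eK : ∀ x, ∑ t ∈ S.powerset.filter fun t => t.card ≤ 2 * b + 1,
      (if t.card = 2 * b + 1 then 1 else 0) * mon x t = es x (2 * b + 1) S := by
    intro x
    unfold es
    rw [Finset.sum_filter]
    refine Finset.sum_congr rfl fun t _ => ?_
    split_ifs <;> first | rfl | omega | simp
  obtain ⟨i0, i1⟩ := inv01
  have hodd : (-1 : ℝ) ^ (2 * b + 1) = -1 := by rw [pow_succ, pow_mul]; simp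
  have hes : es (fun p => (1 / p : ℝ)) (2 * b + 1) S ≤ 4 ^ (2 * b + 1) / (2 * b + 1).factorial := by
    refine (es_le _ i0 S _).trans ?_
    have : 0 ≤ ∑ p ∈ S, (1 / p : ℝ) := Finset.sum_nonneg fun p _ => i0 p
    gcongr
  have hV : Real.exp (-8) ≤ vv (fun p => (1 / p : ℝ)) S := by
    have : Real.exp (-8) ≤ ∏ p ∈ S, Real.exp (-2 * (1 / p : ℝ)) := by
      rw [← Real.exp_sum, ← Finset.mul_sum]
      apply Real.exp_le_exp.2; linarith
    refine this.trans (Finset.prod_le_prod (fun p _ => (Real.exp_pos _).le) fun p hp => ?_)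
    have h2 : (2 : ℝ) ≤ p := by exact_mod_cast (hS p hp).two_le
    set y : ℝ := 1 / p with hy
    have y0 : 0 ≤ y := i0 p
    have y1 : y ≤ 1 / 2 := by rw [hy]; gcongr
    have := Real.add_one_le_exp (2 * y)
    rw [show -2 * y = -(2 * y) by ring, Real.exp_neg, inv_le_comm₀ (Real.exp_pos _) (by linarith)]
    refine le_trans ?_ this
    rw [inv_le_iff_one_le_mul₀ (by linarith)]
    nlinarith
  have hkk : es (fun p => (1 / p : ℝ)) (2 * b + 1) S ≤ vv (fun p => (1 / p : ℝ)) S *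
      (Real.exp 8 * (4 ^ (2 * b + 1) / (2 * b + 1).factorial)) := by
    refine hes.trans ?_
    have : 1 ≤ vv (fun p => (1 / p : ℝ)) S * Real.exp 8 := by
      calc 1 = Real.exp (-8) * Real.exp 8 := by rw [← Real.exp_add]; simp
        _ ≤ _ := by gcongr
    rw [← mul_assoc]
    exact le_mul_of_one_le_left (by positivity) this
  have up : ∀ x : ℕ → ℝ, (∀ p, 0 ≤ x p) → (∀ p, x p ≤ 1) → vv x S ≤ sg x (2 * b + 1) S ∧
      sg x (2 * b + 1) S ≤ vv x S + es x (2 * b + 1) S := by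
    intro x x0 x1
    have := brun x x0 x1 S (2 * b + 1)
    rw [hodd] at this
    constructor <;> linarith [this.1, this.2]
  refine ⟨?_, hle, ?_, ?_, ?_, ?_, ?_, by positivity⟩
  · intro t ht
    exact Finset.mem_powerset.1 (Finset.mem_filter.1 ht).1
  · have : ∑ t ∈ S.powerset.filter fun t => t.card ≤ 2 * b + 1, (|(if t.card < 2 * b + 1 then (-1 : ℝ) ^ t.card else 0)|
      + |(if t.card = 2 * b + 1 then (1 : ℝ) else 0)|) ≤ ∑ t ∈ S.powerset.filter fun t => t.card ≤ 2 * b + 1, (1:ℝ) := by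
      refine Finset.sum_le_sum fun t _ => ?_
      split_ifs <;> first | omega | simp
    refine this.trans ?_
    rw [Finset.sum_const, nsmul_eq_mul, mul_one]
    norm_cast
    have hc : (S.powerset.filter fun t => t.card ≤ 2 * b + 1).card ≤ (Finset.Icc 1 (M ^ (2 * b + 1))).card := by
      refine Finset.card_le_card_of_injOn (fun t => ∏ p ∈ t, p) ?_ ?_
      · intro t ht
        have ht' := hle t ht
        simp only [Finset.coe_Icc, Set.mem_Icc]
        refine ⟨Finset.one_le_prod' fun p hp => ?_, ht'⟩
        have ht2 := Finset.mem_powerset.1 (Finset.mem_filter.1 ht).1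
        exact (hS p (ht2 hp)).one_le
      · intro t ht t' ht' he
        have a := Finset.mem_powerset.1 (Finset.mem_filter.1 (Finset.mem_coe.1 ht)).1
        have a' := Finset.mem_powerset.1 (Finset.mem_filter.1 (Finset.mem_coe.1 ht')).1
        beta_reduce at he
        rw [← Nat.primeFactors_prod fun p hp => hS p (a hp), he, Nat.primeFactors_prod fun p hp => hS p (a' hp)]
    simpa using hc
  · intro x x0 x1
    simp only [id]
    rw [eT]; exact (up x x0 x1).1
  · intro x x0 x1
    simp only [id]
    rw [eT, eK]; exact (up x x0 x1).2
  · simp only [id]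
    rw [eT]
    linarith [(up _ i0 i1).2]
  · simp only [id]
    rw [eK]; exact hkk

end DPM
namespace DPM
open Finset

theorem cheb (i : ℕ) (hi : 1 ≤ i) :
    (((Ico (2 ^ i) (2 ^ (i + 1))).filter Nat.Prime).card : ℝ) ≤ 4 * 2 ^ i / i := by
  have h := Chebyshev.theta_le_log4_mul_x (x := ((2 ^ (i + 1) : ℕ) : ℝ)) (by positivity)
  rw [Chebyshev.theta_eq_sum_Icc, Nat.floor_natCast] at h
  have h1 : ∑ p ∈ (Ico (2 ^ i) (2 ^ (i + 1))).filter Nat.Prime, (i * Real.log 2) ≤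
      ∑ p ∈ (Icc 0 (2 ^ (i + 1))).filter Nat.Prime, Real.log ((p : ℕ) : ℝ) := by
    refine (Finset.sum_le_sum fun p hp => ?_).trans (Finset.sum_le_sum_of_subset_of_nonneg ?_ ?_)
    · rw [Finset.mem_filter, Finset.mem_Ico] at hp
      rw [← Real.log_pow]
      apply Real.log_le_log (by positivity)
      exact_mod_cast hp.1.1
    · intro p hp
      rw [Finset.mem_filter, Finset.mem_Ico] at hp
      rw [Finset.mem_filter, Finset.mem_Icc]
      exact ⟨⟨by omega, by omega⟩, hp.2⟩
    · intro p _ _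
      exact Real.log_natCast_nonneg p
  rw [Finset.sum_const, nsmul_eq_mul] at h1
  have hl2 := Real.log_pos (show (1:ℝ) < 2 by norm_num)
  have h4 : Real.log 4 = 2 * Real.log 2 := by
    rw [show (4:ℝ) = 2 ^ 2 by norm_num, Real.log_pow]; norm_num
  rw [h4] at h
  have hi' : (0:ℝ) < i := by exact_mod_cast hi
  rw [le_div_iff₀ hi']
  have := h1.trans h
  have e3 : ((2 ^ (i + 1) : ℕ) : ℝ) = 2 ^ i * 2 := by push_cast; ring
  rw [e3] at this
  have h5 : (((Ico (2 ^ i) (2 ^ (i + 1))).filter Nat.Prime).card : ℝ) * i * Real.log 2 ≤ 4 * 2 ^ i * Real.log 2 := by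
    linarith
  exact le_of_mul_le_mul_right h5 hl2

theorem cheb_inv (m : ℕ) (hm : 1 ≤ m) (n : ℕ) :
    ∑ p ∈ (Ico (2 ^ m) (2 ^ (m + n))).filter Nat.Prime, (1 / p : ℝ) ≤ n * (4 / m) := by
  induction n with
  | zero => simp
  | succ n ih =>
    have hu : Ico (2 ^ m) (2 ^ (m + (n + 1))) = Ico (2 ^ m) (2 ^ (m + n)) ∪ Ico (2 ^ (m + n)) (2 ^ (m + n + 1)) :=
      (Finset.Ico_union_Ico_eq_Ico (Nat.pow_le_pow_right (by norm_num) (by omega))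
        (Nat.pow_le_pow_right (by norm_num) (by omega))).symm
    rw [hu, Finset.filter_union]
    rw [Finset.sum_union (Finset.disjoint_filter_filter (Finset.Ico_disjoint_Ico_consecutive _ _ _))]
    have h2 : ∑ p ∈ (Ico (2 ^ (m + n)) (2 ^ (m + n + 1))).filter Nat.Prime, (1 / p : ℝ) ≤ 4 / m := by
      calc _ ≤ ∑ p ∈ (Ico (2 ^ (m + n)) (2 ^ (m + n + 1))).filter Nat.Prime, (1 / 2 ^ (m + n) : ℝ) := by
            refine Finset.sum_le_sum fun p hp => ?_
            rw [Finset.mem_filter, Finset.mem_Ico] at hp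
            apply one_div_le_one_div_of_le (by positivity)
            exact_mod_cast hp.1.1
        _ = (((Ico (2 ^ (m + n)) (2 ^ (m + n + 1))).filter Nat.Prime).card : ℝ) * (1 / 2 ^ (m + n)) := by
            rw [Finset.sum_const, nsmul_eq_mul]
        _ ≤ (4 * 2 ^ (m + n) / (m + n : ℕ)) * (1 / 2 ^ (m + n)) := by
            gcongr; exact cheb (m + n) (by omega)
        _ = 4 / (m + n : ℕ) := by field_simp
        _ ≤ 4 / m := by
            have : (0:ℝ) < m := by exact_mod_cast hm
            gcongr; omega
    push_cast
    linarith

noncomputable def ps (J q : ℕ) : Finset ℕ := (range (2 ^ 2 ^ J)).filter fun p => p.Prime ∧ ¬ p ∣ q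

noncomputable def GG : ℝ := 2 * Real.exp 16

theorem sieve_exists (q J : ℕ) : ∀ b : ℕ, ∃ (δ : ℝ) (ι : Type) (I : Finset ι) (d : ι → Finset ℕ) (l k : ι → ℝ),
    SD (ps J q) (2 ^ (2 ^ J * (4 * b + 6))) δ I d l k ∧ 1 + 2 * δ ≤ Real.exp (GG / 2 ^ b) := by
  induction J with
  | zero =>
    intro b
    refine ⟨0, Unit, {()}, fun _ => ∅, fun _ => 1, fun _ => 0, ?_, ?_⟩
    · have : ps 0 q = ∅ := by
        unfold ps
        ext p
        simp only [Finset.mem_filter, Finset.mem_range, Finset.notMem_empty, iff_false, not_and]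
        intro h1 h2
        have := h2.two_le
        norm_num at h1; omega
      rw [this]
      have h1 : (1:ℕ) ≤ 2 ^ (2 ^ 0 * (4 * b + 6)) := Nat.one_le_two_pow
      have h1' : (1:ℝ) ≤ (2 ^ (2 ^ 0 * (4 * b + 6)) : ℕ) := by exact_mod_cast h1
      refine ⟨by simp, by simpa using h1, by simpa using h1', ?_, ?_, ?_, ?_, le_rfl⟩ <;> simp [vv, mon]
    · simp [GG]; positivity
  | succ J ih =>
    intro b
    obtain ⟨δ1, ι1, I1, d1, l1, k1, h1, e1⟩ := ih (b + 1)
    set B := ((Ico (2 ^ 2 ^ J) (2 ^ 2 ^ (J + 1))).filter Nat.Prime).filter fun p => ¬ p ∣ q with hB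
    have hp : ∀ p ∈ B, p.Prime := fun p hp => (Finset.mem_filter.1 (Finset.mem_filter.1 hp).1).2
    have hle : ∀ p ∈ B, p ≤ 2 ^ 2 ^ (J + 1) := fun p hp =>
      (Finset.mem_Ico.1 (Finset.mem_filter.1 (Finset.mem_filter.1 hp).1).1).2.le
    have hsum : ∑ p ∈ B, (1 / p : ℝ) ≤ 4 := by
      have := cheb_inv (2 ^ J) Nat.one_le_two_pow (2 ^ J)
      rw [← two_mul, mul_comm 2, ← pow_succ] at this
      refine (Finset.sum_le_sum_of_subset_of_nonneg (Finset.filter_subset _ _) fun p _ _ => by positivity).trans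
        (this.trans (le_of_eq ?_))
      push_cast; field_simp
    have h2 := SD.block hp Nat.one_le_two_pow hle b hsum
    have hps : ps (J + 1) q = ps J q ∪ B := by
      have hlt : 2 ^ 2 ^ J ≤ 2 ^ 2 ^ (J + 1) := Nat.pow_le_pow_right (by norm_num)
        (Nat.pow_le_pow_right (by norm_num) (by omega))
      ext p
      simp only [ps, hB, Finset.mem_filter, Finset.mem_range, Finset.mem_union, Finset.mem_Ico]
      generalize p.Prime = X
      by_cases h : p < 2 ^ 2 ^ J
      · have := h.trans_le hlt
        tauto
      · have := not_lt.1 h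
        tauto
    have hdis : Disjoint (ps J q) B := by
      rw [Finset.disjoint_left]
      intro p h3 h4
      simp only [ps, hB, Finset.mem_filter, Finset.mem_range, Finset.mem_Ico] at h3 h4
      omega
    have h3 := h1.combine hdis h2
    have hD : 2 ^ (2 ^ J * (4 * (b + 1) + 6)) * (2 ^ 2 ^ (J + 1)) ^ (2 * b + 1) = 2 ^ (2 ^ (J + 1) * (4 * b + 6)) := by
      rw [← pow_mul, ← pow_add]
      congr 1
      rw [pow_succ]; ring
    rw [hD, ← hps] at h3
    refine ⟨_, _, _, _, _, _, h3, ?_⟩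
    · set δ2 := Real.exp 8 * (4 ^ (2 * b + 1) / (2 * b + 1).factorial : ℝ) with hδ2
      have a1 := h1.d0
      have a2 : 0 ≤ δ2 := by positivity
      have c2 : 1 + 2 * δ2 ≤ Real.exp (GG / 2 ^ (b + 1)) := by
        have := Real.add_one_le_exp (GG / 2 ^ (b + 1))
        refine le_trans ?_ this
        have h8 := Real.pow_div_factorial_le_exp (8:ℝ) (by norm_num) (2 * b + 1)
        have : (4:ℝ) ^ (2 * b + 1) / (2 * b + 1).factorial ≤ Real.exp 8 / 2 ^ (b + 1) := by
          rw [show (8:ℝ) = 4 * 2 by norm_num, mul_pow, mul_div_right_comm] at h8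
          rw [le_div_iff₀ (by positivity)]
          norm_num at h8 ⊢
          refine le_trans ?_ h8
          gcongr
          · norm_num
          · omega
        have e16 : Real.exp 16 = Real.exp 8 * Real.exp 8 := by rw [← Real.exp_add]; norm_num
        have : δ2 ≤ Real.exp 8 * (Real.exp 8 / 2 ^ (b + 1)) := by rw [hδ2]; gcongr
        rw [GG, e16]
        have e : 2 * (Real.exp 8 * Real.exp 8) / 2 ^ (b + 1) = 2 * (Real.exp 8 * (Real.exp 8 / 2 ^ (b + 1))) := by ring
        linarith
      have : 1 + 2 * (δ1 + δ2 + 2 * δ1 * δ2) = (1 + 2 * δ1) * (1 + 2 * δ2) := by ring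
      rw [this]
      refine (mul_le_mul e1 c2 (by positivity) (by positivity)).trans (le_of_eq ?_)
      rw [← Real.exp_add]; congr 1
      rw [pow_succ]; field_simp; norm_num

theorem prod_ge (t : Finset ℕ) (ht : ∀ p ∈ t, 2 ≤ p) : 1 / ((t.card : ℝ) + 1) ≤ ∏ p ∈ t, (1 - 1 / (p : ℝ)) := by
  induction t using Finset.induction_on_max with
  | empty => simp
  | insert m t hm ih =>
    have hmt : m ∉ t := fun h => lt_irrefl _ (hm m h)
    rw [Finset.prod_insert hmt, Finset.card_insert_of_notMem hmt]
    have ih' := ih fun p hp => ht p (Finset.mem_insert_of_mem hp)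
    have hm2 := ht m (Finset.mem_insert_self _ _)
    have hc : t.card + 2 ≤ m := by
      have : t ⊆ Ico 2 m := fun p hp => Finset.mem_Ico.2 ⟨ht p (Finset.mem_insert_of_mem hp), hm p hp⟩
      have := Finset.card_le_card this
      rw [Nat.card_Ico] at this; omega
    have hc' : (t.card : ℝ) + 2 ≤ m := by exact_mod_cast hc
    have h1 : 1 / (m : ℝ) ≤ 1 / ((t.card : ℝ) + 2) := one_div_le_one_div_of_le (by positivity) hc'
    calc 1 / (((t.card + 1 : ℕ) : ℝ) + 1) = (1 - 1 / ((t.card : ℝ) + 2)) * (1 / ((t.card : ℝ) + 1)) := by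
          push_cast; field_simp; ring
      _ ≤ _ := by
          have : 1 / ((t.card : ℝ) + 2) ≤ 1 := by rw [div_le_one (by positivity)]; linarith [(Nat.cast_nonneg t.card : (0:ℝ) ≤ t.card)]
          gcongr
          linarith

theorem mertens (w : ℕ) (hw : 1 ≤ w) : (∏ p ∈ w.primesBelow, (1 - 1 / (p : ℝ))) * Real.log w ≤ 1 := by
  let f : ℕ →* ℝ := { toFun := fun n => 1 / (n : ℝ), map_one' := by simp, map_mul' := fun x y => by push_cast; field_simp }
  have hf : ∀ n : ℕ, f n = 1 / (n : ℝ) := fun n => rfl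
  have h := (EulerProduct.summable_and_hasSum_smoothNumbers_prod_primesBelow_geometric (f := f) (by
    intro p hp
    have : (1:ℝ) < p := by exact_mod_cast hp.one_lt
    rw [hf, Real.norm_of_nonneg (by positivity), div_lt_one (by linarith)]; exact this) w).2
  have hlog : Real.log w ≤ ∏ p ∈ w.primesBelow, (1 - f p)⁻¹ := by
    have h1 := log_add_one_le_harmonic (w - 1)
    rw [show w - 1 + 1 = w by omega] at h1
    refine h1.trans ?_
    rw [harmonic_eq_sum_Icc]
    have h2 := sum_le_hasSum ((Icc 1 (w - 1)).attach.image fun n => (⟨n.1, by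
      have := Finset.mem_Icc.1 n.2
      exact Nat.mem_smoothNumbers_of_lt (by omega) (by omega)⟩ : w.smoothNumbers)) (fun n _ => by
        rw [hf]; positivity) h
    refine le_trans (le_of_eq ?_) h2
    rw [Finset.sum_image (by
      intro x _ y _ hxy
      exact Subtype.ext (congrArg (fun z : w.smoothNumbers => (z : ℕ)) hxy))]
    push_cast
    rw [← Finset.sum_attach]
    refine Finset.sum_congr rfl fun n _ => ?_
    rw [hf, one_div]
  have hpos : ∀ p ∈ w.primesBelow, 0 < 1 - 1 / (p : ℝ) := by
    intro p hp
    have : (1:ℝ) < p := by exact_mod_cast (Nat.prime_of_mem_primesBelow hp).one_lt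
    rw [sub_pos, div_lt_one (by linarith)]; exact this
  have hP := Finset.prod_pos hpos
  calc _ ≤ (∏ p ∈ w.primesBelow, (1 - 1 / (p : ℝ))) * ∏ p ∈ w.primesBelow, (1 - f p)⁻¹ := by gcongr
    _ = 1 := by
      rw [← Finset.prod_mul_distrib]
      refine Finset.prod_eq_one fun p hp => ?_
      rw [hf]; exact mul_inv_cancel₀ (hpos p hp).ne'

theorem vv_le (J q : ℕ) (hq : 0 < q) :
    vv (fun p => (1 / p : ℝ)) (ps J q) ≤ 2 * (Nat.log 2 q + 1) / 2 ^ J := by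
  have h1 := mertens (2 ^ 2 ^ J) Nat.one_le_two_pow
  have e : ∏ p ∈ (2 ^ 2 ^ J).primesBelow, (1 - 1 / ((p : ℕ) : ℝ)) = vv (fun p => (1 / p : ℝ)) (ps J q) *
      ∏ p ∈ (2 ^ 2 ^ J).primesBelow.filter (· ∣ q), (1 - 1 / ((p : ℕ) : ℝ)) := by
    unfold vv ps Nat.primesBelow
    rw [← Finset.prod_filter_mul_prod_filter_not _ (fun p => ¬ p ∣ q)]
    simp only [not_not, Finset.filter_filter]
  set t := (2 ^ 2 ^ J).primesBelow.filter (· ∣ q) with ht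
  have h2 := prod_ge t (fun p hp => (Nat.prime_of_mem_primesBelow (Finset.mem_filter.1 hp).1).two_le)
  have hc : t.card ≤ Nat.log 2 q := by
    apply Nat.le_log_of_pow_le (by norm_num)
    have : t ⊆ q.primeFactors := by
      intro p hp
      have := Finset.mem_filter.1 hp
      exact Nat.mem_primeFactors.2 ⟨Nat.prime_of_mem_primesBelow this.1, this.2, hq.ne'⟩
    refine le_trans ?_ (Nat.le_of_dvd hq (Nat.prod_primeFactors_dvd q))
    refine (Nat.pow_le_pow_right (by norm_num) (Finset.card_le_card this)).trans ?_
    exact Finset.pow_card_le_prod _ _ _ fun p hp => (Nat.prime_of_mem_primeFactors hp).two_le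
  have hc' : (t.card : ℝ) ≤ Nat.log 2 q := by exact_mod_cast hc
  rw [e] at h1
  have v0 := vv_nonneg _ inv01.2 (ps J q)
  set v := vv (fun p => (1 / p : ℝ)) (ps J q) with hv
  have hl : Real.log ((2 ^ 2 ^ J : ℕ) : ℝ) = 2 ^ J * Real.log 2 := by
    push_cast; rw [Real.log_pow]; norm_num
  rw [hl] at h1
  have hlog := Real.log_two_gt_d9
  have h3 : v * (1 / ((Nat.log 2 q : ℝ) + 1)) * (2 ^ J * (1 / 2)) ≤ 1 := by
    refine le_trans ?_ h1
    have : 1 / ((Nat.log 2 q : ℝ) + 1) ≤ ∏ p ∈ t, (1 - 1 / (p : ℝ)) := by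
      refine le_trans ?_ h2
      gcongr
    have h0 : 0 ≤ ∏ p ∈ t, (1 - 1 / (p : ℝ)) := le_trans (by positivity) this
    gcongr
    linarith
  rw [le_div_iff₀ (by positivity)]
  have : v * (1 / ((Nat.log 2 q : ℝ) + 1)) * (2 ^ J * (1 / 2)) = v * 2 ^ J / (2 * ((Nat.log 2 q : ℝ) + 1)) := by
    field_simp
  rw [this, div_le_one (by positivity)] at h3
  exact h3

end DPM
namespace DPM
open Finset

noncomputable def dp (t : Finset ℕ) : ℕ := ∏ p ∈ t, p
noncomputable def xn (n : ℕ) : ℕ → ℝ := fun p => if p ∣ n then 1 else 0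
noncomputable def TT {ι : Type} (I : Finset ι) (d : ι → Finset ℕ) (l : ι → ℝ) (n : ℕ) : ℝ :=
  ∑ i ∈ I, l i * (if dp (d i) ∣ n then 1 else 0)

theorem xn01 (n : ℕ) : (∀ p, 0 ≤ xn n p) ∧ ∀ p, xn n p ≤ 1 := by
  constructor <;> intro p <;> unfold xn <;> split_ifs <;> norm_num

theorem mon_xn (t : Finset ℕ) (ht : ∀ p ∈ t, p.Prime) (n : ℕ) :
    mon (xn n) t = if dp t ∣ n then 1 else 0 := by
  unfold mon dp
  split_ifs with h
  · refine Finset.prod_eq_one fun p hp => ?_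
    unfold xn
    rw [if_pos ((Finset.dvd_prod_of_mem _ hp).trans h)]
  · by_contra h2
    apply h
    refine Finset.prod_primes_dvd n (fun p hp => (ht p hp).prime) fun p hp => ?_
    by_contra h3
    exact h2 (Finset.prod_eq_zero hp (by simp [xn, h3]))

theorem mon_inv (t : Finset ℕ) : mon (fun p => (1 / p : ℝ)) t = 1 / (dp t : ℝ) := by
  unfold mon dp
  rw [Nat.cast_prod, Finset.prod_div_distrib, Finset.prod_const_one]

theorem ps_prime {J q p : ℕ} (h : p ∈ ps J q) : p.Prime := (Finset.mem_filter.1 h).2.1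

theorem dp_cop {J q : ℕ} {t : Finset ℕ} (h : t ⊆ ps J q) : Nat.Coprime (dp t) q := by
  refine Nat.Coprime.prod_left fun p hp => ?_
  exact (Nat.Prime.coprime_iff_not_dvd (ps_prime (h hp))).2 (Finset.mem_filter.1 (h hp)).2.2

theorem dp_pos {J q : ℕ} {t : Finset ℕ} (h : t ⊆ ps J q) : 0 < dp t :=
  Finset.prod_pos fun p hp => (ps_prime (h hp)).pos

section
variable {J q D : ℕ} {δ : ℝ} {ι : Type} {I : Finset ι} {d : ι → Finset ℕ} {l k : ι → ℝ}

theorem TT_eq (h : SD (ps J q) D δ I d l k) (c : ι → ℝ) (n : ℕ) :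
    TT I d c n = ∑ i ∈ I, c i * mon (xn n) (d i) :=
  Finset.sum_congr rfl fun i hi => by rw [mon_xn _ fun p hp => ps_prime (h.sub i hi hp)]

theorem TT_nonneg (h : SD (ps J q) D δ I d l k) (n : ℕ) : 0 ≤ TT I d l n := by
  rw [TT_eq h]
  exact (vv_nonneg _ (xn01 n).2 _).trans (h.lower _ (xn01 n).1 (xn01 n).2)

theorem vv_one {n : ℕ} {S : Finset ℕ} (hn : ∀ p ∈ S, ¬ p ∣ n) : vv (xn n) S = 1 :=
  Finset.prod_eq_one fun p hp => by simp [xn, hn p hp]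

theorem TT_one (h : SD (ps J q) D δ I d l k) {n : ℕ} (hn : ∀ p ∈ ps J q, ¬ p ∣ n) : 1 ≤ TT I d l n := by
  rw [TT_eq h]
  have := h.lower _ (xn01 n).1 (xn01 n).2
  rwa [vv_one hn] at this

theorem TT_err (h : SD (ps J q) D δ I d l k) (n : ℕ) :
    |TT I d l n - (if ∀ p ∈ ps J q, ¬ p ∣ n then 1 else 0)| ≤ TT I d k n := by
  rw [TT_eq h, TT_eq h]
  have h1 := h.lower _ (xn01 n).1 (xn01 n).2
  have h2 := h.upper _ (xn01 n).1 (xn01 n).2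
  have e : (if ∀ p ∈ ps J q, ¬ p ∣ n then (1:ℝ) else 0) = vv (xn n) (ps J q) := by
    split_ifs with hn
    · rw [vv_one hn]
    · push Not at hn
      obtain ⟨p, hp, hpn⟩ := hn
      exact (Finset.prod_eq_zero hp (by simp [xn, hpn])).symm
  rw [e, abs_of_nonneg (by linarith)]
  linarith

theorem card_modEq_nat (A B v d : ℕ) (hAB : A ≤ B) (hd : 0 < d) :
    |(((Ico A B).filter (fun x => x ≡ v [MOD d])).card : ℝ) - ((B : ℝ) - A) / d| ≤ 1 := by
  have h := card_modEq (A : ℤ) B v d (by exact_mod_cast hAB) (by exact_mod_cast hd)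
  have e : ((Ico A B).filter (fun x => x ≡ v [MOD d])).card =
      ((Ico (A : ℤ) B).filter (fun x => x ≡ v [ZMOD d])).card := by
    refine Finset.card_nbij' (fun x => (x : ℤ)) (fun x => x.toNat) ?_ ?_ ?_ ?_
    · intro x hx
      simp only [Finset.coe_filter, Finset.mem_Ico, Set.mem_ofPred_eq] at hx ⊢
      exact ⟨by omega, Int.natCast_modEq_iff.2 hx.2⟩
    · intro x hx
      simp only [Finset.coe_filter, Finset.mem_Ico, Set.mem_ofPred_eq] at hx ⊢
      refine ⟨by omega, ?_⟩
      rw [← Int.natCast_modEq_iff, Int.toNat_of_nonneg (by omega)]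
      exact hx.2
    · intro x _; simp
    · intro x hx
      simp only [Finset.coe_filter, Finset.mem_Ico, Set.mem_ofPred_eq] at hx
      simp only
      omega
  rw [e]
  simpa only [Int.cast_natCast] using h

theorem TT_count (h : SD (ps J q) D δ I d l k) (c : ι → ℝ) (hc : ∀ i ∈ I, |c i| ≤ |l i| + |k i|) (m v A B : ℕ) (hm : 0 < m)
    (hmq : m ∣ q) (hAB : A ≤ B) :
    ∑ n ∈ Ico A B with n ≡ v [MOD m], TT I d c n ≤
      ((B : ℝ) - A) / m * (∑ i ∈ I, c i * mon (fun p => (1 / p : ℝ)) (d i)) + D := by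
  unfold TT
  rw [Finset.sum_comm]
  have key : ∀ i ∈ I, ∑ n ∈ Ico A B with n ≡ v [MOD m], c i * (if dp (d i) ∣ n then (1:ℝ) else 0) ≤
      ((B : ℝ) - A) / m * (c i * mon (fun p => (1 / p : ℝ)) (d i)) + (|l i| + |k i|) := by
    intro i hi
    have hpos := dp_pos (h.sub i hi)
    have hcop : Nat.Coprime (dp (d i)) m := Nat.Coprime.coprime_dvd_right hmq (dp_cop (h.sub i hi))
    obtain ⟨u, hu1, hu2⟩ := Nat.chineseRemainder hcop 0 v
    have h1 := card_modEq_nat A B u (dp (d i) * m) hAB (by positivity)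
    have e : ((Ico A B).filter (fun n => n ≡ v [MOD m])).filter (fun n => dp (d i) ∣ n) =
        (Ico A B).filter (fun x => x ≡ u [MOD (dp (d i) * m)]) := by
      rw [Finset.filter_filter]
      refine Finset.filter_congr fun n _ => ?_
      rw [← Nat.modEq_and_modEq_iff_modEq_mul hcop]
      constructor
      · rintro ⟨a1, a2⟩
        exact ⟨(Nat.modEq_zero_iff_dvd.2 a2).trans hu1.symm, a1.trans hu2.symm⟩
      · rintro ⟨a1, a2⟩
        exact ⟨a2.trans hu2, Nat.modEq_zero_iff_dvd.1 (a1.trans hu1)⟩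
    rw [← Finset.mul_sum, ← Finset.sum_filter, Finset.sum_const, nsmul_eq_mul, mul_one, e, mon_inv]
    push_cast at h1
    set X := (((Ico A B).filter (fun x => x ≡ u [MOD (dp (d i) * m)])).card : ℝ)
    have e2 : ((B : ℝ) - A) / m * (c i * (1 / (dp (d i) : ℝ))) = c i * (((B : ℝ) - A) / (dp (d i) * m)) := by
      field_simp
    rw [e2]
    have h3 : c i * (X - ((B : ℝ) - A) / (dp (d i) * m)) ≤ |c i| * 1 := by
      refine (le_abs_self _).trans ?_
      rw [abs_mul]; gcongr
    linarith [hc i hi]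
  refine (Finset.sum_le_sum key).trans ?_
  rw [Finset.sum_add_distrib, ← Finset.mul_sum]
  linarith [h.sum]

theorem sum_dvd_reindex (dd : ℕ) (hd : 0 < dd) (A B : ℕ) (f : ℕ → ℂ) :
    ∑ n ∈ Ico A B with dd ∣ n, f n = ∑ m ∈ Ico ((A + dd - 1) / dd) ((B + dd - 1) / dd), f (m * dd) := by
  have key : ∀ C m : ℕ, (C + dd - 1) / dd ≤ m ↔ C ≤ m * dd := by
    intro C m
    rw [Nat.div_le_iff_le_mul_add_pred hd, mul_comm dd m]; omega
  symm
  refine Finset.sum_nbij' (fun m => m * dd) (fun n => n / dd) ?_ ?_ ?_ ?_ ?_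
  · intro m hm
    rw [Finset.mem_Ico, key, ← not_le, key] at hm
    rw [Finset.mem_filter, Finset.mem_Ico]
    exact ⟨⟨hm.1, by omega⟩, Dvd.intro_left m rfl⟩
  · intro n hn
    rw [Finset.mem_filter, Finset.mem_Ico] at hn
    obtain ⟨⟨h1, h2⟩, c, rfl⟩ := hn
    rw [Nat.mul_div_cancel_left _ hd, Finset.mem_Ico, key, ← not_le, key, mul_comm c]
    omega
  · intro m _; exact Nat.mul_div_cancel _ hd
  · intro n hn
    exact Nat.div_mul_cancel (Finset.mem_filter.1 hn).2
  · intro m _; rfl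

theorem TT_exp_eq (c : ι → ℝ) (A B : ℕ) (γ : ℝ) : ∑ n ∈ Ico A B, (TT I d c n : ℂ) * ee (n * γ) =
    ∑ i ∈ I, (c i : ℂ) * ∑ n ∈ Ico A B with dp (d i) ∣ n, ee (n * γ) := by
  unfold TT
  simp only [Finset.mul_sum, Finset.sum_filter]
  rw [Finset.sum_comm]
  refine Finset.sum_congr rfl fun n _ => ?_
  push_cast
  rw [Finset.sum_mul]
  refine Finset.sum_congr rfl fun i _ => ?_
  split_ifs <;> simp

theorem sum_l (h : SD (ps J q) D δ I d l k) : ∑ i ∈ I, |l i| ≤ D :=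
  (Finset.sum_le_sum fun i _ => le_add_of_nonneg_right (abs_nonneg _)).trans h.sum

theorem TT_minor (h : SD (ps J q) D δ I d l k) (hq : 0 < q) (c : ℤ) (hc : ¬ (q : ℤ) ∣ c) (ϑ : ℝ)
    (hϑ : D * |ϑ| ≤ 1 / (2 * q)) (A B : ℕ) :
    ‖∑ n ∈ Ico A B, (TT I d l n : ℂ) * ee (n * (c / q + ϑ))‖ ≤ D * q := by
  have hq' : (0:ℝ) < q := by exact_mod_cast hq
  rw [TT_exp_eq]
  refine (norm_sum_le _ _).trans ?_
  have key : ∀ i ∈ I, ‖(l i : ℂ) * ∑ n ∈ Ico A B with dp (d i) ∣ n, ee (n * (c / q + ϑ))‖ ≤ |l i| * q := by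
    intro i hi
    rw [norm_mul, Complex.norm_real, Real.norm_eq_abs]
    gcongr
    have hpos := dp_pos (h.sub i hi)
    have hle : (dp (d i) : ℝ) ≤ D := by exact_mod_cast h.le i hi
    rw [sum_dvd_reindex _ hpos]
    have e : ∀ m : ℕ, ee (((m * dp (d i) : ℕ) : ℝ) * (c / q + ϑ)) = ee (m * (dp (d i) * (c / q + ϑ))) := by
      intro m; congr 1; push_cast; ring
    simp only [e]
    refine (geom_bound _ (1 / (2 * q)) (by positivity) ?_ _ _).trans (le_of_eq (by field_simp))
    intro m
    have hne : (dp (d i) : ℤ) * c - m * q ≠ 0 := by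
      intro h0
      apply hc
      have h1 : (q : ℤ) ∣ (dp (d i) : ℤ) * c := ⟨m, by linarith⟩
      exact (IsCoprime.dvd_of_dvd_mul_left (Nat.isCoprime_iff_coprime.2 (dp_cop (h.sub i hi)).symm) h1)
    have h1 : (1:ℝ) ≤ |((dp (d i) : ℤ) * c - m * q : ℤ)| := by
      exact_mod_cast Int.one_le_abs hne
    have e1 : (dp (d i) : ℝ) * (c / q + ϑ) - m = (((dp (d i) : ℤ) * c - m * q : ℤ) : ℝ) / q + dp (d i) * ϑ := by
      push_cast; field_simp; ring
    rw [e1]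
    have h2 : 1 / (q:ℝ) ≤ |(((dp (d i) : ℤ) * c - m * q : ℤ) : ℝ) / q| := by
      rw [abs_div, abs_of_pos hq']
      gcongr; exact_mod_cast h1
    have h3 : |(dp (d i) : ℝ) * ϑ| ≤ 1 / (2 * q) := by
      rw [abs_mul, abs_of_nonneg (by positivity)]
      refine le_trans ?_ hϑ
      gcongr
    have h4 := abs_sub_abs_le_abs_add ((((dp (d i) : ℤ) * c - m * q : ℤ) : ℝ) / q) (dp (d i) * ϑ)
    have h5 : 1 / (q : ℝ) = 1 / (2 * q) + 1 / (2 * q) := by field_simp; norm_num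
    linarith
  refine (Finset.sum_le_sum key).trans ?_
  rw [← Finset.sum_mul]
  gcongr
  exact sum_l h

theorem TT_major (h : SD (ps J q) D δ I d l k) (ϑ : ℝ) (A B : ℕ) (hAB : A ≤ B) :
    ‖∑ n ∈ Ico A B, (TT I d l n : ℂ) * ee (n * ϑ)‖ ≤
      (∑ i ∈ I, l i * mon (fun p => (1 / p : ℝ)) (d i)) * ‖∑ n ∈ Ico A B, ee (n * ϑ)‖
      + D * (1 + 2 * Real.pi * |ϑ| * (B - A)) := by
  rw [TT_exp_eq]
  have hBA : (0:ℝ) ≤ (B:ℝ) - A := by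
    have : (A:ℝ) ≤ B := by exact_mod_cast hAB
    linarith
  set E := ∑ n ∈ Ico A B, ee (n * ϑ) with hE
  have e : ∑ i ∈ I, (l i : ℂ) * ∑ n ∈ Ico A B with dp (d i) ∣ n, ee (n * ϑ) =
     ((∑ i ∈ I, l i * mon (fun p => (1 / p : ℝ)) (d i) : ℝ) : ℂ) * E +
     ∑ i ∈ I, (l i : ℂ) * (∑ n ∈ Ico A B with dp (d i) ∣ n, ee (n * ϑ) - ((1 / (dp (d i)) : ℝ) : ℂ) * E) := by
    push_cast
    rw [Finset.sum_mul, ← Finset.sum_add_distrib]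
    refine Finset.sum_congr rfl fun i _ => ?_
    rw [mon_inv]; push_cast; ring
  rw [e]
  obtain ⟨i0, i1⟩ := inv01
  have hT0 := (vv_nonneg _ i1 _).trans (h.lower _ i0 i1)
  refine (norm_add_le _ _).trans (add_le_add ?_ ?_)
  · rw [norm_mul, Complex.norm_real, Real.norm_of_nonneg hT0]
  · refine (norm_sum_le _ _).trans ?_
    refine (Finset.sum_le_sum (g := fun i => |l i| * (1 + 2 * Real.pi * |ϑ| * (B - A))) fun i hi => ?_).trans ?_
    · rw [norm_mul, Complex.norm_real, Real.norm_eq_abs]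
      gcongr
      have := dvd_sum (dp (d i)) (dp_pos (h.sub i hi)) ϑ A B hAB
      exact this
    · rw [← Finset.sum_mul]
      gcongr
      exact sum_l h

end
end DPM
namespace DPM
open Finset

theorem mn_tau (X ϑ : ℝ) (hX : 0 ≤ X) (h : |ϑ| ≤ 1 / 2) : mn X ϑ ≤ 2 * X / (1 + X * |ϑ|) := by
  have hnd : nd ϑ = |ϑ| := by
    unfold nd
    apply le_antisymm
    · have := nd_le ϑ 0
      simpa [nd] using this
    · rcases eq_or_ne (round ϑ) 0 with h0 | h0
      · rw [h0]; simp
      · have : (1:ℝ) ≤ |((round ϑ : ℤ) : ℝ)| := by exact_mod_cast Int.one_le_abs h0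
        have h2 := abs_sub_abs_le_abs_sub ((round ϑ : ℤ) : ℝ) ϑ
        rw [abs_sub_comm] at h2
        linarith
  have h1 := mn_le X ϑ
  have h2 := mn_nd X ϑ
  have h0 := mn_nonneg X ϑ hX
  rw [hnd] at h2
  have h3 := abs_nonneg ϑ
  rw [le_div_iff₀ (by positivity)]
  nlinarith

theorem mobius_cop (q : ℕ) (hq : 0 < q) (s : Finset ℕ) (F : ℕ → ℂ) :
    ∑ n ∈ s with Nat.Coprime n q, F n =
      ∑ r ∈ q.divisors, ((ArithmeticFunction.moebius r : ℤ) : ℂ) * ∑ n ∈ s with r ∣ n, F n := by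
  simp only [Finset.sum_filter, Finset.mul_sum]
  rw [Finset.sum_comm]
  refine Finset.sum_congr rfl fun n _ => ?_
  have h := congrArg (fun f => f (Nat.gcd n q)) ArithmeticFunction.coe_zeta_mul_moebius
  beta_reduce at h
  rw [ArithmeticFunction.coe_zeta_mul_apply, ArithmeticFunction.one_apply] at h
  have hd : (Nat.gcd n q).divisors = q.divisors.filter (fun r => r ∣ n) := by
    ext r
    simp only [Nat.mem_divisors, Finset.mem_filter, Nat.dvd_gcd_iff]
    have : n.gcd q ≠ 0 := (Nat.gcd_pos_of_pos_right n hq).ne'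
    have := hq.ne'
    tauto
  rw [hd] at h
  have e : ∑ r ∈ q.divisors, ((ArithmeticFunction.moebius r : ℤ) : ℂ) * (if r ∣ n then F n else 0) =
      ((∑ r ∈ q.divisors.filter (fun r => r ∣ n), ArithmeticFunction.moebius r : ℤ) : ℂ) * F n := by
    rw [Finset.sum_filter]
    push_cast
    rw [Finset.sum_mul]
    refine Finset.sum_congr rfl fun r _ => ?_
    split_ifs <;> simp
  rw [e, h]
  unfold Nat.Coprime
  split_ifs <;> simp

section
variable {J q D : ℕ} {δ : ℝ} {ι : Type} {I : Finset ι} {d : ι → Finset ℕ} {l k : ι → ℝ}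

theorem TT_mul (h : SD (ps J q) D δ I d l k) {r : ℕ} (hr : r ∣ q) (m : ℕ) : TT I d l (m * r) = TT I d l m := by
  unfold TT
  refine Finset.sum_congr rfl fun i hi => ?_
  have hc : Nat.Coprime (dp (d i)) r := Nat.Coprime.coprime_dvd_right hr (dp_cop (h.sub i hi))
  simp only [hc.dvd_mul_right]

theorem typeI (h : SD (ps J q) D δ I d l k) (hq : 0 < q) (a : ℤ) (ha : IsCoprime a (q : ℤ)) (θ : ℝ) (N : ℕ)
    (hD : 2 * D * q ^ 2 * (1 + N * |θ|) ≤ N) (hN : 0 < N) (hD1 : 1 ≤ D) :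
    ‖∑ n ∈ Ico 1 (N + 1) with Nat.Coprime n q ∧ (∀ p ∈ ps J q, ¬ p ∣ n), ee (n * (a / q + θ))‖ ≤
      vv (fun p => (1 / p : ℝ)) (ps J q) * N * (2 * (1 + δ) / (q * (1 + N * |θ|)) + δ)
      + D * (q ^ 2 + 8 * (1 + N * |θ|)) := by
  set v := vv (fun p => (1 / p : ℝ)) (ps J q) with hv
  have v0 : 0 ≤ v := vv_nonneg _ inv01.2 _
  set β : ℝ := a / q + θ with hβ
  have hq' : (1:ℝ) ≤ q := by exact_mod_cast hq
  have hN' : (1:ℝ) ≤ N := by exact_mod_cast hN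
  have hD' : (1:ℝ) ≤ D := by exact_mod_cast hD1
  have hθ0 := abs_nonneg θ
  set τ : ℝ := 1 + N * |θ| with hτ
  have hτ1 : 1 ≤ τ := by rw [hτ]; nlinarith
  have hθN : N * |θ| ≤ τ := by linarith
  have hDθ : ∀ r : ℕ, r ≤ q → D * |(r:ℝ) * θ| ≤ 1 / (2 * q) := by
    intro r hr
    have hr' : (r:ℝ) ≤ q := by exact_mod_cast hr
    rw [abs_mul, Nat.abs_cast, le_div_iff₀ (by positivity)]
    have h1 : D * (r * |θ|) * (2 * q) ≤ D * (q * |θ|) * (2 * q) := by gcongr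
    have h2 : D * (q * |θ|) * (2 * q) * N ≤ 1 * N := by
      calc D * (q * |θ|) * (2 * q) * N = 2 * D * q ^ 2 * (N * |θ|) := by ring
        _ ≤ 2 * D * q ^ 2 * τ := by gcongr
        _ ≤ 1 * N := by linarith
    exact h1.trans (le_of_mul_le_mul_right h2 (by linarith))
  -- the weighted sum
  have main : ‖∑ n ∈ Ico 1 (N + 1) with Nat.Coprime n q, (TT I d l n : ℂ) * ee (n * β)‖ ≤
      v * N * (2 * (1 + δ) / (q * τ)) + D * (q ^ 2 + 7 * τ) := by
    rw [mobius_cop q hq]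
    refine (norm_sum_le _ _).trans ?_
    have hterm : ∀ r ∈ q.divisors, ‖((ArithmeticFunction.moebius r : ℤ) : ℂ) *
        ∑ n ∈ Ico 1 (N + 1) with r ∣ n, (TT I d l n : ℂ) * ee (n * β)‖ ≤
        D * q + (if r = q then v * N * (2 * (1 + δ) / (q * τ)) + D * (7 * τ) else 0) := by
      intro r hr
      have hrq := (Nat.mem_divisors.1 hr).1
      have hr0 : 0 < r := Nat.pos_of_dvd_of_pos hrq hq
      rw [norm_mul]
      have hmu : ‖((ArithmeticFunction.moebius r : ℤ) : ℂ)‖ ≤ 1 := by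
        rw [Complex.norm_intCast]; exact_mod_cast ArithmeticFunction.abs_moebius_le_one
      refine (mul_le_of_le_one_left (norm_nonneg _) hmu).trans ?_
      rw [sum_dvd_reindex r hr0, show (1 + r - 1) / r = 1 by
        rw [Nat.add_sub_cancel_left]; exact Nat.div_self hr0,
        show (N + 1 + r - 1) / r = N / r + 1 by
          rw [show N + 1 + r - 1 = N + r by omega, Nat.add_div_right _ hr0]]
      split_ifs with hrr
      · subst hrr
        have e : ∀ m ∈ Ico 1 (N / r + 1), (TT I d l (m * r) : ℂ) * ee (((m * r : ℕ) : ℝ) * β) =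
            (TT I d l m : ℂ) * ee (m * (r * θ)) := by
          intro m _
          rw [TT_mul h hrq]
          congr 1
          have : ((m * r : ℕ) : ℝ) * β = m * (r * θ) + ((m * a : ℤ) : ℝ) := by
            rw [hβ]; push_cast; field_simp; ring
          rw [this, ee_add_int]
        rw [Finset.sum_congr rfl e]
        have h1 := TT_major h (r * θ) 1 (N / r + 1) (Nat.le_add_left 1 _)
        have hX : (((N / r + 1 : ℕ) : ℝ)) - (1 : ℕ) ≤ (N : ℝ) / r := by
          push_cast; linarith [Nat.cast_div_le (α := ℝ) (m := N) (n := r)]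
        have h2 := geom_mn (N / r) (r * θ) 1 (N / r + 1) hX (by positivity)
        have hhalf : |(r:ℝ) * θ| ≤ 1 / 2 := by
          have h3 := hDθ r le_rfl
          have h4 : 1 / (2 * (r:ℝ)) ≤ 1 / 2 := by gcongr; linarith
          have : |(r:ℝ) * θ| ≤ D * |(r:ℝ) * θ| := le_mul_of_one_le_left (abs_nonneg _) hD'
          linarith
        have h3 := mn_tau (N / r) (r * θ) (by positivity) hhalf
        have e3 : 2 * ((N:ℝ) / r) / (1 + N / r * |r * θ|) = 2 * N / (r * τ) := by
          rw [abs_mul, Nat.abs_cast, hτ]; field_simp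
        rw [e3] at h3
        have h4 := h2.trans h3
        have h5 : 1 + 2 * Real.pi * |(r:ℝ) * θ| * ((((N / r + 1 : ℕ) : ℝ)) - (1 : ℕ)) ≤ 7 * τ - 0 := by
          have hpi := Real.pi_lt_d2
          have hpi0 := Real.pi_pos
          have : 2 * Real.pi * |(r:ℝ) * θ| * ((((N / r + 1 : ℕ) : ℝ)) - (1 : ℕ)) ≤ 2 * Real.pi * |(r:ℝ) * θ| * (N / r) := by
            gcongr
          have e6 : 2 * Real.pi * |(r:ℝ) * θ| * (N / r) = 2 * Real.pi * (N * |θ|) := by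
            rw [abs_mul, Nat.abs_cast]; field_simp
          have : 2 * Real.pi * (N * |θ|) ≤ 7 * (N * |θ|) := by gcongr; linarith
          linarith
        have h6 : (∑ i ∈ I, l i * mon (fun p => (1 / p : ℝ)) (d i)) * ‖∑ n ∈ Ico 1 (N / r + 1), ee (n * (r * θ))‖ ≤
            (v * (1 + δ)) * (2 * N / (r * τ)) := by
          have := h.d0
          exact mul_le_mul h.tt h4 (norm_nonneg _) (by positivity)
        have h7 : (D:ℝ) * (1 + 2 * Real.pi * |(r:ℝ) * θ| * ((((N / r + 1 : ℕ) : ℝ)) - (1 : ℕ))) ≤ D * (7 * τ - 0) := by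
          gcongr
        have e8 : v * N * (2 * (1 + δ) / (r * τ)) = (v * (1 + δ)) * (2 * N / (r * τ)) := by ring
        rw [e8]
        have : (0:ℝ) ≤ D * r := by positivity
        linarith
      · have e : ∀ m ∈ Ico 1 (N / r + 1), (TT I d l (m * r) : ℂ) * ee (((m * r : ℕ) : ℝ) * β) =
            (TT I d l m : ℂ) * ee (m * (((r * a : ℤ) : ℝ) / q + r * θ)) := by
          intro m _
          rw [TT_mul h hrq]
          congr 2
          rw [hβ]; push_cast; ring
        rw [Finset.sum_congr rfl e, add_zero]
        refine TT_minor h hq (r * a) ?_ (r * θ) (hDθ r (Nat.le_of_dvd hq hrq)) _ _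
        intro hdvd
        have h1 : (q : ℤ) ∣ r := (IsCoprime.dvd_of_dvd_mul_right ha.symm hdvd)
        exact hrr (Nat.dvd_antisymm hrq (by exact_mod_cast h1))
    refine (Finset.sum_le_sum hterm).trans ?_
    rw [Finset.sum_add_distrib, Finset.sum_const, nsmul_eq_mul, Finset.sum_ite_eq' q.divisors q,
      if_pos (Nat.mem_divisors_self q hq.ne')]
    have hcard : (q.divisors.card : ℝ) ≤ q := by exact_mod_cast Nat.card_divisors_le_self q
    have : (q.divisors.card : ℝ) * (D * q) ≤ q * (D * q) := by gcongr
    linarith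
  -- error
  have err : ‖∑ n ∈ Ico 1 (N + 1) with Nat.Coprime n q, (((TT I d l n : ℝ) : ℂ) -
      (if ∀ p ∈ ps J q, ¬ p ∣ n then 1 else 0)) * ee (n * β)‖ ≤ v * N * δ + D := by
    refine (norm_sum_le _ _).trans ?_
    have h1 := TT_count h k (fun i _ => by linarith [abs_nonneg (l i)]) 1 0 1 (N + 1) one_pos (one_dvd _) (by omega)
    have h2 : (((N + 1 : ℕ) : ℝ) - (1 : ℕ)) / (1 : ℕ) * (∑ i ∈ I, k i * mon (fun p => (1 / p : ℝ)) (d i)) ≤ N * (v * δ) := by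
      have : (((N + 1 : ℕ) : ℝ) - (1 : ℕ)) / (1 : ℕ) = N := by push_cast; ring
      rw [this]
      have := h.kk
      gcongr
    have hk0 : ∀ n, 0 ≤ TT I d k n := fun n => (abs_nonneg _).trans (TT_err h n)
    refine le_trans ?_ (h1.trans (by linarith))
    refine (Finset.sum_le_sum (g := fun n => TT I d k n) fun n _ => ?_).trans
      (Finset.sum_le_sum_of_subset_of_nonneg ?_ fun n _ _ => hk0 n)
    · rw [norm_mul, norm_ee, mul_one]
      have := TT_err h n
      rw [← Real.norm_eq_abs, ← Complex.norm_real] at this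
      refine le_trans (le_of_eq ?_) this
      congr 1
      split_ifs <;> simp
    · intro n hn
      rw [Finset.mem_filter] at hn ⊢
      exact ⟨hn.1, Nat.modEq_one⟩
  have e : ∑ n ∈ Ico 1 (N + 1) with Nat.Coprime n q ∧ (∀ p ∈ ps J q, ¬ p ∣ n), ee (n * β) =
      ∑ n ∈ Ico 1 (N + 1) with Nat.Coprime n q, (TT I d l n : ℂ) * ee (n * β) -
      ∑ n ∈ Ico 1 (N + 1) with Nat.Coprime n q, (((TT I d l n : ℝ) : ℂ) -
      (if ∀ p ∈ ps J q, ¬ p ∣ n then 1 else 0)) * ee (n * β) := by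
    rw [← Finset.sum_sub_distrib, ← Finset.filter_filter, Finset.sum_filter (s := filter _ _)]
    refine Finset.sum_congr rfl fun n _ => ?_
    split_ifs <;> ring
  rw [e]
  refine (norm_sub_le _ _).trans ((add_le_add main err).trans ?_)
  have : (D:ℝ) * 1 ≤ D * τ := by gcongr
  linarith

end
end DPM
namespace DPM
open Finset

section
variable {J q D : ℕ} {δ : ℝ} {ι : Type} {I : Finset ι} {d : ι → Finset ℕ} {l k : ι → ℝ}

theorem rough_count (h : SD (ps J q) D δ I d l k) {L : ℝ}
    (hL : ∑ i ∈ I, l i * mon (fun p => (1 / p : ℝ)) (d i) ≤ L) (G : Finset ℕ) (m v A B : ℕ)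
    (hm : 0 < m) (hmq : m ∣ q) (hAB : A ≤ B)
    (hG : ∀ n ∈ G, n ∈ Ico A B ∧ n ≡ v [MOD m] ∧ ∀ p ∈ ps J q, ¬ p ∣ n) :
    (#G : ℝ) ≤ ((B : ℝ) - A) / m * L + D := by
  have h1 := TT_count h l (fun i _ => by linarith [abs_nonneg (k i)]) m v A B hm hmq hAB
  have hBA : (0:ℝ) ≤ (B:ℝ) - A := by
    have : (A:ℝ) ≤ B := by exact_mod_cast hAB
    linarith
  have h2 : ((B : ℝ) - A) / m * (∑ i ∈ I, l i * mon (fun p => (1 / p : ℝ)) (d i)) ≤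
    ((B : ℝ) - A) / m * L := by gcongr
  refine le_trans ?_ (h1.trans (by linarith))
  rw [Finset.card_eq_sum_ones, Nat.cast_sum]
  refine (Finset.sum_le_sum (g := fun n => TT I d l n) fun n hn => ?_).trans
      (Finset.sum_le_sum_of_subset_of_nonneg ?_ fun n _ _ => TT_nonneg h n)
  · simpa using TT_one h (hG n hn).2.2
  · intro n hn
    exact Finset.mem_filter.2 ⟨(hG n hn).1, (hG n hn).2.1⟩

theorem W_bound (h : SD (ps J q) D δ I d l k) {L : ℝ}
    (hL : ∑ i ∈ I, l i * mon (fun p => (1 / p : ℝ)) (d i) ≤ L) (hL0 : 0 ≤ L)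
    (hq : 0 < q) (a : ℤ) (ha : IsCoprime a (q:ℤ)) (θ : ℝ) (N X : ℕ) (hX : 0 < X) (s : ℝ) (hs1 : 1 ≤ s)
    (hs : s ^ 2 = 1 + N * |θ|) (hD1 : 1 ≤ D) (hc : 2 * (D:ℝ) * q * s ^ 2 ≤ X) (κ lam : ℕ)
    (hκ : ((κ:ℝ) - lam : ℝ) ≤ N / X) (hlam : ((lam:ℝ) - κ : ℝ) ≤ N / X) (Y : ℕ) (hY1 : X ≤ Y) (hY : Y ≤ 2 * X) :
    ‖∑ m ∈ Ico X Y, (TT I d l m : ℂ) * ee (m * (((κ:ℝ) - lam) * (a / q + θ)))‖ ≤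
      if (q:ℤ) ∣ (κ:ℤ) - lam then
        L * ((if |(κ:ℝ) - lam| * s ≤ N / X then (X:ℝ) else 0) + 2 * X / s) + (D:ℝ) * (8 * s ^ 2) else (D:ℝ) * q := by
  have hX' : (0:ℝ) < X := by exact_mod_cast hX
  have hq' : (0:ℝ) < q := by exact_mod_cast hq
  have hD' : (1:ℝ) ≤ D := by exact_mod_cast hD1
  have hq1 : (1:ℝ) ≤ q := by exact_mod_cast hq
  set g : ℝ := (κ:ℝ) - lam with hg
  have hgM : |g| ≤ N / X := by rw [abs_le]; constructor <;> linarith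
  have hgX : X * (|g| * |θ|) ≤ s ^ 2 := by
    have : X * (|g| * |θ|) ≤ X * ((N / X) * |θ|) := by gcongr
    have e : X * ((N / X) * |θ|) = N * |θ| := by field_simp
    linarith
  have hDg : (D:ℝ) * |g * θ| ≤ 1 / (2 * q) := by
    rw [abs_mul, le_div_iff₀ (by positivity)]
    have h1 : (2 * D * q) * (X * (|g| * |θ|)) ≤ 1 * X :=
      (mul_le_mul_of_nonneg_left hgX (by positivity)).trans (by linarith)
    have h2 : X * (D * (|g| * |θ|) * (2 * q)) ≤ X * 1 := by nlinarith
    exact le_of_mul_le_mul_left h2 hX'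
  by_cases hdv : (q:ℤ) ∣ (κ:ℤ) - lam
  · rw [if_pos hdv]
    obtain ⟨z, hz⟩ := hdv
    have hz' : g = q * z := by rw [hg]; exact_mod_cast hz
    have e : ∀ m ∈ Ico X Y, (TT I d l m : ℂ) * ee (m * (g * (a / q + θ))) =
        (TT I d l m : ℂ) * ee (m * (g * θ)) := by
      intro m _
      congr 1
      have : (m:ℝ) * (g * (a / q + θ)) = m * (g * θ) + ((m * z * a : ℤ) : ℝ) := by
        rw [hz']; push_cast; field_simp; ring
      rw [this, ee_add_int]
    rw [Finset.sum_congr rfl e]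
    have hXY : ((Y:ℝ)) - X ≤ X := by
      have : (Y:ℝ) ≤ 2 * X := by exact_mod_cast hY
      linarith
    have h1 := TT_major h (g * θ) X Y hY1
    have h2 := geom_mn X (g * θ) X Y hXY hX'.le
    have h3 : (D:ℝ) * (1 + 2 * Real.pi * |g * θ| * (Y - X)) ≤ D * (8 * s ^ 2) := by
      have : |g * θ| * ((Y:ℝ) - X) ≤ s ^ 2 := by
        rw [abs_mul]
        refine le_trans ?_ hgX
        rw [mul_comm]
        gcongr
      have h4 : 2 * Real.pi * (|g * θ| * ((Y:ℝ) - X)) ≤ 2 * 3.15 * s ^ 2 := by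
        have := Real.pi_lt_d2.le
        gcongr
        have : (X:ℝ) ≤ Y := by exact_mod_cast hY1
        exact mul_nonneg (abs_nonneg _) (by linarith)
      have : 1 ≤ s ^ 2 := one_le_pow₀ hs1
      gcongr
      linarith
    have h5 : (∑ i ∈ I, l i * mon (fun p => (1 / p : ℝ)) (d i)) * ‖∑ n ∈ Ico X Y, ee (n * (g * θ))‖ ≤
      L * mn X (g * θ) := by gcongr
    refine h1.trans (add_le_add (h5.trans ?_) h3)
    gcongr
    split_ifs with hsm
    · have := mn_le X (g * θ)
      have : 0 ≤ 2 * (X:ℝ) / s := by positivity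
      linarith
    · have hhalf : |g * θ| ≤ 1 / 2 := by
        have : |g * θ| ≤ D * |g * θ| := le_mul_of_one_le_left (abs_nonneg _) hD'
        have h4 : 1 / (2 * (q:ℝ)) ≤ 1 / 2 := by gcongr; linarith
        linarith
      have h6 := mn_tau X (g * θ) hX'.le hhalf
      rw [zero_add]
      refine h6.trans ?_
      gcongr
      rw [abs_mul]
      push Not at hsm
      have h7 : s * (X * (|g| * |θ|)) ≥ N * |θ| := by
        have : X * ((N / X) * |θ|) ≤ X * ((|g| * s) * |θ|) := by gcongr
        have e : X * ((N / X) * |θ|) = N * |θ| := by field_simp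
        nlinarith
      have h8 : s * s ≤ s * (1 + X * (|g| * |θ|)) := by nlinarith
      exact le_of_mul_le_mul_left h8 (by linarith)
  · rw [if_neg hdv]
    have hnd : ¬ (q:ℤ) ∣ ((κ:ℤ) - lam) * a := fun hh => hdv (ha.symm.dvd_of_dvd_mul_right hh)
    have h1 := TT_minor h hq (((κ:ℤ) - lam) * a) hnd (g * θ) hDg X Y
    convert h1 using 6
    push_cast
    rw [hg]; ring

set_option maxHeartbeats 1000000 in
theorem dyadic (h : SD (ps J q) D δ I d l k) {L : ℝ}
    (hL : ∑ i ∈ I, l i * mon (fun p => (1 / p : ℝ)) (d i) ≤ L) (hL0 : 0 < L) (hL1 : L ≤ 1)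
    (hq : 0 < q) (a : ℤ) (ha : IsCoprime a (q:ℤ)) (θ : ℝ) (N i : ℕ) (hi : 1 ≤ i) (hJ : 2 ^ J ≤ i)
    (hXN : 2 ^ i * 2 ^ i ≤ N) (s : ℝ) (hs1 : 1 ≤ s)
    (hs : s ^ 2 = 1 + N * |θ|) (hD1 : 1 ≤ D) (hc : 9 * (D:ℝ) * (q * s ^ 2) ^ 2 ≤ L ^ 2 * 2 ^ i)
    (Ks : Finset ℕ) (u : ℕ → ℕ) (hKs : ∀ κ ∈ Ks, κ ∈ Ico 1 (N / 2 ^ i + 1) ∧ ∀ p ∈ ps J q, ¬ p ∣ κ) :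
    ‖∑ m ∈ Ico (2 ^ i) (2 * 2 ^ i), (if m.Prime then (1:ℂ) else 0) *
      ∑ κ ∈ Ks with m ≤ u κ, (1:ℂ) * ee (m * κ * (a / q + θ))‖ ^ 2 ≤ 56 * L ^ 3 * N ^ 2 / (i * (q * s)) := by
  set X : ℕ := 2 ^ i with hXd
  have hX : 0 < X := by positivity
  have hXr : ((X:ℕ):ℝ) = 2 ^ i := by rw [hXd]; push_cast; rfl
  rw [← hXr] at hc
  have hX' : (0:ℝ) < X := by exact_mod_cast hX
  have hq' : (0:ℝ) < q := by exact_mod_cast hq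
  have hi' : (0:ℝ) < i := by exact_mod_cast hi
  have hD' : (1:ℝ) ≤ D := by exact_mod_cast hD1
  have hq1 : (1:ℝ) ≤ q := by exact_mod_cast hq
  have hXN' : (X:ℝ) * X ≤ N := by exact_mod_cast hXN
  set M : ℝ := N / X with hM
  have hMX : M * X = N := by rw [hM]; field_simp
  have hXM : (X:ℝ) ≤ M := by rw [hM, le_div_iff₀ hX']; exact hXN'
  have hM0 : 0 < M := by linarith
  have hs2 : 1 ≤ s ^ 2 := one_le_pow₀ hs1
  have hss : s ≤ s ^ 2 := by nlinarith
  have hqs1 : (q:ℝ) * s ≤ q * s ^ 2 := by gcongr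
  have hqs0 : 1 ≤ (q:ℝ) * s ^ 2 := by nlinarith
  have hqs2 : (q:ℝ) * s ^ 2 ≤ (q * s ^ 2) ^ 2 := by nlinarith
  have hL2 : L ^ 2 ≤ L := by nlinarith
  have hLX : L ^ 2 * X ≤ L * X := by gcongr
  have hLM : L * X ≤ L * M := by gcongr
  have hLX1 : L * X ≤ X := by nlinarith
  have hDq : (D:ℝ) * (q * s ^ 2) ≤ D * (q * s ^ 2) ^ 2 := by gcongr
  have hDq1 : (D:ℝ) * 1 ≤ D * (q * s ^ 2) := by gcongr
  have c4 : 2 * (D:ℝ) * q * s ^ 2 ≤ X := by linarith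
  have c2 : (D:ℝ) ≤ M * L := by linarith
  have c3 : 3 * (D:ℝ) * (q * s) ≤ L * M := by
    have : (D:ℝ) * (q * s) ≤ D * (q * s ^ 2) := by gcongr
    linarith
  have c5 : (D:ℝ) * (q + 8 * s ^ 2) * (q * s) ≤ L ^ 2 * X := by
    have h1 : (q:ℝ) + 8 * s ^ 2 ≤ 9 * (q * s ^ 2) := by nlinarith
    calc (D:ℝ) * (q + 8 * s ^ 2) * (q * s) ≤ D * (9 * (q * s ^ 2)) * (q * s ^ 2) := by gcongr
      _ = 9 * (D:ℝ) * (q * s ^ 2) ^ 2 := by ring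
      _ ≤ _ := hc
  have c6 : s ≤ M := by
    have h1 : 1 * s ≤ q * s := by gcongr
    have h2 : 1 * ((q:ℝ) * s ^ 2) ≤ D * (q * s ^ 2) := by gcongr
    linarith
  have hNX : ((N / X : ℕ) : ℝ) ≤ M := Nat.cast_div_le
  have hKM : ∀ κ ∈ Ks, (κ:ℝ) ≤ M := fun κ hκ => by
    have : κ ≤ N / X := by have := (Finset.mem_Ico.1 (hKs κ hκ).1).2; omega
    exact le_trans (by exact_mod_cast this) hNX
  have cardK : (#Ks : ℝ) ≤ 2 * (M * L) := by
    have := rough_count h hL Ks 1 0 1 (N / X + 1) one_pos (one_dvd _) (Nat.le_add_left 1 _)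
      fun n hn => ⟨(hKs n hn).1, Nat.modEq_one, (hKs n hn).2⟩
    have e : (((N / X + 1 : ℕ) : ℝ) - (1:ℕ)) / (1:ℕ) * L ≤ M * L := by
      push_cast; gcongr; rw [div_one]; linarith
    linarith
  set W : ℕ → ℕ → ℝ := fun κ lam => if (q:ℤ) ∣ (κ:ℤ) - lam then
        L * ((if |(κ:ℝ) - lam| * s ≤ N / X then (X:ℝ) else 0) + 2 * X / s) + (D:ℝ) * (8 * s ^ 2) else (D:ℝ) * q
    with hW
  have hWb : ∀ κ ∈ Ks, ∑ lam ∈ Ks, W κ lam ≤ 7 * L ^ 2 * N / (q * s) + 0 := by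
    intro κ hκ
    have h1 : ∑ lam ∈ Ks, W κ lam ≤ ∑ lam ∈ Ks, ((D:ℝ) * (q + 8 * s ^ 2) +
        ((if (q:ℤ) ∣ (κ:ℤ) - lam ∧ |(κ:ℝ) - lam| * s ≤ N / X then L * X else 0) +
        (if (q:ℤ) ∣ (κ:ℤ) - lam then L * (2 * X / s) else 0))) := by
      refine Finset.sum_le_sum fun lam _ => ?_
      rw [hW]
      beta_reduce
      have p1 : (0:ℝ) ≤ D * q := by positivity
      have p2 : (0:ℝ) ≤ D * (8 * s ^ 2) := by positivity
      by_cases x1 : (q:ℤ) ∣ (κ:ℤ) - lam <;> by_cases x2 : |(κ:ℝ) - lam| * s ≤ N / X <;>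
        simp only [x1, x2, if_true, if_false, true_and, false_and] <;> linarith
    have modq : ∀ lam : ℕ, (q:ℤ) ∣ (κ:ℤ) - lam → lam ≡ κ [MOD q] := fun lam hh =>
      (Nat.modEq_iff_dvd).2 hh
    rw [Finset.sum_add_distrib, Finset.sum_add_distrib, Finset.sum_const, nsmul_eq_mul,
      ← Finset.sum_filter, ← Finset.sum_filter, Finset.sum_const, Finset.sum_const, nsmul_eq_mul, nsmul_eq_mul] at h1
    have n2 := rough_count h hL (Ks.filter fun lam : ℕ => (q:ℤ) ∣ (κ:ℤ) - lam) q κ 1 (N / X + 1) hq dvd_rfl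
      (Nat.le_add_left 1 _) fun n hn => by
        rw [Finset.mem_filter] at hn
        exact ⟨(hKs n hn.1).1, modq n hn.2, (hKs n hn.1).2⟩
    have n1 := rough_count h hL (Ks.filter fun lam : ℕ => (q:ℤ) ∣ (κ:ℤ) - lam ∧ |(κ:ℝ) - lam| * s ≤ N / X) q κ
      (κ - ⌊M / s⌋₊) (κ + ⌊M / s⌋₊ + 1) hq dvd_rfl (by omega) fun n hn => by
        rw [Finset.mem_filter] at hn
        refine ⟨?_, modq n hn.2.1, (hKs n hn.1).2⟩
        have hh : |(κ:ℝ) - n| ≤ M / s := by rw [le_div_iff₀ (by linarith)]; exact hn.2.2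
        rw [abs_le] at hh
        have h8 : n - κ ≤ ⌊M / s⌋₊ := by
          apply Nat.le_floor
          rcases le_total n κ with h9 | h9
          · rw [Nat.sub_eq_zero_of_le h9]; push_cast; positivity
          · rw [Nat.cast_sub h9]; linarith
        have h8' : κ - n ≤ ⌊M / s⌋₊ := by
          apply Nat.le_floor
          rcases le_total κ n with h9 | h9
          · rw [Nat.sub_eq_zero_of_le h9]; push_cast; positivity
          · rw [Nat.cast_sub h9]; linarith
        rw [Finset.mem_Ico]
        omega
    have n1' : (#(Ks.filter fun lam : ℕ => (q:ℤ) ∣ (κ:ℤ) - lam ∧ |(κ:ℝ) - lam| * s ≤ N / X) : ℝ) ≤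
        3 * (M * L / (q * s)) + D := by
      refine n1.trans ?_
      have hfl : ((⌊M / s⌋₊ : ℕ) : ℝ) ≤ M / s := Nat.floor_le (by positivity)
      have h9 : ((κ - ⌊M / s⌋₊ : ℕ) : ℝ) ≥ κ - M / s := by
        have : κ ≤ (κ - ⌊M / s⌋₊) + ⌊M / s⌋₊ := by omega
        have : (κ:ℝ) ≤ ((κ - ⌊M / s⌋₊ : ℕ) : ℝ) + ⌊M / s⌋₊ := by exact_mod_cast this
        linarith
      have h10 : 1 ≤ M / s := by rw [le_div_iff₀ (by linarith)]; linarith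
      have e : 3 * (M * L / (q * s)) = 3 * (M / s) / q * L := by field_simp
      rw [e]
      gcongr
      push_cast
      linarith
    have n2' : (#(Ks.filter fun lam : ℕ => (q:ℤ) ∣ (κ:ℤ) - lam) : ℝ) ≤ M * L / q + D := by
      refine n2.trans ?_
      have e : M * L / q = M / q * L := by ring
      rw [e]
      gcongr
      push_cast; linarith
    have n0 : (#Ks:ℝ) ≤ M := by
      have : #Ks ≤ #(Ico 1 (N / X + 1)) := Finset.card_le_card fun κ hκ => (hKs κ hκ).1
      rw [Nat.card_Ico, Nat.add_sub_cancel] at this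
      exact le_trans (by exact_mod_cast this) hNX
    refine h1.trans ?_
    have t0 : (#Ks:ℝ) * (D * (q + 8 * s ^ 2)) ≤ L ^ 2 * N / (q * s) := by
      rw [le_div_iff₀ (by positivity)]
      calc (#Ks:ℝ) * (D * (q + 8 * s ^ 2)) * (q * s) = #Ks * (D * (q + 8 * s ^ 2) * (q * s)) := by ring
        _ ≤ M * (L ^ 2 * X) := by gcongr
        _ = L ^ 2 * N := by rw [← hMX]; ring
    have tD : L * X * (3 * D) ≤ L ^ 2 * N / (q * s) := by
      rw [le_div_iff₀ (by positivity)]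
      calc L * X * (3 * D) * (q * s) = L * X * (3 * D * (q * s)) := by ring
        _ ≤ L * X * (L * M) := by gcongr
        _ = L ^ 2 * N := by rw [← hMX]; ring
    have t1 : (3 * (M * L / (q * s)) + D) * (L * X) = 3 * (L ^ 2 * N / (q * s)) + L * X * D := by
      rw [← hMX]; field_simp
    have t2 : (M * L / q + D) * (L * (2 * X / s)) ≤ 2 * (L ^ 2 * N / (q * s)) + L * X * (2 * D) := by
      have e : (M * L / q + D) * (L * (2 * X / s)) = 2 * (L ^ 2 * N / (q * s)) + L * X * (2 * D) / s := by
        rw [← hMX]; field_simp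
      rw [e]
      gcongr
      exact div_le_self (by positivity) hs1
    have t1' := mul_le_mul_of_nonneg_right n1' (show 0 ≤ L * X by positivity)
    have t2' := mul_le_mul_of_nonneg_right n2' (show 0 ≤ L * (2 * X / s) by positivity)
    have e7 : 7 * L ^ 2 * N / (q * s) = 7 * (L ^ 2 * N / (q * s)) := by ring
    rw [e7]
    linarith
  have hb := bilin (a / q + θ) X (2 * X) (by omega) Ks u (fun m => if m.Prime then (1:ℂ) else 0) (fun _ => 1)
    (fun m => if m.Prime then (1:ℝ) else 0) (fun m => TT I d l m)
    (fun m _ => by split_ifs <;> norm_num) (fun m _ => TT_nonneg h m)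
    (fun m hm => by
      split_ifs with hp
      · simp only [norm_one, one_pow, one_mul]
        refine TT_one h fun p hp1 hp2 => ?_
        have e := (Nat.prime_dvd_prime_iff_eq (ps_prime hp1) hp).1 hp2
        have h3 := Finset.mem_range.1 (Finset.mem_filter.1 hp1).1
        have h4 : 2 ^ 2 ^ J ≤ X := Nat.pow_le_pow_right (by norm_num) hJ
        have h5 := (Finset.mem_Ico.1 hm).1
        omega
      · simp)
    W (fun κ hκ lam hlam Y hY1 hY2 => by
        have h1 := hKM κ hκ
        have h2 := hKM lam hlam
        exact W_bound h hL hL0.le hq a ha θ N X hX s hs1 hs hD1 c4 κ lam (by linarith [Nat.cast_nonneg (α := ℝ) lam])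
          (by linarith [Nat.cast_nonneg (α := ℝ) κ]) Y hY1 hY2)
    (fun κ _ lam _ => by
      simp only [hW]
      simp only [abs_sub_comm (κ:ℝ) lam, dvd_sub_comm (b := (κ:ℤ)) (c := (lam:ℤ))])
  refine hb.trans ?_
  have hpr : ∑ m ∈ Ico X (2 * X), (if m.Prime then (1:ℝ) else 0) ≤ 4 * X / i := by
    have := cheb i hi
    rw [pow_succ, mul_comm (2 ^ i) 2, ← hXd, ← hXr] at this
    simpa using this
  have hsum : ∑ κ ∈ Ks, ‖(1:ℂ)‖ ^ 2 * ∑ lam ∈ Ks, W κ lam ≤ 2 * (M * L) * (7 * L ^ 2 * N / (q * s)) := by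
    calc ∑ κ ∈ Ks, ‖(1:ℂ)‖ ^ 2 * ∑ lam ∈ Ks, W κ lam ≤ ∑ κ ∈ Ks, (7 * L ^ 2 * N / (q * s)) :=
          Finset.sum_le_sum fun κ hκ => by simpa using hWb κ hκ
      _ = #Ks * (7 * L ^ 2 * N / (q * s)) := by rw [Finset.sum_const, nsmul_eq_mul]
      _ ≤ _ := by gcongr
  have hsum0 : 0 ≤ 2 * (M * L) * (7 * L ^ 2 * N / (q * s)) := by positivity
  have hp0 : 0 ≤ ∑ m ∈ Ico X (2 * X), (if m.Prime then (1:ℝ) else 0) :=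
    Finset.sum_nonneg fun m _ => by split_ifs <;> norm_num
  refine (mul_le_mul_of_nonneg_left hsum hp0).trans ((mul_le_mul_of_nonneg_right hpr hsum0).trans (le_of_eq ?_))
  rw [← hMX]; field_simp; ring
end
end DPM
namespace DPM
open Finset

theorem minFac_pk {p κ : ℕ} (hp : p.Prime) (hκ : 2 ≤ κ) (h : p ≤ κ.minFac) : (p * κ).minFac = p := by
  apply le_antisymm (Nat.minFac_le_of_dvd hp.two_le (dvd_mul_right _ _))
  have h1 : (p * κ).minFac.Prime := Nat.minFac_prime (by have := hp.two_le; nlinarith)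
  rcases (h1.dvd_mul).1 (Nat.minFac_dvd (p * κ)) with h2 | h2
  · exact ((Nat.prime_dvd_prime_iff_eq h1 hp).1 h2).ge
  · exact h.trans (Nat.minFac_le_of_dvd h1.two_le h2)

theorem fiber_eq (β : ℝ) (N J i : ℕ) (hJ : 2 ^ J ≤ i) :
    ∑ n ∈ ((Ico 2 (N + 1)).filter fun n => 2 ^ 2 ^ J ≤ n.minFac ∧ ¬ n.Prime) with Nat.log 2 n.minFac = i,
      ee (n * β) =
    ∑ m ∈ Ico (2 ^ i) (2 * 2 ^ i), (if m.Prime then (1:ℂ) else 0) *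
      ∑ κ ∈ ((Ico 2 (N / 2 ^ i + 1)).filter fun κ => 2 ^ 2 ^ J ≤ κ.minFac) with m ≤ min (N / κ) κ.minFac,
        (1:ℂ) * ee (m * κ * β) := by
  simp only [ite_mul, one_mul, zero_mul]
  rw [← Finset.sum_filter, Finset.sum_sigma']
  refine Finset.sum_nbij' (fun n => (⟨n.minFac, n / n.minFac⟩ : Σ _ : ℕ, ℕ)) (fun x => x.1 * x.2) ?_ ?_ ?_ ?_ ?_
  · intro n hn
    simp only [Finset.mem_filter, Finset.mem_Ico] at hn
    obtain ⟨⟨⟨hn2, hnN⟩, hw, hnp⟩, hlog⟩ := hn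
    have hp := Nat.minFac_prime (show n ≠ 1 by omega)
    set p := n.minFac with hpd
    have e : p * (n / p) = n := Nat.mul_div_cancel' (Nat.minFac_dvd n)
    set κ := n / p with hκ
    have hk2 : 2 ≤ κ := by
      rcases Nat.lt_or_ge κ 2 with h | h
      · interval_cases κ
        · omega
        · rw [mul_one] at e; rw [e] at hp; exact absurd hp hnp
      · exact h
    have hX : 2 ^ i ≤ p := by rw [← hlog]; exact Nat.pow_log_le_self 2 hp.ne_zero
    have hX2 : p < 2 ^ (i + 1) := by rw [← hlog]; exact Nat.lt_pow_succ_log_self (by norm_num) _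
    have hmf : p ≤ κ.minFac := Nat.minFac_le_of_dvd (Nat.minFac_prime (by omega)).two_le
      ((Nat.minFac_dvd κ).trans ⟨p, by rw [mul_comm, e]⟩)
    simp only [Finset.mem_sigma, Finset.mem_filter, Finset.mem_Ico]
    refine ⟨⟨⟨hX, by rw [pow_succ] at hX2; omega⟩, hp⟩, ⟨⟨hk2, Nat.lt_succ_of_le ?_⟩, hw.trans hmf⟩, le_min ?_ hmf⟩
    · rw [Nat.le_div_iff_mul_le (by positivity)]
      calc κ * 2 ^ i ≤ κ * p := Nat.mul_le_mul_left _ hX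
        _ ≤ N := by rw [mul_comm, e]; omega
    · rw [Nat.le_div_iff_mul_le (by omega), e]; omega
  · rintro ⟨p, κ⟩ hx
    simp only [Finset.mem_sigma, Finset.mem_filter, Finset.mem_Ico] at hx
    obtain ⟨⟨⟨h1, h2⟩, hp⟩, ⟨⟨h3, h4⟩, h5⟩, h6⟩ := hx
    have h7 := h6.trans (min_le_left _ _)
    have h8 := h6.trans (min_le_right _ _)
    rw [Nat.le_div_iff_mul_le (by omega)] at h7
    have hp2 := hp.two_le
    simp only [Finset.mem_filter, Finset.mem_Ico]
    rw [minFac_pk hp h3 h8]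
    refine ⟨⟨⟨by nlinarith, by omega⟩, ?_, Nat.not_prime_mul hp.ne_one (by omega)⟩, ?_⟩
    · exact (Nat.pow_le_pow_right (by norm_num) hJ).trans h1
    · exact Nat.log_eq_of_pow_le_of_lt_pow h1 (by rw [pow_succ]; omega)
  · intro n hn
    exact Nat.mul_div_cancel' (Nat.minFac_dvd n)
  · rintro ⟨p, κ⟩ hx
    simp only [Finset.mem_sigma, Finset.mem_filter, Finset.mem_Ico] at hx
    obtain ⟨⟨⟨h1, h2⟩, hp⟩, ⟨⟨h3, h4⟩, h5⟩, h6⟩ := hx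
    have e := minFac_pk hp h3 (h6.trans (min_le_right _ _))
    simp only [e, Nat.mul_div_cancel_left _ hp.pos]
  · intro n hn
    have e : n.minFac * (n / n.minFac) = n := Nat.mul_div_cancel' (Nat.minFac_dvd n)
    simp only
    rw [← Nat.cast_mul, e]

theorem typeII {J2 q D : ℕ} {δ : ℝ} {ι : Type} {I : Finset ι} {d : ι → Finset ℕ} {l k : ι → ℝ}
    (h : SD (ps J2 q) D δ I d l k) {L : ℝ}
    (hL : ∑ i ∈ I, l i * mon (fun p => (1 / p : ℝ)) (d i) ≤ L) (hL0 : 0 < L) (hL1 : L ≤ 1)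
    (hq : 0 < q) (a : ℤ) (ha : IsCoprime a (q:ℤ)) (θ : ℝ) (N J : ℕ) (hJ : J2 ≤ J) (s : ℝ) (hs1 : 1 ≤ s)
    (hs : s ^ 2 = 1 + N * |θ|) (hD1 : 1 ≤ D) (hc : 9 * (D:ℝ) * (q * s ^ 2) ^ 2 ≤ L ^ 2 * 2 ^ 2 ^ J) :
    ‖∑ n ∈ Ico 2 (N + 1) with 2 ^ 2 ^ J ≤ n.minFac ∧ ¬ n.Prime, ee (n * (a / q + θ))‖ ≤
      (Nat.log 2 N + 1) * √(56 * L ^ 3 * N ^ 2 / (2 ^ J * (q * s))) := by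
  have hq' : (0:ℝ) < q := by exact_mod_cast hq
  rw [← Finset.sum_fiberwise_of_maps_to (t := range (Nat.log 2 N + 1)) (g := fun n => Nat.log 2 n.minFac)]
  · refine (norm_sum_le _ _).trans ?_
    refine (Finset.sum_le_card_nsmul _ _ (√(56 * L ^ 3 * N ^ 2 / (2 ^ J * (q * s)))) fun i _ => ?_).trans ?_
    · rcases Finset.eq_empty_or_nonempty (((Ico 2 (N + 1)).filter fun n => 2 ^ 2 ^ J ≤ n.minFac ∧ ¬ n.Prime).filter
        fun n => Nat.log 2 n.minFac = i) with he | ⟨n, hn⟩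
      · rw [he, Finset.sum_empty, norm_zero]; positivity
      · simp only [Finset.mem_filter, Finset.mem_Ico] at hn
        obtain ⟨⟨⟨hn2, hnN⟩, hw, hnp⟩, hlog⟩ := hn
        have hi : 2 ^ J ≤ i := by
          rw [← hlog]
          exact Nat.le_log_of_pow_le (by norm_num) hw
        have hX : 2 ^ i ≤ n.minFac := by rw [← hlog]; exact Nat.pow_log_le_self 2 (Nat.minFac_pos n).ne'
        have hXN : 2 ^ i * 2 ^ i ≤ N := by
          have := Nat.minFac_sq_le_self (by omega) hnp
          have : 2 ^ i * 2 ^ i ≤ n.minFac * n.minFac := Nat.mul_le_mul hX hX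
          nlinarith
        rw [fiber_eq _ _ _ _ hi]
        have hi1 : 1 ≤ i := Nat.one_le_two_pow.trans hi
        refine Real.le_sqrt_of_sq_le ((dyadic h hL hL0 hL1 hq a ha θ N i hi1
          ((Nat.pow_le_pow_right (by norm_num) hJ).trans hi) hXN s hs1 hs hD1 ?_ _
          (fun κ => min (N / κ) κ.minFac) ?_).trans ?_)
        · refine hc.trans ?_
          gcongr
          norm_num
        · intro κ hκ
          simp only [Finset.mem_filter, Finset.mem_Ico] at hκ ⊢
          refine ⟨⟨by omega, hκ.1.2⟩, fun p hp hd => ?_⟩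
          have h3 := Finset.mem_range.1 (Finset.mem_filter.1 hp).1
          have h4 := Nat.minFac_le_of_dvd (ps_prime hp).two_le hd
          have h5 : 2 ^ 2 ^ J2 ≤ 2 ^ 2 ^ J :=
            Nat.pow_le_pow_right (by norm_num) (Nat.pow_le_pow_right (by norm_num) hJ)
          omega
        · have : (2:ℝ) ^ J ≤ i := by exact_mod_cast hi
          gcongr
    · rw [Finset.card_range, nsmul_eq_mul]; push_cast; rfl
  · intro n hn
    simp only [Finset.mem_filter, Finset.mem_Ico] at hn
    rw [Finset.mem_range]
    have : Nat.log 2 n.minFac ≤ Nat.log 2 N :=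
      Nat.log_mono_right ((Nat.minFac_le (by omega)).trans (by omega))
    omega
end DPM
namespace DPM
open Finset

theorem rough_iff {q J n : ℕ} (hq : 0 < q) (hqw : q < 2 ^ 2 ^ J) (hn : 2 ≤ n) :
    (Nat.Coprime n q ∧ ∀ p ∈ ps J q, ¬ p ∣ n) ↔ 2 ^ 2 ^ J ≤ n.minFac := by
  have hp := Nat.minFac_prime (show n ≠ 1 by omega)
  constructor
  · rintro ⟨h1, h2⟩
    by_contra h
    push Not at h
    refine h2 n.minFac (Finset.mem_filter.2 ⟨Finset.mem_range.2 h, hp, fun h3 => ?_⟩) (Nat.minFac_dvd n)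
    exact hp.one_lt.ne' (Nat.dvd_one.1 (h1 ▸ Nat.dvd_gcd (Nat.minFac_dvd n) h3))
  · intro h
    refine ⟨?_, fun p hp1 hd => ?_⟩
    · refine Nat.coprime_of_dvd fun p hp1 hd hdq => ?_
      have := Nat.minFac_le_of_dvd hp1.two_le hd
      have := Nat.le_of_dvd hq hdq
      omega
    · have h3 := Finset.mem_range.1 (Finset.mem_filter.1 hp1).1
      have := Nat.minFac_le_of_dvd (ps_prime hp1).two_le hd
      omega

theorem prime_split (β : ℝ) (N q J : ℕ) (hq : 0 < q) (hqw : q < 2 ^ 2 ^ J) (hN : 0 < N) :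
    ‖∑ n ∈ Ico 1 (N + 1) with n.Prime, ee (n * β)‖ ≤
      ‖∑ n ∈ Ico 1 (N + 1) with Nat.Coprime n q ∧ (∀ p ∈ ps J q, ¬ p ∣ n), ee (n * β)‖ +
      ‖∑ n ∈ Ico 2 (N + 1) with 2 ^ 2 ^ J ≤ n.minFac ∧ ¬ n.Prime, ee (n * β)‖ + (2 ^ 2 ^ J + 1) := by
  set w := 2 ^ 2 ^ J with hw
  have e1 : ∑ n ∈ Ico 1 (N + 1) with Nat.Coprime n q ∧ (∀ p ∈ ps J q, ¬ p ∣ n), ee (n * β) =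
      ee ((1:ℕ) * β) + ∑ n ∈ Ico 2 (N + 1) with w ≤ n.minFac, ee (n * β) := by
    rw [Finset.sum_filter, Finset.sum_eq_sum_Ico_succ_bot (by omega), Finset.sum_filter, if_pos]
    · congr 1
      refine Finset.sum_congr rfl fun n hn => ?_
      have hn2 : 2 ≤ n := (Finset.mem_Ico.1 hn).1
      simp only [rough_iff hq hqw hn2, ← hw]
    · exact ⟨Nat.coprime_one_left q, fun p hp h => (ps_prime hp).one_lt.ne' (Nat.dvd_one.1 h)⟩
  have e2 : ∑ n ∈ Ico 1 (N + 1) with n.Prime, ee (n * β) =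
      ∑ n ∈ Ico 2 (N + 1) with w ≤ n.minFac ∧ n.Prime, ee (n * β) +
      ∑ n ∈ Ico 2 (N + 1) with n < w ∧ n.Prime, ee (n * β) := by
    rw [Finset.sum_filter, Finset.sum_eq_sum_Ico_succ_bot (by omega), if_neg Nat.not_prime_one, zero_add,
      Finset.sum_filter, Finset.sum_filter, ← Finset.sum_add_distrib]
    refine Finset.sum_congr rfl fun n hn => ?_
    by_cases hp : n.Prime
    · rcases lt_or_ge n w with h | h
      · simp [hp, hp.minFac_eq, h, not_le.2 h]
      · simp [hp, hp.minFac_eq, h, not_lt.2 h]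
    · simp [hp]
  have e3 : ∑ n ∈ Ico 2 (N + 1) with w ≤ n.minFac, ee (n * β) =
      ∑ n ∈ Ico 2 (N + 1) with w ≤ n.minFac ∧ n.Prime, ee (n * β) +
      ∑ n ∈ Ico 2 (N + 1) with w ≤ n.minFac ∧ ¬ n.Prime, ee (n * β) := by
    rw [← Finset.filter_filter, ← Finset.filter_filter, Finset.sum_filter_add_sum_filter_not]
  have e4 : ‖∑ n ∈ Ico 2 (N + 1) with n < w ∧ n.Prime, ee (n * β)‖ ≤ 2 ^ 2 ^ J := by
    refine (norm_sum_le _ _).trans ?_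
    simp only [norm_ee, Finset.sum_const, nsmul_eq_mul, mul_one]
    have : #((Ico 2 (N + 1)).filter fun n => n < w ∧ n.Prime) ≤ #(range w) :=
      Finset.card_le_card fun n hn => Finset.mem_range.2 (Finset.mem_filter.1 hn).2.1
    rw [Finset.card_range] at this
    exact_mod_cast this
  rw [e1, e2, e3]
  generalize ∑ n ∈ Ico 2 (N + 1) with w ≤ n.minFac ∧ n.Prime, ee (n * β) = x at *
  generalize ∑ n ∈ Ico 2 (N + 1) with w ≤ n.minFac ∧ ¬ n.Prime, ee (n * β) = y at *
  generalize ∑ n ∈ Ico 2 (N + 1) with n < w ∧ n.Prime, ee (n * β) = z at *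
  have h1 : x + z = (ee ((1:ℕ) * β) + (x + y)) - y + z - ee ((1:ℕ) * β) := by ring
  rw [h1]
  have h2 := norm_ee ((1:ℕ) * β)
  have h3 := norm_sub_le (ee ((1:ℕ) * β) + (x + y) - y + z) (ee ((1:ℕ) * β))
  have h4 := norm_add_le (ee ((1:ℕ) * β) + (x + y) - y) z
  have h5 := norm_sub_le (ee ((1:ℕ) * β) + (x + y)) y
  linarith
end DPM
namespace DPM
open Finset

theorem polyexp : ∃ K : ℝ, 1 ≤ K ∧ ∀ b : ℕ, ((b:ℝ) + 1) ^ 56 ≤ K * 2 ^ b := by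
  have h := tendsto_pow_const_div_const_pow_of_one_lt 56 (r := (2:ℝ)) (by norm_num)
  obtain ⟨K, hK⟩ := h.bddAbove_range
  refine ⟨2 * max K 1, by linarith [le_max_right K 1], fun b => ?_⟩
  have h1 := hK ⟨b + 1, rfl⟩
  beta_reduce at h1
  rw [div_le_iff₀ (by positivity)] at h1
  push_cast at h1
  calc ((b:ℝ) + 1) ^ 56 ≤ K * 2 ^ (b + 1) := h1
    _ ≤ max K 1 * 2 ^ (b + 1) := by gcongr; exact le_max_left _ _
    _ = _ := by ring

theorem comb3 {x x1 x2 x3 A1 A2 A3 Q M : ℝ} (h0 : 0 ≤ x) (h1 : 0 ≤ x1) (h2 : 0 ≤ x2) (h3 : 0 ≤ x3)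
    (h : x ≤ x1 + x2 + x3) (hQ : 0 ≤ Q) (a1 : x1 ^ 16 * Q ≤ A1 * M) (a2 : x2 ^ 16 * Q ≤ A2 * M)
    (a3 : x3 ^ 16 * Q ≤ A3 * M) : x ^ 16 * Q ≤ 2 ^ 30 * (A1 + A2 + A3) * M := by
  have e1 : x ^ 16 ≤ (x1 + x2 + x3) ^ 16 := by gcongr
  have e2 := add_pow_le (add_nonneg h1 h2) h3 16
  have e3 := add_pow_le h1 h2 16
  have e4 : 0 ≤ x3 ^ 16 := by positivity
  norm_num at e2 e3
  have e5 : x ^ 16 ≤ 2 ^ 30 * (x1 ^ 16 + x2 ^ 16 + x3 ^ 16) := by linarith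
  nlinarith [mul_le_mul_of_nonneg_right e5 hQ]

theorem typeII_num {x lam B L E c N q s Δ K : ℝ} {b : ℕ} (hlam : 1 ≤ lam) (hc : 0 < c) (hE : 1 ≤ E)
    (hN : 0 ≤ N) (hq : 1 ≤ q) (hs : 1 ≤ s) (hΔ : Δ = q * s ^ 2) (hB : B = b + 1)
    (hL : L = 128 * E * B / c) (hcl : lam ≤ 24 * B * c) (hK : B ^ 56 ≤ K * 2 ^ b) (hb : 2 ^ b ≤ 4 * Δ) (hK0 : 1 ≤ K)
    (hx0 : 0 ≤ x) (hx : x ≤ (lam + 1) * √(56 * L ^ 3 * N ^ 2 / (c * (q * s)))) :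
    (x * lam) ^ 16 * Δ ^ 3 ≤ ((224 * (128 * E) ^ 3 * 24 ^ 4) ^ 8 * (4 * K)) * N ^ 16 := by
  have hB1 : 1 ≤ B := by rw [hB]; linarith [Nat.cast_nonneg (α := ℝ) b]
  have hL0 : 0 ≤ L := by rw [hL]; positivity
  set C := 224 * (128 * E) ^ 3 * 24 ^ 4 with hC
  have hC0 : 0 < C := by positivity
  have h1 : (x * lam) ^ 2 ≤ C * B ^ 7 * N ^ 2 / (q * s) := by
    have e1 : x ^ 2 ≤ (2 * lam) ^ 2 * (56 * L ^ 3 * N ^ 2 / (c * (q * s))) := by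
      calc x ^ 2 ≤ ((lam + 1) * √(56 * L ^ 3 * N ^ 2 / (c * (q * s)))) ^ 2 := by gcongr
        _ = (lam + 1) ^ 2 * (56 * L ^ 3 * N ^ 2 / (c * (q * s))) := by
            rw [mul_pow, Real.sq_sqrt (by positivity)]
        _ ≤ _ := by gcongr; linarith
    have e2 : (2 * lam) ^ 2 * (56 * L ^ 3 * N ^ 2 / (c * (q * s))) * lam ^ 2 =
        224 * (128 * E) ^ 3 * B ^ 3 * N ^ 2 / (q * s) * (lam ^ 4 / c ^ 4) := by
      rw [hL]; field_simp; ring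
    have e3 : lam ^ 4 / c ^ 4 ≤ 24 ^ 4 * B ^ 4 := by
      rw [div_le_iff₀ (by positivity)]
      calc lam ^ 4 ≤ (24 * B * c) ^ 4 := by gcongr
        _ = _ := by ring
    calc (x * lam) ^ 2 = x ^ 2 * lam ^ 2 := by ring
      _ ≤ (2 * lam) ^ 2 * (56 * L ^ 3 * N ^ 2 / (c * (q * s))) * lam ^ 2 := by gcongr
      _ = _ := e2
      _ ≤ 224 * (128 * E) ^ 3 * B ^ 3 * N ^ 2 / (q * s) * (24 ^ 4 * B ^ 4) := by gcongr
      _ = _ := by rw [hC]; ring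
  have hΔ1 : 1 ≤ Δ := by rw [hΔ]; nlinarith [one_le_pow₀ (n := 2) hs]
  have h2 : Δ ^ 4 ≤ (q * s) ^ 8 := by
    have : (q * s) ^ 8 = (q * Δ) ^ 4 := by rw [hΔ]; ring
    rw [this]
    have : Δ ≤ q * Δ := by nlinarith
    gcongr
  calc (x * lam) ^ 16 * Δ ^ 3 = ((x * lam) ^ 2) ^ 8 * Δ ^ 3 := by ring
    _ ≤ (C * B ^ 7 * N ^ 2 / (q * s)) ^ 8 * Δ ^ 3 := by gcongr
    _ = C ^ 8 * B ^ 56 * N ^ 16 * Δ ^ 3 / (q * s) ^ 8 := by rw [div_pow]; ring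
    _ ≤ C ^ 8 * (K * (4 * Δ)) * N ^ 16 * Δ ^ 3 / Δ ^ 4 := by
        have : B ^ 56 ≤ K * (4 * Δ) := hK.trans (by gcongr)
        gcongr
    _ = _ := by field_simp

theorem typeI_num {x lam B C1 c N Δ K v G : ℝ} {b : ℕ} (hlam : 1 ≤ lam) (hc : 0 < c)
    (hN : 0 ≤ N) (hΔ1 : 1 ≤ Δ) (hB1 : 1 ≤ B) (hC1 : 0 < C1)
    (hcl : lam ≤ 24 * B * c) (hK : B ^ 56 ≤ K * 2 ^ b) (hb : 2 ^ b ≤ 4 * Δ) (hK0 : 1 ≤ K)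
    (hv0 : 0 ≤ v) (hv : v ≤ 2 * B / c) (hG0 : 0 ≤ G) (hG : G ≤ C1 / Δ) (hx : x = v * N * G) :
    (x * lam) ^ 16 * Δ ^ 3 ≤ ((48 * C1) ^ 16 * (4 * K)) * N ^ 16 := by
  have h1 : x * lam ≤ 48 * C1 * B ^ 2 * N / Δ := by
    rw [hx]
    calc v * N * G * lam ≤ (2 * B / c) * N * (C1 / Δ) * (24 * B * c) := by gcongr
      _ = _ := by field_simp; ring
  have h0 : 0 ≤ x * lam := by rw [hx]; positivity
  have h2 : B ^ 32 ≤ K * (4 * Δ) := (pow_le_pow_right₀ hB1 (by norm_num)).trans (hK.trans (by gcongr))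
  calc (x * lam) ^ 16 * Δ ^ 3 ≤ (48 * C1 * B ^ 2 * N / Δ) ^ 16 * Δ ^ 3 := by gcongr
    _ = (48 * C1) ^ 16 * B ^ 32 * N ^ 16 * Δ ^ 3 / Δ ^ 16 := by rw [div_pow]; ring
    _ ≤ (48 * C1) ^ 16 * (K * (4 * Δ)) * N ^ 16 * Δ ^ 3 / Δ ^ 4 := by
        gcongr
        norm_num
    _ = _ := by field_simp

theorem nat_num {lam b J : ℕ} (h1 : 3072 * (b + 1) ≤ lam) (hJ : 2 ^ J * (2 * (4 * b + 6)) ≤ lam) :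
    2 ^ (2 ^ J * (4 * b + 6)) * (11 * (2 ^ b) ^ 3 * lam) ≤ 2 ^ lam := by
  set r := lam / 16 with hr
  have e1 : lam ≤ 2 ^ (4 + r) := by
    have : r + 1 ≤ 2 ^ r := Nat.lt_two_pow_self
    rw [pow_add]
    omega
  calc 2 ^ (2 ^ J * (4 * b + 6)) * (11 * (2 ^ b) ^ 3 * lam)
      ≤ 2 ^ (lam / 2) * (2 ^ 4 * (2 ^ b) ^ 3 * 2 ^ (4 + r)) := by
        gcongr
        · norm_num
        · rw [Nat.le_div_iff_mul_le (by norm_num)]; linarith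
        · norm_num
    _ = 2 ^ (lam / 2 + (4 + b * 3 + (4 + r))) := by rw [← pow_mul]; simp only [pow_add]
    _ ≤ 2 ^ lam := Nat.pow_le_pow_right (by norm_num) (by omega)

theorem delta_num {δ Δ E : ℝ} {b : ℕ} (hE : E = Real.exp GG) (hd0 : 0 ≤ δ) (h : 1 + 2 * δ ≤ Real.exp (GG / 2 ^ b))
    (hΔ1 : 1 ≤ Δ) (hΔ : Δ ≤ 2 ^ b) : 2 * (1 + δ) / Δ + δ ≤ (2 * E + GG * E) / Δ := by
  have hG : 0 < GG := by unfold GG; positivity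
  have hb : (1:ℝ) ≤ 2 ^ b := hΔ1.trans hΔ
  set x := GG / 2 ^ b with hx
  have hx0 : 0 ≤ x := by positivity
  have hxG : x ≤ GG := div_le_self hG.le hb
  have hxE : Real.exp x ≤ E := by rw [hE]; exact Real.exp_le_exp.2 hxG
  have h2 : Real.exp x - 1 ≤ x * Real.exp x := by
    have := Real.add_one_le_exp (-x)
    have e : Real.exp (-x) * Real.exp x = 1 := by rw [← Real.exp_add]; simp
    have := mul_le_mul_of_nonneg_right this (Real.exp_pos x).le
    linarith
  have hE0 : 0 < E := by rw [hE]; positivity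
  have h3 : x * Real.exp x ≤ GG / Δ * E := by
    have : x ≤ GG / Δ := by rw [hx]; gcongr
    gcongr
  have e : (2 * E + GG * E) / Δ = 2 * E / Δ + GG / Δ * E := by ring
  rw [e]
  have : 2 * (1 + δ) / Δ ≤ 2 * E / Δ := by gcongr; linarith
  linarith
end DPM
namespace DPM
open Finset

set_option maxHeartbeats 2000000 in
theorem major_aux (K : ℝ) (hK1 : 1 ≤ K) (hK : ∀ b : ℕ, ((b:ℝ) + 1) ^ 56 ≤ K * 2 ^ b) (E : ℝ) (hE : E = Real.exp GG)
    (N q b : ℕ) (a : ℤ) (θ : ℝ) (hq : 0 < q) (ha : IsCoprime a (q:ℤ))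
    (hb1 : q * (1 + N * |θ|) ≤ 2 ^ b) (hb2 : 2 ^ b ≤ 4 * (q * (1 + N * |θ|)))
    (hlamC : 3072 * E * ((b:ℝ) + 1) ^ 2 ≤ Nat.log 2 N) :
    (‖∑ n ∈ Ico 1 (N + 1) with n.Prime, ee (n * (a / q + θ))‖ * Nat.log 2 N) ^ 16 * (q * (1 + N * |θ|)) ^ 3 ≤
      2 ^ 30 * ((48 * (2 * E + GG * E)) ^ 16 * (4 * K) + (224 * (128 * E) ^ 3 * 24 ^ 4) ^ 8 * (4 * K) + 1) * N ^ 16 := by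
  have hG : 0 < GG := by unfold GG; positivity
  have hE1 : 1 ≤ E := by rw [hE]; exact Real.one_le_exp hG.le
  set lam := Nat.log 2 N with hlam
  set τ : ℝ := 1 + N * |θ| with hτ
  have hτ1 : 1 ≤ τ := by rw [hτ]; linarith [mul_nonneg (Nat.cast_nonneg (α := ℝ) N) (abs_nonneg θ)]
  have hq1 : (1:ℝ) ≤ q := by exact_mod_cast hq
  set Δ : ℝ := q * τ with hΔ
  have hqΔ : (q:ℝ) ≤ Δ := by rw [hΔ]; nlinarith
  have hτΔ : τ ≤ Δ := by rw [hΔ]; nlinarith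
  have hΔ1 : 1 ≤ Δ := hq1.trans hqΔ
  have hB1 : (1:ℝ) ≤ (b:ℝ) + 1 := by linarith [Nat.cast_nonneg (α := ℝ) b]
  have hl1 : 3072 * (b + 1) ≤ lam := by
    have : (3072:ℝ) * (b + 1) ≤ 3072 * E * ((b:ℝ) + 1) ^ 2 := by
      have : (1:ℝ) * (b + 1) ≤ E * ((b:ℝ) + 1) ^ 2 := by gcongr; nlinarith
      linarith
    exact_mod_cast this.trans hlamC
  have hN0 : N ≠ 0 := by rintro rfl; simp [hlam] at hl1
  have hNp : 2 ^ lam ≤ N := Nat.pow_log_le_self 2 hN0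
  set m := 2 * (4 * b + 6) with hm
  set J := Nat.log 2 (lam / m) with hJ
  have hlm : lam / m ≠ 0 := by
    have : 1 ≤ lam / m := by rw [Nat.le_div_iff_mul_le (by omega)]; omega
    omega
  have hJ1 : 2 ^ J * m ≤ lam := by
    rw [← Nat.le_div_iff_mul_le (by omega)]; exact Nat.pow_log_le_self 2 hlm
  have hJ2 : lam < 2 ^ (J + 1) * m := by
    rw [← Nat.div_lt_iff_lt_mul (by omega)]; exact Nat.lt_pow_succ_log_self (by norm_num) _
  have hcl : (lam:ℝ) ≤ 24 * ((b:ℝ) + 1) * 2 ^ J := by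
    have h1 : lam ≤ 24 * (b + 1) * 2 ^ J := by
      refine hJ2.le.trans ?_
      rw [pow_succ, hm]
      nlinarith [Nat.two_pow_pos J]
    exact_mod_cast h1
  have hEJ : 128 * E * ((b:ℝ) + 1) ≤ 2 ^ J := by
    have h1 := hlamC.trans hcl
    have : (24 * ((b:ℝ) + 1)) * (128 * E * ((b:ℝ) + 1)) ≤ (24 * ((b:ℝ) + 1)) * 2 ^ J := by linarith
    exact le_of_mul_le_mul_left this (by linarith)
  have hbJ : 128 * (b + 1) ≤ 2 ^ J := by
    have : 128 * 1 * ((b:ℝ) + 1) ≤ 128 * E * ((b:ℝ) + 1) := by gcongr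
    have : (128:ℝ) * (b + 1) ≤ 2 ^ J := by linarith
    exact_mod_cast this
  have hJ7 : 7 ≤ J := (Nat.pow_le_pow_iff_right (a := 2) (by norm_num)).1 (le_trans (by omega) hbJ)
  have hqb : q ≤ 2 ^ b := by
    have : (q:ℝ) ≤ 2 ^ b := hqΔ.trans hb1
    exact_mod_cast this
  have hqw : q < 2 ^ 2 ^ J := hqb.trans_lt (Nat.pow_lt_pow_right (by norm_num) (by omega))
  have hlq : (Nat.log 2 q : ℝ) + 1 ≤ (b:ℝ) + 1 := by
    have : Nat.log 2 q ≤ b := by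
      have := Nat.log_mono_right (b := 2) hqb
      rwa [Nat.log_pow (by norm_num)] at this
    have : (Nat.log 2 q : ℝ) ≤ b := by exact_mod_cast this
    linarith
  have hsplit := prime_split (a / q + θ) N q J hq hqw (Nat.pos_of_ne_zero hN0)
  obtain ⟨δ, ι, I, d, l, k, h, hδ⟩ := sieve_exists q J b
  obtain ⟨δ', ι', I', d', l', k', h', hδ'⟩ := sieve_exists q (J - 6) 0
  set D := 2 ^ (2 ^ J * (4 * b + 6)) with hD
  have hDN : (D:ℝ) * (11 * Δ ^ 3 * lam) ≤ N := by
    have h1 : D * (11 * (2 ^ b) ^ 3 * lam) ≤ N := (nat_num hl1 hJ1).trans hNp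
    have h2 : (D:ℝ) * (11 * (2 ^ b) ^ 3 * lam) ≤ N := by exact_mod_cast h1
    refine le_trans ?_ h2
    gcongr
  have hlam1 : (1:ℝ) ≤ lam := by
    have : 1 ≤ lam := by omega
    exact_mod_cast this
  have hΔ2 : Δ ≤ Δ ^ 2 := by nlinarith
  have hΔ3 : Δ ^ 2 ≤ Δ ^ 3 := pow_le_pow_right₀ hΔ1 (by norm_num)
  have hD0 : (1:ℝ) ≤ D := by
    have : 1 ≤ D := Nat.one_le_two_pow
    exact_mod_cast this
  have hΔl : Δ ^ 3 * 1 ≤ Δ ^ 3 * lam := by gcongr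
  have hI := typeI h hq a ha θ N (by
    rw [← hτ]
    calc 2 * (D:ℝ) * q ^ 2 * τ = D * (2 * (q * Δ)) := by rw [hΔ]; ring
      _ ≤ D * (11 * Δ ^ 3 * lam) := by
        have : q * Δ ≤ Δ * Δ := by gcongr
        refine mul_le_mul_of_nonneg_left ?_ (by linarith)
        nlinarith only [this, hΔ3, hΔl, hΔ1]
      _ ≤ N := hDN) (Nat.pos_of_ne_zero hN0) Nat.one_le_two_pow
  rw [← hτ, ← hΔ] at hI
  set v := vv (fun p => (1 / p : ℝ)) (ps J q) with hv
  have hv0 : 0 ≤ v := vv_nonneg _ inv01.2 _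
  have hvle : v ≤ 2 * ((b:ℝ) + 1) / 2 ^ J := (vv_le J q hq).trans (by gcongr)
  have hGG := delta_num hE h.d0 hδ hΔ1 hb1
  set G := 2 * (1 + δ) / Δ + δ with hGd
  have hG0 : 0 ≤ G := by have := h.d0; positivity
  have A1 := typeI_num (x := v * N * G) hlam1 (show (0:ℝ) < 2 ^ J by positivity) (Nat.cast_nonneg N) hΔ1 hB1
    (show 0 < 2 * E + GG * E by positivity) hcl (hK b) hb2 hK1 hv0 hvle hG0 hGG rfl
  -- type II
  set L : ℝ := 128 * E * ((b:ℝ) + 1) / 2 ^ J with hLd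
  have hL0 : 0 < L := by positivity
  have hL1 : L ≤ 1 := by rw [hLd, div_le_one (by positivity)]; exact hEJ
  have h2J : (2:ℝ) ^ J = 64 * 2 ^ (J - 6) := by
    rw [show (64:ℝ) = 2 ^ 6 by norm_num, ← pow_add]; congr 1; omega
  have hL : ∑ i ∈ I', l' i * mon (fun p => (1 / p : ℝ)) (d' i) ≤ L := by
    refine h'.tt.trans ?_
    have h1 := vv_le (J - 6) q hq
    have h2 : 1 + δ' ≤ E := by rw [pow_zero, div_one, ← hE] at hδ'; linarith [h'.d0]
    have h0 := vv_nonneg _ inv01.2 (ps (J - 6) q)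
    calc vv (fun p => (1 / p : ℝ)) (ps (J - 6) q) * (1 + δ') ≤ (2 * ((b:ℝ) + 1) / 2 ^ (J - 6)) * E := by
          have := h'.d0
          exact mul_le_mul (h1.trans (by gcongr)) h2 (by linarith) (by positivity)
      _ = L := by rw [hLd, h2J]; field_simp; ring
  have hs : √τ ^ 2 = τ := Real.sq_sqrt (by linarith)
  have hs1 : 1 ≤ √τ := Real.one_le_sqrt.2 hτ1
  have hII := typeII h' hL hL0 hL1 hq a ha θ N J (by omega) (√τ) hs1 (by rw [hs]) Nat.one_le_two_pow (by
    rw [hs, ← hΔ]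
    have hLJ : 1 / 2 ^ J ≤ L := by
      rw [hLd]; gcongr
      have : (1:ℝ) * 1 ≤ E * ((b:ℝ) + 1) := by gcongr
      linarith only [this]
    set j := 2 ^ (J - 6) with hj
    have hj2 : 2 ^ J = 64 * j := by exact_mod_cast h2J
    have key : 9 * 2 ^ (j * (4 * 0 + 6)) * (2 ^ b) ^ 2 * (2 ^ J) ^ 2 ≤ 2 ^ 2 ^ J := by
      rw [hj2]
      have h1 : j ≤ 2 ^ j := Nat.lt_two_pow_self.le
      have hj1 : 1 ≤ j := Nat.one_le_two_pow
      calc 9 * 2 ^ (j * (4 * 0 + 6)) * (2 ^ b) ^ 2 * (64 * j) ^ 2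
          ≤ 2 ^ 4 * 2 ^ (j * (4 * 0 + 6)) * (2 ^ b) ^ 2 * (2 ^ 6 * 2 ^ j) ^ 2 := by gcongr <;> norm_num
        _ = 2 ^ (4 + j * (4 * 0 + 6) + b * 2 + (6 + j) * 2) := by
            rw [← pow_add 2 6 j, ← pow_mul, ← pow_mul]; simp only [← pow_add]
        _ ≤ 2 ^ (64 * j) := Nat.pow_le_pow_right (by norm_num) (by omega)
    have key' : (9:ℝ) * 2 ^ (j * (4 * 0 + 6)) * (2 ^ b) ^ 2 * (2 ^ J) ^ 2 ≤ 2 ^ 2 ^ J := by exact_mod_cast key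
    push_cast
    calc (9:ℝ) * 2 ^ (j * (4 * 0 + 6)) * Δ ^ 2 ≤ 9 * 2 ^ (j * (4 * 0 + 6)) * (2 ^ b) ^ 2 := by gcongr
      _ = (1 / 2 ^ J) ^ 2 * (9 * 2 ^ (j * (4 * 0 + 6)) * (2 ^ b) ^ 2 * (2 ^ J) ^ 2) := by field_simp
      _ ≤ L ^ 2 * 2 ^ 2 ^ J := by gcongr)
  set x2 := ‖∑ n ∈ Ico 2 (N + 1) with 2 ^ 2 ^ J ≤ n.minFac ∧ ¬ n.Prime, ee (n * (a / q + θ))‖ with hx2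
  have A2 := typeII_num (Δ := Δ) hlam1 (show (0:ℝ) < 2 ^ J by positivity) hE1 (Nat.cast_nonneg N) hq1 hs1
    (by rw [hs]) rfl hLd hcl (hK b) hb2 hK1 (norm_nonneg _) hII
  -- remainder
  have hwD : (2:ℝ) ^ 2 ^ J ≤ D := by
    have : 2 ^ 2 ^ J ≤ D := Nat.pow_le_pow_right (by norm_num) (Nat.le_mul_of_pos_right _ (by omega))
    exact_mod_cast this
  set R : ℝ := D * (q ^ 2 + 8 * τ) + (2 ^ 2 ^ J + 1) with hR
  have hR0 : 0 ≤ R := by positivity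
  have hRle : R * lam ≤ N / Δ := by
    rw [le_div_iff₀ (by linarith)]
    refine le_trans ?_ hDN
    have h1 : R ≤ D * (11 * Δ ^ 2) := by
      have h2 : (D:ℝ) * (q ^ 2 + 8 * τ) ≤ D * (9 * Δ ^ 2) := by
        gcongr
        have : (q:ℝ) ^ 2 ≤ Δ ^ 2 := by gcongr
        linarith only [this, hτΔ, hΔ2]
      have h3 : (D:ℝ) * 1 ≤ D * Δ ^ 2 := by gcongr; linarith only [hΔ1, hΔ2]
      linarith only [h2, h3, hwD, hD0, hR]
    calc R * lam * Δ ≤ D * (11 * Δ ^ 2) * lam * Δ := by gcongr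
      _ = _ := by ring
  have A3 : (R * lam) ^ 16 * Δ ^ 3 ≤ 1 * (N:ℝ) ^ 16 := by
    calc (R * lam) ^ 16 * Δ ^ 3 ≤ (N / Δ) ^ 16 * Δ ^ 16 := by
          gcongr
          norm_num
      _ = _ := by field_simp
  refine comb3 (by positivity) (by positivity) (by positivity) (by positivity) ?_ (by positivity) A1 A2 A3
  rw [← add_mul, ← add_mul]
  gcongr
  linarith only [hsplit, hI, hR]

theorem major : ∃ C C3 : ℝ, 0 < C ∧ 1 ≤ C3 ∧ ∀ (N q b : ℕ) (a : ℤ) (θ : ℝ), 0 < q → IsCoprime a (q:ℤ) →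
    q * (1 + N * |θ|) ≤ 2 ^ b → 2 ^ b ≤ 4 * (q * (1 + N * |θ|)) → C3 * ((b:ℝ) + 1) ^ 2 ≤ Nat.log 2 N →
    (‖∑ n ∈ Ico 1 (N + 1) with n.Prime, ee (n * (a / q + θ))‖ * Nat.log 2 N) ^ 16 * (q * (1 + N * |θ|)) ^ 3 ≤
      C * N ^ 16 := by
  obtain ⟨K, hK1, hK⟩ := polyexp
  have hG : 0 < GG := by unfold GG; positivity
  have hE1 : 1 ≤ Real.exp GG := Real.one_le_exp hG.le
  exact ⟨_, 3072 * Real.exp GG, by positivity, by linarith, fun N q b a θ hq ha h1 h2 h3 =>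
    major_aux K hK1 hK (Real.exp GG) rfl N q b a θ hq ha h1 h2 h3⟩
end DPM
namespace DPM
open Finset

theorem pi_lower (N : ℕ) (hN : 16 ≤ N) :
    (N:ℝ) / 4 ≤ #{n ∈ Ico 1 (N + 1) | n.Prime} * (Nat.log 2 N : ℝ) := by
  have hc : #{n ∈ Ico 1 (N + 1) | n.Prime} = N.primeCounting := by
    rw [Nat.primeCounting, ← Nat.primesBelow_card_eq_primeCounting', Nat.primesBelow]
    congr 1
    ext n
    simp only [mem_filter, mem_Ico, mem_range]
    constructor
    · rintro ⟨h, h2⟩; exact ⟨h.2, h2⟩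
    · rintro ⟨h, h2⟩; exact ⟨⟨h2.one_le, h⟩, h2⟩
  rw [hc]
  have hN' : (16:ℝ) ≤ N := by exact_mod_cast hN
  have h := Chebyshev.pi_ge' (x := (N:ℝ)) (by linarith)
  rw [Nat.floor_natCast, div_le_iff₀ (Real.log_pos (by linarith))] at h
  have hl2 := Real.log_two_gt_d9
  have hl2' := Real.log_two_lt_d9
  have h1 : Real.log ((N:ℝ) + 2) ≤ 6 * Real.log 2 + (((N:ℝ) + 2) / 64 - 1) := by
    have h64 : Real.log ((N:ℝ) + 2) = Real.log 64 + Real.log (((N:ℝ) + 2) / 64) := by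
      rw [← Real.log_mul (by norm_num) (by positivity)]; congr 1; ring
    have : Real.log 64 = 6 * Real.log 2 := by
      rw [show (64:ℝ) = 2 ^ 6 by norm_num, Real.log_pow]; norm_num
    rw [h64, this]
    have := Real.log_le_sub_one_of_pos (show 0 < ((N:ℝ) + 2) / 64 by positivity)
    linarith
  have hlam : 4 ≤ Nat.log 2 N := by
    have := Nat.log_mono_right (b := 2) hN
    have h16 : Nat.log 2 16 = 4 := by
      rw [show (16:ℕ) = 2 ^ 4 by norm_num, Nat.log_pow (by norm_num)]
    omega
  have hlam' : (4:ℝ) ≤ Nat.log 2 N := by exact_mod_cast hlam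
  have hlog : Real.log N ≤ 2 * (Nat.log 2 N) * Real.log 2 := by
    have h2 : (N:ℝ) ≤ 2 ^ (Nat.log 2 N + 1) := by
      exact_mod_cast (Nat.lt_pow_succ_log_self (by norm_num : 1 < 2) N).le
    have := Real.log_le_log (by linarith) h2
    rw [Real.log_pow] at this
    push_cast at this
    nlinarith
  have hpi : (0:ℝ) ≤ N.primeCounting := by positivity
  have h3 : (N:ℝ) / 2 * Real.log 2 ≤ N.primeCounting * (2 * (Nat.log 2 N) * Real.log 2) := by
    calc (N:ℝ) / 2 * Real.log 2 ≤ ((N:ℝ) - 1) * Real.log 2 - Real.log ((N:ℝ) + 2) := by nlinarith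
      _ ≤ _ := h
      _ ≤ _ := by gcongr
  have h4 : (N:ℝ) / 2 * Real.log 2 ≤ (N.primeCounting * (2 * (Nat.log 2 N))) * Real.log 2 := by linarith
  have h5 := le_of_mul_le_mul_right h4 (by linarith)
  linarith

set_option maxHeartbeats 1000000 in
theorem minor (N : ℕ) (β M : ℝ) (hlam : 4 ≤ Nat.log 2 N) (hM : 1 ≤ M)
    (hS : (N:ℝ) ^ 2 * (16 * 2720 ^ 2 * (Nat.log 2 N : ℝ) ^ 10) ≤
       16 * (‖∑ n ∈ Ico 1 (N + 1) with n.Prime, ee (n * β)‖ * Nat.log 2 N) ^ 2 * M)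
    (hMN : 8 * (3 * M) ^ 3 ≤ N) :
    ∃ (q : ℕ) (a : ℤ) (θ : ℝ), 0 < q ∧ IsCoprime a (q:ℤ) ∧ β = a / q + θ ∧ q * (1 + N * |θ|) ≤ 6 * M := by
  set lam := Nat.log 2 N with hlamd
  set T := 3 * M with hT
  have hT1 : 1 ≤ T := by linarith
  have hTN : T ≤ N := by nlinarith [one_le_pow₀ (n := 2) hT1]
  have hN0 : (0:ℝ) < N := by linarith
  set n := ⌊(N:ℝ) / T⌋₊ with hn
  have hn1 : 0 < n := by
    rw [hn, Nat.floor_pos, le_div_iff₀ (by linarith)]; linarith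
  have hnle : (n:ℝ) ≤ N / T := Nat.floor_le (by positivity)
  have hngt : (N:ℝ) / T < n + 1 := Nat.lt_floor_add_one _
  obtain ⟨r, hr1, hr2⟩ := Real.exists_rat_abs_sub_le_and_den_le β hn1
  set q := r.den with hq
  have hq0 : 0 < q := r.den_pos
  have hq0' : (1:ℝ) ≤ q := by exact_mod_cast hq0
  have hqn : (q:ℝ) ≤ n := by exact_mod_cast hr2
  have hrr : (r:ℝ) = r.num / q := by rw [hq]; exact Rat.cast_def r
  have hcop : IsCoprime r.num (q:ℤ) := by
    rw [Int.isCoprime_iff_gcd_eq_one]; simpa [Int.gcd] using r.reduced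
  rw [hrr] at hr1
  have hn0' : (0:ℝ) < n := by exact_mod_cast hn1
  have hap : Approx β r.num q := by
    refine ⟨hq0, hcop, hr1.trans ?_⟩
    rw [pow_two]
    gcongr
    linarith
  set U := ⌈T⌉₊ with hU
  have hUT : T ≤ U := Nat.le_ceil _
  have hUT2 : (U:ℝ) ≤ 2 * T := by
    have := Nat.ceil_lt_add_one (show 0 ≤ T by linarith); linarith
  have hUN : U ^ 3 ≤ N := by
    have : (U:ℝ) ^ 3 ≤ N := by
      calc (U:ℝ) ^ 3 ≤ (2 * T) ^ 3 := by gcongr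
        _ = 8 * T ^ 3 := by ring
        _ ≤ _ := hMN
    exact_mod_cast this
  have hNT : (N:ℝ) / T ≤ N := div_le_self hN0.le hT1
  have hqN : q ≤ N := by
    have : (q:ℝ) ≤ N := by linarith
    exact_mod_cast this
  have hlam' : (4:ℝ) ≤ lam := by exact_mod_cast hlam
  have hll : 1 + Real.log (4 * N) ≤ 2 * lam := by
    have h2 : (N:ℝ) ≤ 2 ^ (lam + 1) := by
      exact_mod_cast (Nat.lt_pow_succ_log_self (by norm_num : 1 < 2) N).le
    have h3 : 4 * (N:ℝ) ≤ 2 ^ (lam + 3) := by rw [pow_add] at h2 ⊢; linarith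
    have := Real.log_le_log (by linarith) h3
    rw [Real.log_pow] at this
    push_cast at this
    have hl2 := Real.log_two_gt_d9
    have hl2' := Real.log_two_lt_d9
    nlinarith
  have hV : VHyp β r.num q N U (2 * lam) := ⟨hap, by
    have : (1:ℝ) ≤ U := by linarith
    exact_mod_cast this, hUN, hqN, hll⟩
  have hp := prime_exp hV
  set S := ‖∑ n ∈ Ico 1 (N + 1) with n.Prime, ee (n * β)‖ with hSd
  have hS0 : 0 ≤ S := norm_nonneg _
  have hU0 : (0:ℝ) < U := by linarith
  set X : ℝ := N * ((N : ℝ) / q + (N : ℝ) / U + q) with hX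
  have hX0 : 0 ≤ X := by positivity
  have h1 : (S * lam) ^ 2 ≤ 2720 ^ 2 * (lam:ℝ) ^ 10 * X := by
    calc (S * lam) ^ 2 ≤ (170 * (2 * (lam:ℝ)) ^ 4 * √X * lam) ^ 2 := by gcongr
      _ = 2720 ^ 2 * (lam:ℝ) ^ 10 * (√X) ^ 2 := by ring
      _ = _ := by rw [Real.sq_sqrt hX0]
  have h2 : (N:ℝ) ^ 2 ≤ X * M := by
    have hpos : (0:ℝ) < 16 * 2720 ^ 2 * (lam:ℝ) ^ 10 := by positivity
    refine le_of_mul_le_mul_right (hS.trans ?_) hpos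
    calc 16 * (S * lam) ^ 2 * M ≤ 16 * (2720 ^ 2 * (lam:ℝ) ^ 10 * X) * M := by gcongr
      _ = _ := by ring
  have h3 : (N:ℝ) ≤ M * (N / q) + M * (N / U) + M * q := by
    refine le_of_mul_le_mul_left ?_ hN0
    calc (N:ℝ) * N = N ^ 2 := by ring
      _ ≤ _ := h2
      _ = _ := by rw [hX]; ring
  have h4 : M * (N / U) ≤ N / 3 := by
    rw [← mul_div_assoc, div_le_div_iff₀ hU0 (by norm_num)]
    nlinarith
  have hT0 : 0 < T := by linarith
  have h5 : M * q ≤ N / 3 := by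
    have : (q:ℝ) * T ≤ N := by rw [← le_div_iff₀ hT0]; linarith
    nlinarith
  have hqT : (q:ℝ) ≤ T := by
    have h6 : (N:ℝ) / 3 ≤ M * (N / q) := by linarith
    rw [← mul_div_assoc, div_le_div_iff₀ (by norm_num) (by linarith)] at h6
    refine le_of_mul_le_mul_left (h6.trans_eq ?_) hN0
    rw [hT]; ring
  refine ⟨q, r.num, β - r.num / q, hq0, hcop, by ring, ?_⟩
  have h7 : (q:ℝ) * (N * |β - r.num / q|) ≤ T := by
    calc (q:ℝ) * (N * |β - r.num / q|) ≤ q * (N * (1 / ((n + 1) * q))) := by gcongr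
      _ = N / (n + 1) := by field_simp
      _ ≤ T := by
        rw [div_le_iff₀ (by linarith)]
        rw [div_lt_iff₀ hT0] at hngt
        linarith
  nlinarith
end DPM
namespace DPM
open Finset

theorem ev_big (B : ℝ) (hB : 0 < B) : ∃ l0 : ℕ, ∀ l : ℕ, l0 ≤ l → B * (l:ℝ) ^ 300 ≤ 2 ^ l := by
  have h := tendsto_pow_const_div_const_pow_of_one_lt 300 (r := (2:ℝ)) (by norm_num)
  have h2 := h.eventually (gt_mem_nhds (show (0:ℝ) < 1 / B by positivity))
  obtain ⟨l0, hl0⟩ := Filter.eventually_atTop.1 h2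
  refine ⟨l0, fun l hl => ?_⟩
  have h3 := hl0 l hl
  rw [div_lt_div_iff₀ (by positivity) hB] at h3
  linarith

set_option maxHeartbeats 1000000 in
theorem core_aux (D C C3 K W : ℝ) (hD : D = 16 * 2720 ^ 2 * 4096) (hC : 0 < C) (hC3 : 1 ≤ C3) (hK1 : 1 ≤ K)
    (hW : W = C3 ^ 28 * (4 * K * (6 * D) ^ 2))
    (hmaj : ∀ (N q b : ℕ) (a : ℤ) (θ : ℝ), 0 < q → IsCoprime a (q:ℤ) →
    q * (1 + N * |θ|) ≤ 2 ^ b → 2 ^ b ≤ 4 * (q * (1 + N * |θ|)) → C3 * ((b:ℝ) + 1) ^ 2 ≤ Nat.log 2 N →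
    (‖∑ n ∈ Ico 1 (N + 1) with n.Prime, ee (n * (a / q + θ))‖ * Nat.log 2 N) ^ 16 * (q * (1 + N * |θ|)) ^ 3 ≤
      C * N ^ 16) (hK : ∀ b : ℕ, ((b:ℝ) + 1) ^ 56 ≤ K * 2 ^ b)
    (ε : ℝ) (he : 0 < ε) (he1 : ε < 1) (N : ℕ) (hl4 : 4 ≤ Nat.log 2 N) (hlW : W ≤ Nat.log 2 N)
    (hl300 : (216 * D ^ 3) ^ 10 * (Nat.log 2 N : ℝ) ^ 300 ≤ N) (heN : 1 ≤ ε ^ 10 * N) (β : ℝ)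
    (hS : ε * √ε / 64 * #{n ∈ Ico 1 (N + 1) | n.Prime} < ‖∑ n ∈ Ico 1 (N + 1) with n.Prime, ee (n * β)‖) :
    ∃ (q : ℕ) (a : ℤ), 0 < q ∧ q * ε ^ 8 ≤ C * 256 ^ 16 + 1 ∧ N * |q * β - a| * ε ^ 8 ≤ C * 256 ^ 16 + 1 := by
  set lam := Nat.log 2 N with hlam
  have hD1 : 1 ≤ D := by rw [hD]; norm_num
  have hl4' : (4:ℝ) ≤ lam := by exact_mod_cast hl4
  have hN0 : N ≠ 0 := by rintro rfl; simp [hlam] at hl4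
  have hN16 : 16 ≤ N := by
    have := Nat.pow_le_of_le_log hN0 hl4
    simpa using this
  have hNpos : (0:ℝ) < N := by positivity
  have hpi := pi_lower N hN16
  set S := ‖∑ n ∈ Ico 1 (N + 1) with n.Prime, ee (n * β)‖ with hSd
  set s := √ε with hs
  have hs0 : 0 < s := Real.sqrt_pos.2 he
  have hs2 : s ^ 2 = ε := Real.sq_sqrt he.le
  have hy : ε * s * N ≤ 256 * (S * lam) := by
    have h1 : ε * s / 64 * (N / 4) ≤ ε * s / 64 * (#{n ∈ Ico 1 (N + 1) | n.Prime} * (lam:ℝ)) := by gcongr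
    have h2 : ε * s / 64 * #{n ∈ Ico 1 (N + 1) | n.Prime} * lam ≤ S * lam := by gcongr
    linarith only [h1, h2]
  clear hpi hS
  set L := 6 * D * (lam:ℝ) ^ 10 with hL
  have hL1 : 1 ≤ L := by
    rw [hL]; have := one_le_pow₀ (n := 10) (show (1:ℝ) ≤ lam by linarith only [hl4'])
    nlinarith only [this, hD1]
  have he3 : ε ^ 3 ≤ 1 := pow_le_one₀ he.le he1.le
  have hM1 : 1 ≤ D * (lam:ℝ) ^ 10 / ε ^ 3 := by
    rw [le_div_iff₀ (by positivity)]
    have := one_le_pow₀ (n := 10) (show (1:ℝ) ≤ lam by linarith only [hl4'])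
    nlinarith only [this, hD1, he3]
  have hm1 : (N:ℝ) ^ 2 * (16 * 2720 ^ 2 * (lam : ℝ) ^ 10) ≤
       16 * (S * lam) ^ 2 * (D * (lam:ℝ) ^ 10 / ε ^ 3) := by
    have h1 : (ε * s * N) ^ 2 ≤ (256 * (S * lam)) ^ 2 := by gcongr
    have h2 : (ε * s * N) ^ 2 = ε ^ 3 * N ^ 2 := by
      calc (ε * s * N) ^ 2 = ε ^ 2 * s ^ 2 * N ^ 2 := by ring
        _ = _ := by rw [hs2]; ring
    rw [h2] at h1
    rw [← mul_div_assoc, le_div_iff₀ (by positivity), hD]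
    calc (N:ℝ) ^ 2 * (16 * 2720 ^ 2 * (lam : ℝ) ^ 10) * ε ^ 3
        = (ε ^ 3 * N ^ 2) * (16 * 2720 ^ 2 * (lam : ℝ) ^ 10) := by ring
      _ ≤ (256 * (S * lam)) ^ 2 * (16 * 2720 ^ 2 * (lam : ℝ) ^ 10) := by gcongr
      _ = _ := by ring
  have hm2 : 8 * (3 * (D * (lam:ℝ) ^ 10 / ε ^ 3)) ^ 3 ≤ N := by
    have h1 : (216 * D ^ 3 * (lam:ℝ) ^ 30) ^ 10 ≤ (N * ε ^ 9) ^ 10 := by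
      calc (216 * D ^ 3 * (lam:ℝ) ^ 30) ^ 10 = (216 * D ^ 3) ^ 10 * (lam:ℝ) ^ 300 := by rw [mul_pow _ ((lam:ℝ) ^ 30), ← pow_mul]
        _ ≤ (N:ℝ) := hl300
        _ = (N:ℝ) * 1 := by ring
        _ ≤ N * (ε ^ 10 * N) ^ 9 := by gcongr; exact one_le_pow₀ heN
        _ = _ := by ring
    have h2 := le_of_pow_le_pow_left₀ (by norm_num) (by positivity) h1
    have h3 : 8 * (3 * (D * (lam:ℝ) ^ 10 / ε ^ 3)) ^ 3 = 216 * D ^ 3 * (lam:ℝ) ^ 30 / ε ^ 9 := by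
      field_simp; ring
    rw [h3, div_le_iff₀ (by positivity)]
    exact h2
  obtain ⟨q, a, θ, hq, hcop, hβ, hΔ⟩ := minor N β _ hl4 hM1 hm1 hm2
  set Δ : ℝ := q * (1 + N * |θ|) with hΔd
  have hq1 : (1:ℝ) ≤ q := by exact_mod_cast hq
  have hnn : 0 ≤ (N:ℝ) * |θ| := by positivity
  have hqΔ : (q:ℝ) ≤ Δ := by rw [hΔd]; nlinarith only [hnn, hq1]
  have hθΔ : (N:ℝ) * |q * β - a| ≤ Δ := by
    have : (q:ℝ) * β - a = q * θ := by rw [hβ]; field_simp; ring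
    rw [this, abs_mul, Nat.abs_cast, hΔd]
    nlinarith only [hnn, hq1]
  have hΔL : Δ * ε ^ 3 ≤ L := by
    have : 6 * (D * (lam:ℝ) ^ 10 / ε ^ 3) = L / ε ^ 3 := by rw [hL]; ring
    rw [this, le_div_iff₀ (by positivity)] at hΔ
    exact hΔ
  suffices hfin : Δ * ε ^ 8 ≤ C * 256 ^ 16 + 1 by
    refine ⟨q, a, hq, le_trans ?_ hfin, le_trans ?_ hfin⟩
    · gcongr
    · gcongr
  have hΔ1 : 1 ≤ Δ := hq1.trans hqΔ
  clear hm1 hm2 hM1 hl300 hΔ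
  rcases le_or_gt (L * ε ^ 5) 1 with hA | hB
  · calc Δ * ε ^ 8 = Δ * ε ^ 3 * ε ^ 5 := by ring
      _ ≤ L * ε ^ 5 := by gcongr
      _ ≤ 1 := hA
      _ ≤ _ := by linarith only [mul_pos hC (show (0:ℝ) < 256 ^ 16 by positivity)]
  have hLe3 : 1 ≤ L * ε ^ 3 := by
    refine hB.le.trans ?_
    have : ε ^ 5 ≤ ε ^ 3 := pow_le_pow_of_le_one he.le he1.le (by norm_num)
    gcongr
  have hΔ2 : Δ ≤ L ^ 2 := by
    have : Δ * ε ^ 3 ≤ L ^ 2 * ε ^ 3 := by nlinarith only [hΔL, hLe3, hL1]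
    exact le_of_mul_le_mul_right this (by positivity)
  obtain ⟨n, hn1, hn2⟩ := exists_nat_pow_near hΔ1 (show (1:ℝ) < 2 by norm_num)
  have hb2 : (2:ℝ) ^ (n + 1) ≤ 4 * Δ := by rw [pow_succ]; linarith only [hn1, hΔ1]
  have hlb : C3 * (((n + 1 : ℕ):ℝ) + 1) ^ 2 ≤ lam := by
    have h1 : (C3 * (((n + 1 : ℕ):ℝ) + 1) ^ 2) ^ 28 ≤ (lam:ℝ) ^ 28 := by
      calc (C3 * (((n + 1 : ℕ):ℝ) + 1) ^ 2) ^ 28 = C3 ^ 28 * (((n + 1 : ℕ):ℝ) + 1) ^ 56 := by ring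
        _ ≤ C3 ^ 28 * (K * 2 ^ (n + 1)) := by gcongr; exact hK _
        _ ≤ C3 ^ 28 * (K * (4 * L ^ 2)) := by gcongr; linarith only [hb2, hΔ2]
        _ = W * lam ^ 20 := by rw [hW, hL]; ring
        _ ≤ lam * lam ^ 20 := by gcongr
        _ = (lam:ℝ) ^ 21 := by ring
        _ ≤ _ := pow_le_pow_right₀ (by linarith only [hl4']) (by norm_num)
    exact le_of_pow_le_pow_left₀ (by norm_num) (by positivity) h1
  have hm := hmaj N q (n + 1) a θ hq hcop hn2.le hb2 hlb
  rw [← hβ] at hm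
  have h3 : (Δ * ε ^ 8) ^ 3 ≤ C * 256 ^ 16 := by
    have hN16p : (0:ℝ) < (N:ℝ) ^ 16 := by positivity
    refine le_of_mul_le_mul_right ?_ hN16p
    calc (Δ * ε ^ 8) ^ 3 * (N:ℝ) ^ 16 = Δ ^ 3 * (ε ^ 16 * ε ^ 8 * N ^ 16) := by ring
      _ = Δ ^ 3 * (ε * s * N) ^ 16 := by
        have : ε ^ 8 = s ^ 16 := by rw [← hs2]; ring
        rw [this]; ring
      _ ≤ Δ ^ 3 * (256 * (S * lam)) ^ 16 := by gcongr
      _ = 256 ^ 16 * ((S * lam) ^ 16 * Δ ^ 3) := by ring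
      _ ≤ 256 ^ 16 * (C * N ^ 16) := by gcongr
      _ = _ := by ring
  have hp : 0 < C * 256 ^ 16 := by positivity
  generalize C * 256 ^ 16 = Z at h3 hp
  by_contra! hcon
  have h4 : 1 ≤ Δ * ε ^ 8 := by linarith only [hcon, hp]
  have h5 := le_self_pow₀ h4 (show 3 ≠ 0 by norm_num)
  linarith only [h5, hcon, h3]

theorem core : ∃ (C7 : ℝ) (l0 : ℕ), 1 ≤ C7 ∧ ∀ ε : ℝ, 0 < ε → ε < 1 → ∀ N : ℕ, l0 ≤ Nat.log 2 N → 1 ≤ ε ^ 10 * N →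
    ∀ β : ℝ, ε * √ε / 64 * #{n ∈ Ico 1 (N + 1) | n.Prime} < ‖∑ n ∈ Ico 1 (N + 1) with n.Prime, ee (n * β)‖ →
    ∃ (q : ℕ) (a : ℤ), 0 < q ∧ q * ε ^ 8 ≤ C7 ∧ N * |q * β - a| * ε ^ 8 ≤ C7 := by
  obtain ⟨C, C3, hC, hC3, hmaj⟩ := major
  obtain ⟨K, hK1, hK⟩ := polyexp
  obtain ⟨D, hD⟩ : ∃ D : ℝ, D = 16 * 2720 ^ 2 * 4096 := ⟨_, rfl⟩
  have hD1 : 1 ≤ D := by rw [hD]; norm_num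
  obtain ⟨l1, hl1⟩ := ev_big ((216 * D ^ 3) ^ 10) (by positivity)
  obtain ⟨W, hW⟩ : ∃ W : ℝ, W = C3 ^ 28 * (4 * K * (6 * D) ^ 2) := ⟨_, rfl⟩
  refine ⟨C * 256 ^ 16 + 1, max 4 (max l1 ⌈W⌉₊), by linarith [mul_pos hC (show (0:ℝ) < 256 ^ 16 by positivity)],
    fun ε he he1 N hl heN β hS => ?_⟩
  have h4 : 4 ≤ Nat.log 2 N := le_trans (le_max_left _ _) hl
  have h5 : l1 ≤ Nat.log 2 N := le_trans (le_trans (le_max_left _ _) (le_max_right _ _)) hl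
  have h6 : ⌈W⌉₊ ≤ Nat.log 2 N := le_trans (le_trans (le_max_right _ _) (le_max_right _ _)) hl
  have hN0 : N ≠ 0 := by rintro rfl; simp at h4
  refine core_aux D C C3 K W hD hC hC3 hK1 hW hmaj hK ε he he1 N h4 (Nat.ceil_le.1 h6) ?_ heN β hS
  refine (hl1 _ h5).trans ?_
  exact_mod_cast Nat.pow_log_le_self 2 hN0

theorem final : ∃ A : ℝ, 0 < A ∧ ∀ ε : ℝ, 0 < ε → ε < 1 → ∀ P : ℝ, (ε ^ 10)⁻¹ ≤ P → ∀ α : ℝ,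
    (∀ (I : Set ℝ) (G s : Finset ℕ), I ⊆ Set.Icc 0 1 → I.OrdConnected →
      (∀ k, k ∈ s ↔ k ∈ Ico 1 (⌊P⌋₊ + 1) ∧ k.Prime) → (∀ k, k ∈ G ↔ k ∈ s ∧ Int.fract ((k:ℝ) * α) ∈ I) →
      |(#G : ℝ) / #s - (MeasureTheory.volume I).toReal| ≤ ε) ∨
    ∃ ℓ : ℕ, 1 ≤ ℓ ∧ (ℓ : ℝ) ≤ A * (ε ^ 10)⁻¹ ∧ |(ℓ : ℝ) * α - round ((ℓ : ℝ) * α)| ≤ A * (ε ^ 10)⁻¹ / P := by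
  obtain ⟨C7, l0, hC7, hcore⟩ := core
  refine ⟨34 * C7 + 2 * 2 ^ (l0 + 1), by positivity, fun ε he he1 P hP α => ?_⟩
  set A : ℝ := 34 * C7 + 2 * 2 ^ (l0 + 1) with hA
  have h2p : (1:ℝ) ≤ 2 ^ (l0 + 1) := one_le_pow₀ (by norm_num)
  have he10 : 0 < ε ^ 10 := by positivity
  have hei : 1 ≤ (ε ^ 10)⁻¹ := (one_le_inv₀ he10).2 (pow_le_one₀ he.le he1.le)
  have hP0 : 0 < P := by linarith
  rcases le_or_gt P (A * (ε ^ 10)⁻¹) with hsm | hlg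
  · right
    refine ⟨1, le_rfl, by push_cast; nlinarith, ?_⟩
    refine (abs_sub_round _).trans ?_
    rw [le_div_iff₀ hP0]; linarith
  rw [or_iff_not_imp_left]
  intro hno
  push Not at hno
  obtain ⟨I, G, s, hI, hIc, hs, hG, hbig⟩ := hno
  set N := ⌊P⌋₊ with hN
  have hPA : A < P := by nlinarith
  have hNP : P < N + 1 := Nat.lt_floor_add_one _
  have hP2 : P ≤ 2 * N := by linarith
  have hNp : (2:ℝ) ^ l0 ≤ N := by rw [pow_succ] at *; linarith
  have hNp' : 2 ^ l0 ≤ N := by exact_mod_cast hNp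
  have hN0 : 0 < N := lt_of_lt_of_le (by positivity) hNp'
  have hl : l0 ≤ Nat.log 2 N := Nat.le_log_of_pow_le (by norm_num) hNp'
  have hNR : (0:ℝ) < N := by exact_mod_cast hN0
  have heN : 1 ≤ ε ^ 10 * N := by
    have h1 : 2 * (ε ^ 10)⁻¹ ≤ P := by nlinarith
    have h2 : (ε ^ 10)⁻¹ ≤ N := by linarith
    calc (1:ℝ) = ε ^ 10 * (ε ^ 10)⁻¹ := by field_simp
      _ ≤ _ := by gcongr
  have hse : s = {n ∈ Ico 1 (N + 1) | n.Prime} := by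
    ext k; rw [hs, mem_filter]
  have hsne : s.Nonempty := by
    refine ⟨2, (hs 2).2 ⟨?_, Nat.prime_two⟩⟩
    rw [mem_Ico]
    refine ⟨by norm_num, ?_⟩
    have : (2:ℝ) ≤ N := by linarith
    have : 2 ≤ N := by exact_mod_cast this
    omega
  obtain ⟨n, hn1, hn2, hn3⟩ := disc_exp ε he he1 s hsne (fun k => Int.fract ((k:ℝ) * α))
    (fun k => Int.fract_nonneg _) (fun k => Int.fract_lt_one _) I hI hIc G hG hbig
  have hee : ∀ k ∈ s, ee (n * Int.fract ((k:ℝ) * α)) = ee (k * (n * α)) := by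
    intro k _
    rw [← ee_add_int (n * Int.fract ((k:ℝ) * α)) (n * ⌊(k:ℝ) * α⌋)]
    congr 1
    rw [← Int.self_sub_floor]
    push_cast
    ring
  rw [sum_congr rfl hee, hse] at hn3
  obtain ⟨q, a, hq, hq8, ha8⟩ := hcore ε he he1 N hl heN _ hn3
  have he8 : 0 < ε ^ 8 := by positivity
  refine ⟨n * q, Nat.mul_pos hn1 hq, ?_, ?_⟩
  · push_cast
    rw [← div_eq_mul_inv, le_div_iff₀ he10]
    have hn2' : n * ε ^ 2 ≤ 17 := by rwa [← le_div_iff₀ (by positivity)]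
    calc (n:ℝ) * q * ε ^ 10 = (n * ε ^ 2) * (q * ε ^ 8) := by ring
      _ ≤ 17 * C7 := by gcongr
      _ ≤ A := by rw [hA]; linarith
  · refine (round_le _ a).trans ?_
    have h1 : ((n * q : ℕ) : ℝ) * α - a = q * (n * α) - a := by push_cast; ring
    rw [h1, le_div_iff₀ hP0, ← div_eq_mul_inv, le_div_iff₀ he10]
    have h2 : |(q:ℝ) * (n * α) - a| * P * ε ^ 10 ≤ |(q:ℝ) * (n * α) - a| * (2 * N) * ε ^ 8 := by
      gcongr ?_ * ?_
      · gcongr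
      · exact pow_le_pow_of_le_one he.le he1.le (by norm_num)
    rw [hA]
    linarith
end DPM

open Filter MeasureTheory
open scoped Classical

theorem discrepancy_of_prime_multiples :
    ∃ A : ℝ, 0 < A ∧
      ∀ ε : ℝ, ε ∈ Set.Ioo (0 : ℝ) 1 → ∀ P : ℝ, ε ^ (-10 : ℤ) ≤ P → ∀ α : ℝ,
        (∀ I : Set ℝ, I ⊆ Set.Icc 0 1 → I.OrdConnected →
          |(((Finset.Icc 1 ⌊P⌋₊).filter
                (fun p : ℕ => Nat.Prime p ∧ Int.fract ((p : ℝ) * α) ∈ I)).card : ℝ) /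
              (((Finset.Icc 1 ⌊P⌋₊).filter (fun p : ℕ => Nat.Prime p)).card : ℝ) -
            (MeasureTheory.volume I).toReal| ≤ ε)
        ∨ ∃ ℓ : ℕ, 1 ≤ ℓ ∧ (ℓ : ℝ) ≤ A * ε ^ (-10 : ℤ) ∧
            |(ℓ : ℝ) * α - round ((ℓ : ℝ) * α)| ≤ A * ε ^ (-10 : ℤ) / P := by
  obtain ⟨A, hA, h⟩ := DPM.final
  refine ⟨A, hA, fun ε he P hP α => ?_⟩
  have hz : ε ^ (-10 : ℤ) = (ε ^ 10)⁻¹ := by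
    rw [zpow_neg]; norm_cast
  rw [hz] at hP ⊢
  rcases h ε he.1 he.2 P hP α with h1 | h1
  · left
    intro I hI hc
    refine h1 I _ _ hI hc (fun k => ?_) (fun k => ?_)
    · rw [Finset.mem_filter, Finset.mem_Icc, Finset.mem_Ico, Nat.lt_succ_iff]
    · rw [Finset.mem_filter, Finset.mem_filter, and_assoc]
  · right
    exact h1
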